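/- arXiv:2405.04154 — 2 statements merged into one kernel-verified Lean document; each statement's English description precedes it below -/
import Mathlib

section
/- There exists δ_g > 0 depending only on g such that for every real λ > 1 there exist a constant C > 0 and a threshold n₀ with the following property: for every integer n ≥ n₀, every finite set r of positive integers ≤ n with 1 ≤ |r| ≤ 2g+3, and each i ∈ {0, 1}, one has ∑_{x ∈ T^i_{n,r}} ∏_{y ∈ Set(x) \ r} λ^{-1} y^{-α} ≤ C · n^{-δ_g}, where T⁰_{n,r} = {x ∈ T_n : {x₁,x₂,x₃} ∩ r = ∅ and r ⊆ Set(x)} and T¹_{n,r} = {x ∈ T_n : 1 ≤ |{x₁,x₂,x₃} ∩ r| ≤ 2 and r ⊆ Set(x)}, and the product runs over the distinct elements of Set(x) not in r. The constants C, δ_g, n₀ do not depend on r. -/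
noncomputable section

open Real MeasureTheory ProbabilityTheory

def IsSidonZ {M : ℕ} (S : Set (ZMod M)) : Prop :=
  ∀ a ∈ S, ∀ b ∈ S, ∀ c ∈ S, ∀ d ∈ S, a + b = c + d → ({a, b} : Set (ZMod M)) = {c, d}

def Covers3 {M : ℕ} (S : Set (ZMod M)) : Prop :=
  ∀ z : ZMod M, ∃ s₁ ∈ S, ∃ s₂ ∈ S, ∃ s₃ ∈ S,
    s₁ ≠ s₂ ∧ s₁ ≠ s₃ ∧ s₂ ≠ s₃ ∧ z = s₁ + s₂ + s₃

def alph (g : ℕ) : ℝ := ((g : ℝ) + 1) / (2 * (g : ℝ) + 1)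

def glam (g : ℕ) (lam : ℝ) (n : ℕ) : ℝ :=
  lam ^ ((2 * (g : ℝ) + 5) / (1 - alph g)) * (n : ℝ) ^ ((1 : ℝ) / (g : ℝ)) *
    Real.log n ^ ((1 : ℝ) / (1 - alph g))

def GoodS (M : ℕ) (CM : Set (ZMod M)) (s : ℕ → Fin 3 → ZMod M) : Prop :=
  ∀ n : ℕ, (∀ i, s n i ∈ CM) ∧ s n 0 ≠ s n 1 ∧ s n 0 ≠ s n 2 ∧ s n 1 ≠ s n 2 ∧
    s n 0 + s n 1 + s n 2 = (n : ZMod M)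

def Rtrip (g M : ℕ) (lam : ℝ) (s : ℕ → Fin 3 → ZMod M) (n x₁ x₂ x₃ : ℕ) : Prop :=
  0 < x₁ ∧ 0 < x₂ ∧ 0 < x₃ ∧ x₁ + x₂ + x₃ = n ∧
  glam g lam n / 2 ≤ (x₁ : ℝ) ∧ (x₁ : ℝ) ≤ glam g lam n ∧
  (n : ℝ) / 4 ≤ (x₂ : ℝ) ∧ x₂ ≤ n ∧ (n : ℝ) / 4 ≤ (x₃ : ℝ) ∧ x₃ ≤ n ∧
  (x₁ : ZMod M) = s n 0 ∧ (x₂ : ZMod M) = s n 1 ∧ (x₃ : ZMod M) = s n 2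

def Rn (g M : ℕ) (lam : ℝ) (s : ℕ → Fin 3 → ZMod M) (n : ℕ) : Set (Finset ℕ) :=
  {ω | ∃ x₁ x₂ x₃ : ℕ, ω = {x₁, x₂, x₃} ∧ Rtrip g M lam s n x₁ x₂ x₃}

def imgF {m : ℕ} (x : Fin m → ℕ) : Finset ℕ := Finset.image x Finset.univ

def firstThree (g : ℕ) (x : Fin (2 * g + 4) → ℕ) : Finset ℕ :=
  {x ⟨0, by omega⟩, x ⟨1, by omega⟩, x ⟨2, by omega⟩}

def pairOf (g : ℕ) (x : Fin (2 * g + 4) → ℕ) (j : ℕ) : Finset ℕ :=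
  if j = 0 then {x ⟨0, by omega⟩, x ⟨3, by omega⟩}
  else if h : j ≤ g then {x ⟨2 * j + 2, by omega⟩, x ⟨2 * j + 3, by omega⟩}
  else ∅

def Tn (g M : ℕ) (lam : ℝ) (s : ℕ → Fin 3 → ZMod M) (n : ℕ) :
    Set (Fin (2 * g + 4) → ℕ) :=
  {x | (∀ i, 0 < x i) ∧
    firstThree g x ∈ Rn g M lam s n ∧
    (∀ j : ℕ, 2 ≤ j → ∀ _ : j ≤ g + 1,
      x ⟨0, by omega⟩ + x ⟨3, by omega⟩ = x ⟨2 * j, by omega⟩ + x ⟨2 * j + 1, by omega⟩) ∧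
    (∀ i : Fin (2 * g + 4), 3 ≤ (i : ℕ) → x i ≤ x ⟨0, by omega⟩) ∧
    (∀ k : ℕ, 2 ≤ k → ∀ _ : k ≤ g + 1,
      (x ⟨2 * k, by omega⟩ : ZMod M) = (x ⟨0, by omega⟩ : ZMod M) ∧
      (x ⟨2 * k + 1, by omega⟩ : ZMod M) = (x ⟨3, by omega⟩ : ZMod M)) ∧
    (∀ j k : ℕ, j ≤ g → k ≤ g → j ≠ k → pairOf g x j ≠ pairOf g x k)}

def TnInd (g M : ℕ) (lam : ℝ) (s : ℕ → Fin 3 → ZMod M) (n : ℕ) :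
    Set (Fin (2 * g + 4) → ℕ) :=
  {x ∈ Tn g M lam s n | Function.Injective x}

def TnDep (g M : ℕ) (lam : ℝ) (s : ℕ → Fin 3 → ZMod M) (n : ℕ) :
    Set (Fin (2 * g + 4) → ℕ) :=
  {x ∈ Tn g M lam s n | ¬ Function.Injective x}

def Vr (g : ℕ) (r₁ : ℕ) : Set (Fin (2 * g + 1) → ℕ) :=
  {v | (∀ i, 0 < v i) ∧
    (∀ t : ℕ, ∀ _ : t < g,
      r₁ + v ⟨0, by omega⟩ = v ⟨2 * t + 1, by omega⟩ + v ⟨2 * t + 2, by omega⟩) ∧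
    (∀ i, v i ≤ r₁) ∧ Function.Injective v ∧ (∀ i, v i ≠ r₁)}

def Tcal (X r : Finset ℕ) (k : ℕ) (eps : ℕ → ℤ) : Set (ℕ → ℕ) :=
  {y | (∀ j < k, y j ∈ X ∪ r) ∧ (∀ j, k ≤ j → y j = 0) ∧ (∃ j < k, y j ∈ X) ∧
    (∀ i < k, ∀ j < k, y i = y j → eps i = eps j)}

def Fval (k : ℕ) (eps : ℕ → ℤ) (y : ℕ → ℕ) : ℤ :=
  ∑ j ∈ Finset.range k, eps j * (y j : ℤ)

def Ccal (U X r : Finset ℕ) : Set (Finset ℕ) :=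
  {w | w.card = 4 ∧ w ⊆ U ∧ (∃ a ∈ w, a ∈ X ∧ a ∉ r) ∧
    ∃ y₁ y₂ y₃ y₄ : ℕ, w = {y₁, y₂, y₃, y₄} ∧ y₁ + y₂ = y₃ + y₄ ∧
      ({y₁, y₂} : Finset ℕ) ≠ {y₃, y₄}}

def CcalR (g M : ℕ) (lam : ℝ) (s : ℕ → Fin 3 → ZMod M) (n : ℕ) (X r : Finset ℕ) :
    Set (Finset ℕ) :=
  {w | w ∈ Rn g M lam s n ∧ w ⊆ X ∪ r ∧ ∃ a ∈ w, a ∈ X ∧ a ∉ r}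

def Sx (g : ℕ) (x : Fin (2 * g + 4) → ℕ) : Set (Finset ℕ) :=
  {w | ∃ l : ℕ, ∃ _ : 3 ≤ l, ∃ _ : l ≤ g + 2,
      w = ({x ⟨0, by omega⟩, x ⟨3, by omega⟩,
            x ⟨2 * l - 2, by omega⟩, x ⟨2 * l - 1, by omega⟩} : Finset ℕ)} ∪
  {w | ∃ l j : ℕ, ∃ _ : 3 ≤ l, ∃ _ : l < j, ∃ _ : j ≤ g + 2,
      w = ({x ⟨2 * j - 2, by omega⟩, x ⟨2 * j - 1, by omega⟩,
            x ⟨2 * l - 2, by omega⟩, x ⟨2 * l - 1, by omega⟩} : Finset ℕ)}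

def SxV (g : ℕ) (r₁ : ℕ) (v : Fin (2 * g + 1) → ℕ) : Set (Finset ℕ) :=
  {w | ∃ l : ℕ, ∃ _ : 3 ≤ l, ∃ _ : l ≤ g + 2,
      w = ({r₁, v ⟨0, by omega⟩, v ⟨2 * l - 5, by omega⟩, v ⟨2 * l - 4, by omega⟩} : Finset ℕ)} ∪
  {w | ∃ l j : ℕ, ∃ _ : 3 ≤ l, ∃ _ : l < j, ∃ _ : j ≤ g + 2,
      w = ({v ⟨2 * j - 5, by omega⟩, v ⟨2 * j - 4, by omega⟩,
            v ⟨2 * l - 5, by omega⟩, v ⟨2 * l - 4, by omega⟩} : Finset ℕ)}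

def tailSet (g : ℕ) (x : Fin (2 * g + 4) → ℕ) : Finset ℕ :=
  Finset.image (fun i : Fin (2 * g + 1) => x ⟨(i : ℕ) + 3, by have := i.isLt; omega⟩)
    Finset.univ

def wt (α : ℝ) (R : Finset ℕ) (t : ℕ) : ℝ := if t ∈ R then 1 else (t : ℝ) ^ (-α)

def pairWt (α : ℝ) (R : Finset ℕ) (y z : ℕ) : ℝ := ∏ a ∈ ({y, z} : Finset ℕ), wt α R a

def pairSum (α : ℝ) (N : ℕ) (R : Finset ℕ) (S : ℕ) : ℝ :=
  ∑ y ∈ Finset.range N, pairWt α R y (S - y)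

def hitSum (α : ℝ) (N : ℕ) (r R : Finset ℕ) (S : ℕ) : ℝ :=
  ∑ y ∈ Finset.range N, if y ∈ r ∨ S - y ∈ r then pairWt α R y (S - y) else 0

def decay (κ : ℝ) (v : ℤ) : ℝ := (max 1 |(v : ℝ)|) ^ (-κ)

lemma natCast_rpow_neg_le_one {α : ℝ} (hα : 0 < α) (t : ℕ) : (t : ℝ) ^ (-α) ≤ 1 := by
  rcases Nat.eq_zero_or_pos t with rfl | h
  · simp [Real.zero_rpow (neg_ne_zero.2 hα.ne')]
  · exact Real.rpow_le_one_of_one_le_of_nonpos (by exact_mod_cast h) (by linarith)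

lemma zero_rpow_neg {α : ℝ} (hα : 0 < α) : ((0 : ℕ) : ℝ) ^ (-α) = 0 := by
  simp [Real.zero_rpow (neg_ne_zero.2 hα.ne')]

lemma rpow_neg_anti {α x y : ℝ} (hα : 0 < α) (hx : 0 < x) (hxy : x ≤ y) :
    y ^ (-α) ≤ x ^ (-α) :=
  Real.rpow_le_rpow_of_nonpos hx hxy (by linarith)

lemma wt_nonneg (α : ℝ) (R : Finset ℕ) (t : ℕ) : 0 ≤ wt α R t := by
  unfold wt; split_ifs <;> positivity

lemma wt_le_one {α : ℝ} (hα : 0 < α) (R : Finset ℕ) (t : ℕ) : wt α R t ≤ 1 := by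
  unfold wt; split_ifs
  · exact le_rfl
  · exact natCast_rpow_neg_le_one hα t

lemma wt_zero {α : ℝ} (hα : 0 < α) {R : Finset ℕ} (hR : 0 ∉ R) : wt α R 0 = 0 := by
  unfold wt; rw [if_neg hR, zero_rpow_neg hα]

lemma wt_mono {α : ℝ} (hα : 0 < α) {r R : Finset ℕ} (h : r ⊆ R) (t : ℕ) :
    wt α r t ≤ wt α R t := by
  by_cases ht : t ∈ R
  · rw [show wt α R t = 1 from if_pos ht]; exact wt_le_one hα r t
  · have : t ∉ r := fun h' => ht (h h')
    simp [wt, ht, this]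

lemma wt_le_add {α : ℝ} (R : Finset ℕ) (t : ℕ) :
    wt α R t ≤ (t : ℝ) ^ (-α) + if t ∈ R then 1 else 0 := by
  unfold wt
  have : 0 ≤ (t : ℝ) ^ (-α) := by positivity
  split_ifs <;> linarith

lemma pairWt_nonneg (α : ℝ) (R : Finset ℕ) (y z : ℕ) : 0 ≤ pairWt α R y z :=
  Finset.prod_nonneg fun _ _ => wt_nonneg _ _ _

lemma pairWt_le_left {α : ℝ} (hα : 0 < α) (R : Finset ℕ) (y z : ℕ) :
    pairWt α R y z ≤ wt α R y := by
  unfold pairWt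
  by_cases h : y = z
  · simp [h]
  · rw [Finset.prod_pair h]
    exact mul_le_of_le_one_right (wt_nonneg _ _ _) (wt_le_one hα _ _)

lemma pairWt_le_right {α : ℝ} (hα : 0 < α) (R : Finset ℕ) (y z : ℕ) :
    pairWt α R y z ≤ wt α R z := by
  have := pairWt_le_left hα R z y
  rwa [pairWt, Finset.pair_comm] at this

lemma sum_rpow_neg_le {α : ℝ} (hα0 : 0 < α) (hα1 : α < 1) (N : ℕ) :
    ∑ y ∈ Finset.range (N + 1), (y : ℝ) ^ (-α) ≤ (1 - α)⁻¹ * (N : ℝ) ^ (1 - α) := by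
  induction N with
  | zero => simp [Real.zero_rpow (neg_ne_zero.2 hα0.ne'), Real.zero_rpow (sub_pos.2 hα1).ne']
  | succ N ih =>
    rw [Finset.sum_range_succ]
    have hN : (0 : ℝ) < (N : ℝ) + 1 := by positivity
    have hb := rpow_one_add_le_one_add_mul_self (s := -1 / ((N : ℝ) + 1))
      (by rw [le_div_iff₀ hN]; nlinarith [(Nat.cast_nonneg N : (0 : ℝ) ≤ N)])
      (p := 1 - α) (by linarith) (by linarith)
    have h1 : (1 : ℝ) + -1 / ((N : ℝ) + 1) = N / (N + 1) := by field_simp; ring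
    rw [h1, Real.div_rpow (by positivity) hN.le,
      div_le_iff₀ (by positivity)] at hb
    have h2 : ((N : ℝ) + 1) ^ (1 - α) = ((N : ℝ) + 1) * ((N : ℝ) + 1) ^ (-α) := by
      rw [sub_eq_add_neg, Real.rpow_add hN, Real.rpow_one]
    have h3 : ((N : ℝ)) ^ (1 - α) ≤
        ((N : ℝ) + 1) ^ (1 - α) - (1 - α) * ((N : ℝ) + 1) ^ (-α) := by
      refine hb.trans (le_of_eq ?_)
      rw [h2]; field_simp; ring
    have h4 : 0 < 1 - α := by linarith
    push_cast
    calc _ ≤ (1 - α)⁻¹ * (N : ℝ) ^ (1 - α) + ((N : ℝ) + 1) ^ (-α) := by linarith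
      _ = (1 - α)⁻¹ * ((N : ℝ) ^ (1 - α) + (1 - α) * ((N : ℝ) + 1) ^ (-α)) := by
        field_simp
      _ ≤ _ := by
        apply mul_le_mul_of_nonneg_left _ (by positivity); linarith

lemma sum_le_sum_of_ne_zero_mem {ι : Type*} {s t : Finset ι} {f : ι → ℝ}
    (hf : ∀ i, 0 ≤ f i) (h : ∀ i ∈ s, f i ≠ 0 → i ∈ t) :
    ∑ i ∈ s, f i ≤ ∑ i ∈ t, f i := by
  classical
  rw [← Finset.sum_filter_ne_zero]
  exact Finset.sum_le_sum_of_subset_of_nonneg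
    (fun i hi => h i (Finset.mem_filter.1 hi).1 (Finset.mem_filter.1 hi).2) fun i _ _ => hf i

/-- The two-fold convolution of `y ^ (-α)` is of order `S ^ (1 - 2 * α)`. -/
lemma sum_conv_rpow_le {α : ℝ} (hα0 : 0 < α) (hα1 : α < 1) (N S : ℕ) (hS : 1 ≤ S) :
    ∑ y ∈ Finset.range N, (y : ℝ) ^ (-α) * ((S - y : ℕ) : ℝ) ^ (-α) ≤
      4 * (1 - α)⁻¹ * (S : ℝ) ^ (1 - 2 * α) := by
  have hS' : (0 : ℝ) < S := by exact_mod_cast hS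
  have key : ∀ y : ℕ, y < S + 1 → (y : ℝ) ^ (-α) * ((S - y : ℕ) : ℝ) ^ (-α) ≤
      ((S : ℝ) / 2) ^ (-α) * ((y : ℝ) ^ (-α) + ((S - y : ℕ) : ℝ) ^ (-α)) := by
    intro y hy
    have n1 : 0 ≤ (y : ℝ) ^ (-α) := by positivity
    have n2 : 0 ≤ ((S - y : ℕ) : ℝ) ^ (-α) := by positivity
    have n3 : 0 ≤ ((S : ℝ) / 2) ^ (-α) := by positivity
    have hc : ((S - y : ℕ) : ℝ) = S - y := by push_cast [Nat.cast_sub (by omega : y ≤ S)]; ring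
    rcases le_total ((S : ℝ) / 2) y with h | h
    · have := rpow_neg_anti hα0 (by positivity) h
      nlinarith
    · have := rpow_neg_anti (y := ((S - y : ℕ) : ℝ)) hα0 (x := (S : ℝ) / 2) (by positivity)
        (by rw [hc]; linarith)
      nlinarith
  have hrefl : ∑ y ∈ Finset.range (S + 1), ((S - y : ℕ) : ℝ) ^ (-α) =
      ∑ y ∈ Finset.range (S + 1), (y : ℝ) ^ (-α) := by
    simpa using Finset.sum_range_reflect (fun y : ℕ => (y : ℝ) ^ (-α)) (S + 1)
  have h0 : ∑ y ∈ Finset.range N, (y : ℝ) ^ (-α) * ((S - y : ℕ) : ℝ) ^ (-α) ≤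
      ∑ y ∈ Finset.range (S + 1), (y : ℝ) ^ (-α) * ((S - y : ℕ) : ℝ) ^ (-α) := by
    refine sum_le_sum_of_ne_zero_mem (fun i => by positivity) fun y _ hy => ?_
    by_contra hlt
    rw [Finset.mem_range, not_lt] at hlt
    rw [Nat.sub_eq_zero_of_le (by omega), zero_rpow_neg hα0, mul_zero] at hy
    exact hy rfl
  have h2 : ((S : ℝ) / 2) ^ (-α) ≤ 2 * (S : ℝ) ^ (-α) := by
    rw [Real.div_rpow hS'.le (by norm_num), Real.rpow_neg (by norm_num : (0 : ℝ) ≤ 2),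
      div_inv_eq_mul, mul_comm]
    refine mul_le_mul_of_nonneg_right ?_ (by positivity)
    calc (2 : ℝ) ^ α ≤ 2 ^ (1 : ℝ) := Real.rpow_le_rpow_of_exponent_le (by norm_num) hα1.le
      _ = 2 := by simp
  have h3 : (S : ℝ) ^ (1 - 2 * α) = (S : ℝ) ^ (-α) * (S : ℝ) ^ (1 - α) := by
    rw [← Real.rpow_add hS']; ring_nf
  have h4 : 0 < 1 - α := by linarith
  calc _ ≤ _ := h0
    _ ≤ ∑ y ∈ Finset.range (S + 1),
        ((S : ℝ) / 2) ^ (-α) * ((y : ℝ) ^ (-α) + ((S - y : ℕ) : ℝ) ^ (-α)) :=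
      Finset.sum_le_sum fun y hy => key y (Finset.mem_range.1 hy)
    _ = ((S : ℝ) / 2) ^ (-α) * (2 * ∑ y ∈ Finset.range (S + 1), (y : ℝ) ^ (-α)) := by
      rw [← Finset.mul_sum, Finset.sum_add_distrib, hrefl, two_mul]
    _ ≤ (2 * (S : ℝ) ^ (-α)) * (2 * ((1 - α)⁻¹ * (S : ℝ) ^ (1 - α))) := by
      refine mul_le_mul h2 ?_ (by positivity) (by positivity)
      exact mul_le_mul_of_nonneg_left (sum_rpow_neg_le hα0 hα1 S) (by norm_num)
    _ = _ := by rw [h3]; ring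

lemma hitSum_nonneg (α : ℝ) (N : ℕ) (r R : Finset ℕ) (S : ℕ) : 0 ≤ hitSum α N r R S :=
  Finset.sum_nonneg fun _ _ => by split_ifs; exacts [pairWt_nonneg _ _ _ _, le_rfl]

lemma pairSum_nonneg (α : ℝ) (N : ℕ) (R : Finset ℕ) (S : ℕ) : 0 ≤ pairSum α N R S :=
  Finset.sum_nonneg fun _ _ => pairWt_nonneg _ _ _ _

lemma hitSum_le {α : ℝ} (hα : 0 < α) (N : ℕ) (r R : Finset ℕ) (hR : 0 ∉ R) (S : ℕ) :
    hitSum α N r R S ≤ 2 * ∑ ρ ∈ r, wt α R (S - ρ) := by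
  have h1 : ∀ y, (if y ∈ r ∨ S - y ∈ r then pairWt α R y (S - y) else 0) ≤
      (if y ∈ r then wt α R (S - y) else 0) +
        (if S - y ∈ r ∧ y ≤ S then wt α R (S - (S - y)) else 0) := by
    intro y
    by_cases hy : y ≤ S
    · have e : S - (S - y) = y := by omega
      have a1 := pairWt_le_left hα R y (S - y)
      have a2 := pairWt_le_right hα R y (S - y)
      have a3 := wt_nonneg α R y
      have a4 := wt_nonneg α R (S - y)
      rw [e]
      by_cases b1 : y ∈ r <;> by_cases b2 : S - y ∈ r <;> simp [b1, b2, hy] <;> linarith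
    · have e : S - y = 0 := by omega
      have a2 := pairWt_le_right hα R y (S - y)
      have : pairWt α R y (S - y) = 0 := by
        refine le_antisymm ?_ (pairWt_nonneg _ _ _ _)
        rwa [e, wt_zero hα hR, ← e] at a2
      rw [this]
      simp only [ite_self]
      refine add_nonneg ?_ ?_ <;> split_ifs <;> first | exact wt_nonneg _ _ _ | exact le_rfl
  have h2 : ∑ y ∈ Finset.range N, (if y ∈ r then wt α R (S - y) else 0) ≤
      ∑ ρ ∈ r, wt α R (S - ρ) := by
    rw [← Finset.sum_filter]
    exact Finset.sum_le_sum_of_subset_of_nonneg (fun y hy => (Finset.mem_filter.1 hy).2)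
      fun _ _ _ => wt_nonneg _ _ _
  have h3 : ∑ y ∈ Finset.range N, (if S - y ∈ r ∧ y ≤ S then wt α R (S - (S - y)) else 0) ≤
      ∑ ρ ∈ r, wt α R (S - ρ) := by
    rw [← Finset.sum_filter]
    rw [← Finset.sum_image (f := fun ρ => wt α R (S - ρ)) (g := fun y => S - y)]
    · refine Finset.sum_le_sum_of_subset_of_nonneg ?_ fun _ _ _ => wt_nonneg _ _ _
      intro ρ hρ
      obtain ⟨y, hy, rfl⟩ := Finset.mem_image.1 hρ
      exact (Finset.mem_filter.1 hy).2.1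
    · intro a ha b hb hab
      have := (Finset.mem_filter.1 ha).2.2
      have := (Finset.mem_filter.1 hb).2.2
      simp only at hab
      omega
  calc _ ≤ _ := Finset.sum_le_sum fun y _ => h1 y
    _ ≤ _ := by rw [Finset.sum_add_distrib]; linarith

lemma pairSum_le {α : ℝ} (hα0 : 0 < α) (hα1 : α < 1) (N : ℕ) (R : Finset ℕ) (hR : 0 ∉ R)
    (S : ℕ) (hS : 1 ≤ S) :
    pairSum α N R S ≤ (4 * (1 - α)⁻¹ + 2) * (S : ℝ) ^ (1 - 2 * α) +
      2 * ∑ ρ ∈ R, wt α R (S - ρ) := by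
  have hS' : (1 : ℝ) ≤ S := by exact_mod_cast hS
  have h1 : ∀ y, pairWt α R y (S - y) ≤ (y : ℝ) ^ (-α) * ((S - y : ℕ) : ℝ) ^ (-α) +
      (if S / 2 = y then 2 * (S : ℝ) ^ (1 - 2 * α) else 0) +
      (if y ∈ R ∨ S - y ∈ R then pairWt α R y (S - y) else 0) := by
    intro y
    have p1 : 0 ≤ (y : ℝ) ^ (-α) * ((S - y : ℕ) : ℝ) ^ (-α) := by positivity
    have p2 : 0 ≤ (if S / 2 = y then 2 * (S : ℝ) ^ (1 - 2 * α) else 0) := by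
      split_ifs <;> positivity
    by_cases h : y ∈ R ∨ S - y ∈ R
    · rw [if_pos h]; linarith
    · rw [if_neg h]
      push Not at h
      by_cases e : y = S - y
      · have hy : S / 2 = y := by omega
        have hS2 : (S : ℝ) = 2 * y := by
          have : S = 2 * y := by omega
          exact_mod_cast this
        have hy1 : (0 : ℝ) < y := by
          have : 0 < y := by omega
          exact_mod_cast this
        have : pairWt α R y (S - y) = (y : ℝ) ^ (-α) := by
          rw [← e]; simp [pairWt, wt, h.1]
        rw [this, if_pos hy]
        have h5 : (y : ℝ) ^ (-α) ≤ 2 * (S : ℝ) ^ (1 - 2 * α) := by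
          calc (y : ℝ) ^ (-α) = (2 : ℝ) ^ α * (S : ℝ) ^ (-α) := by
                rw [hS2, Real.mul_rpow (by norm_num) hy1.le, ← mul_assoc,
                  ← Real.rpow_add (by norm_num)]; simp
            _ ≤ 2 ^ (1 : ℝ) * (S : ℝ) ^ (1 - 2 * α) := by
              gcongr
              · norm_num
              · linarith
            _ = _ := by simp
        linarith
      · have : pairWt α R y (S - y) = (y : ℝ) ^ (-α) * ((S - y : ℕ) : ℝ) ^ (-α) := by
          rw [pairWt, Finset.prod_pair e]; simp [wt, h.1, h.2]
        linarith
  have h2 : ∑ y ∈ Finset.range N, (if S / 2 = y then 2 * (S : ℝ) ^ (1 - 2 * α) else 0) ≤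
      2 * (S : ℝ) ^ (1 - 2 * α) := by
    rw [Finset.sum_ite_eq]
    split_ifs
    · exact le_rfl
    · positivity
  have h3 := sum_conv_rpow_le hα0 hα1 N S hS
  have h4 := hitSum_le hα0 N R R hR S
  calc _ ≤ _ := Finset.sum_le_sum fun y _ => h1 y
    _ ≤ _ := by
      rw [Finset.sum_add_distrib, Finset.sum_add_distrib]
      unfold hitSum at h4
      linarith

lemma decay_nonneg (κ : ℝ) (v : ℤ) : 0 ≤ decay κ v := by
  unfold decay; positivity

lemma decay_zero (κ : ℝ) : decay κ 0 = 1 := by simp [decay]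

lemma decay_le_one {κ : ℝ} (hκ : 0 < κ) (v : ℤ) : decay κ v ≤ 1 :=
  Real.rpow_le_one_of_one_le_of_nonpos (le_max_left _ _) (by linarith)

lemma decay_le {κ V : ℝ} (hκ : 0 < κ) (hV : 0 < V) {v : ℤ} (hv : V ≤ |(v : ℝ)|) :
    decay κ v ≤ V ^ (-κ) :=
  rpow_neg_anti hκ hV (hv.trans (le_max_right _ _))

lemma rpow_neg_le_decay {α κ : ℝ} (hκ : 0 < κ) (hκα : κ ≤ α) (t : ℕ) :
    (t : ℝ) ^ (-α) ≤ decay κ t := by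
  rcases Nat.eq_zero_or_pos t with rfl | h
  · rw [zero_rpow_neg (hκ.trans_le hκα)]; exact decay_nonneg _ _
  · have h1 : (1 : ℝ) ≤ t := by exact_mod_cast h
    have : decay κ t = (t : ℝ) ^ (-κ) := by simp [decay, max_eq_right h1]
    rw [this]
    exact Real.rpow_le_rpow_of_exponent_le h1 (by linarith)

lemma mul_rpow_le_decay_mul {α κ : ℝ} (hκ : 0 < κ) (hκα : κ ≤ α) {a b : ℕ} (ha : 1 ≤ a)
    (hab : a ≤ b) {d : ℤ} (hd : |d| ≤ b) :
    (a : ℝ) ^ (-α) * (b : ℝ) ^ (-α) ≤ decay κ d * (a : ℝ) ^ (-(2 * α - κ)) := by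
  have ha' : (1 : ℝ) ≤ a := by exact_mod_cast ha
  have hab' : (a : ℝ) ≤ b := by exact_mod_cast hab
  have hd' : |(d : ℝ)| ≤ b := by exact_mod_cast hd
  have e1 : (b : ℝ) ^ (-α) = (b : ℝ) ^ (-(α - κ)) * (b : ℝ) ^ (-κ) := by
    rw [← Real.rpow_add (by linarith)]; ring_nf
  have e2 : (a : ℝ) ^ (-(2 * α - κ)) = (a : ℝ) ^ (-α) * (a : ℝ) ^ (-(α - κ)) := by
    rw [← Real.rpow_add (by linarith)]; ring_nf
  have h1 : (b : ℝ) ^ (-(α - κ)) ≤ (a : ℝ) ^ (-(α - κ)) :=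
    Real.rpow_le_rpow_of_nonpos (by linarith) hab' (by linarith)
  have h2 : (b : ℝ) ^ (-κ) ≤ decay κ d :=
    rpow_neg_anti hκ (by positivity) (max_le (by linarith) hd')
  rw [e1, e2]
  calc _ ≤ (a : ℝ) ^ (-α) * ((a : ℝ) ^ (-(α - κ)) * decay κ d) := by gcongr
    _ = _ := by ring

lemma exists_sum_shift_conv_le {α κ : ℝ} (hκ : 0 < κ) (hκα : κ ≤ α) (hβ : 1 < 2 * α - κ) :
    ∃ C : ℝ, 0 < C ∧ ∀ x₀ ρ N : ℕ,
      ∑ x ∈ Finset.range N, (x : ℝ) ^ (-α) * ((x₀ + x - ρ : ℕ) : ℝ) ^ (-α) ≤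
        C * decay κ ((x₀ : ℤ) - ρ) := by
  have hα : 0 < α := hκ.trans_le hκα
  set β := 2 * α - κ with hβ'
  have hsum : Summable fun n : ℕ => (n : ℝ) ^ (-β) := Real.summable_nat_rpow.2 (by linarith)
  have hpart : ∀ s : Finset ℕ, ∑ t ∈ s, (t : ℝ) ^ (-β) ≤ ∑' n : ℕ, (n : ℝ) ^ (-β) := fun s =>
    hsum.sum_le_tsum s fun _ _ => by positivity
  set Z := ∑' n : ℕ, (n : ℝ) ^ (-β)
  have hZ : 0 < Z := by
    refine lt_of_lt_of_le ?_ (hpart {1})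
    simp
  refine ⟨2 * Z, by positivity, fun x₀ ρ N => ?_⟩
  have key : ∀ x : ℕ, (x : ℝ) ^ (-α) * ((x₀ + x - ρ : ℕ) : ℝ) ^ (-α) ≤
      decay κ ((x₀ : ℤ) - ρ) * ((x : ℝ) ^ (-β) + ((x₀ + x - ρ : ℕ) : ℝ) ^ (-β)) := by
    intro x
    have n0 := decay_nonneg κ ((x₀ : ℤ) - ρ)
    have n1 : 0 ≤ (x : ℝ) ^ (-β) := by positivity
    have n2 : 0 ≤ ((x₀ + x - ρ : ℕ) : ℝ) ^ (-β) := by positivity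
    rcases Nat.eq_zero_or_pos x with rfl | hx
    · rw [zero_rpow_neg hα, zero_mul]; positivity
    rcases Nat.eq_zero_or_pos (x₀ + x - ρ) with hy | hy
    · rw [hy, zero_rpow_neg hα, mul_zero, ← hy]; positivity
    rcases le_total x (x₀ + x - ρ) with h | h
    · refine (mul_rpow_le_decay_mul hκ hκα hx h (d := (x₀ : ℤ) - ρ)
        (abs_le.2 ⟨by omega, by omega⟩)).trans ?_
      rw [mul_add]
      exact le_add_of_nonneg_right (mul_nonneg n0 n2)
    · rw [mul_comm]
      refine (mul_rpow_le_decay_mul hκ hκα hy h (d := (x₀ : ℤ) - ρ)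
        (abs_le.2 ⟨by omega, by omega⟩)).trans ?_
      rw [mul_add]
      exact le_add_of_nonneg_left (mul_nonneg n0 n1)
  have hshift : ∑ x ∈ Finset.range N, ((x₀ + x - ρ : ℕ) : ℝ) ^ (-β) ≤ Z := by
    have hβ0 : 0 < β := by linarith
    calc _ ≤ ∑ x ∈ (Finset.range N).filter (fun x => ρ < x₀ + x),
          ((x₀ + x - ρ : ℕ) : ℝ) ^ (-β) := by
          refine sum_le_sum_of_ne_zero_mem (fun i => by positivity) fun x hx h0 => ?_
          refine Finset.mem_filter.2 ⟨hx, ?_⟩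
          by_contra hlt
          rw [Nat.sub_eq_zero_of_le (by omega), zero_rpow_neg hβ0] at h0
          exact h0 rfl
      _ = ∑ t ∈ ((Finset.range N).filter (fun x => ρ < x₀ + x)).image (fun x => x₀ + x - ρ),
          (t : ℝ) ^ (-β) := by
          rw [Finset.sum_image]
          intro a ha b hb hab
          have := (Finset.mem_filter.1 ha).2
          have := (Finset.mem_filter.1 hb).2
          simp only at hab
          omega
      _ ≤ Z := hpart _
  calc _ ≤ _ := Finset.sum_le_sum fun x _ => key x
    _ = decay κ ((x₀ : ℤ) - ρ) * (∑ x ∈ Finset.range N, (x : ℝ) ^ (-β) +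
        ∑ x ∈ Finset.range N, ((x₀ + x - ρ : ℕ) : ℝ) ^ (-β)) := by
      rw [← Finset.mul_sum, Finset.sum_add_distrib]
    _ ≤ decay κ ((x₀ : ℤ) - ρ) * (Z + Z) := by
      have := hpart (Finset.range N)
      have n0 := decay_nonneg κ ((x₀ : ℤ) - ρ)
      gcongr
    _ = _ := by ring

lemma exists_sum_shift_wt_le {α κ : ℝ} (hκ : 0 < κ) (hκα : κ ≤ α) (hβ : 1 < 2 * α - κ) :
    ∃ C : ℝ, 0 < C ∧ ∀ R : Finset ℕ, 0 ∉ R → ∀ x₀ ρ N : ℕ,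
      ∑ x ∈ Finset.range N, (x : ℝ) ^ (-α) * wt α R (x₀ + x - ρ) ≤
        C * decay κ ((x₀ : ℤ) - ρ) + ∑ σ ∈ R, decay κ ((σ : ℤ) + ρ - x₀) := by
  obtain ⟨C, hC, h⟩ := exists_sum_shift_conv_le hκ hκα hβ
  refine ⟨C, hC, fun R hR x₀ ρ N => ?_⟩
  have key : ∀ x : ℕ, (x : ℝ) ^ (-α) * wt α R (x₀ + x - ρ) ≤
      (x : ℝ) ^ (-α) * ((x₀ + x - ρ : ℕ) : ℝ) ^ (-α) +
        ∑ σ ∈ R, if σ + ρ - x₀ = x then decay κ ((σ : ℤ) + ρ - x₀) else 0 := by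
    intro x
    have n1 : 0 ≤ (x : ℝ) ^ (-α) := by positivity
    have h1 := mul_le_mul_of_nonneg_left (wt_le_add (α := α) R (x₀ + x - ρ)) n1
    rw [mul_add] at h1
    refine h1.trans (add_le_add_right ?_ _)
    have n2 : ∀ σ ∈ R, 0 ≤ (if σ + ρ - x₀ = x then decay κ ((σ : ℤ) + ρ - x₀) else 0) := by
      intro σ _; split_ifs; exacts [decay_nonneg _ _, le_rfl]
    split_ifs with hm
    · refine le_trans ?_ (Finset.single_le_sum n2 hm)
      have hpos : 0 < x₀ + x - ρ := Nat.pos_of_ne_zero fun h0 => hR (h0 ▸ hm)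
      rw [if_pos (by omega), mul_one]
      have e : ((x₀ + x - ρ : ℕ) : ℤ) + ρ - x₀ = x := by omega
      rw [e]
      exact rpow_neg_le_decay hκ hκα x
    · simpa using Finset.sum_nonneg n2
  calc _ ≤ _ := Finset.sum_le_sum fun x _ => key x
    _ ≤ _ := by
      rw [Finset.sum_add_distrib, Finset.sum_comm]
      refine add_le_add (h x₀ ρ N) (Finset.sum_le_sum fun σ _ => ?_)
      rw [Finset.sum_ite_eq]
      split_ifs; exacts [le_rfl, decay_nonneg _ _]

def near (κ : ℝ) (R : Finset ℕ) (v : ℤ) : ℝ := decay κ v + ∑ ρ ∈ R, decay κ (v - ρ)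

lemma near_nonneg (κ : ℝ) (R : Finset ℕ) (v : ℤ) : 0 ≤ near κ R v :=
  add_nonneg (decay_nonneg _ _) (Finset.sum_nonneg fun _ _ => decay_nonneg _ _)

lemma wt_sub_le_near {α κ : ℝ} (hκ : 0 < κ) (hκα : κ ≤ α) {R : Finset ℕ} (hR : 0 ∉ R)
    (p q : ℕ) : wt α R (p - q) ≤ near κ R ((p : ℤ) - q) := by
  rcases Nat.eq_zero_or_pos (p - q) with h0 | hpos
  · rw [h0, wt_zero (hκ.trans_le hκα) hR]; exact near_nonneg _ _ _
  have e : ((p : ℤ) - q) = ((p - q : ℕ) : ℤ) := by omega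
  refine (wt_le_add R _).trans (add_le_add ?_ ?_)
  · rw [e]; exact rpow_neg_le_decay hκ hκα _
  · split_ifs with hm
    · refine le_trans ?_ (Finset.single_le_sum (fun _ _ => decay_nonneg _ _) hm)
      rw [e, sub_self, decay_zero]
    · exact Finset.sum_nonneg fun _ _ => decay_nonneg _ _

lemma sum_wt_le_card {α : ℝ} (hα : 0 < α) (R s : Finset ℕ) (f : ℕ → ℕ) :
    ∑ ρ ∈ s, wt α R (f ρ) ≤ s.card := by
  simpa using Finset.sum_le_sum (s := s) fun ρ _ => wt_le_one hα R (f ρ)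

lemma rpow_le_one_of_nat {p : ℝ} (hp : p ≤ 0) {S : ℕ} (hS : 1 ≤ S) : (S : ℝ) ^ p ≤ 1 :=
  Real.rpow_le_one_of_one_le_of_nonpos (by exact_mod_cast hS) hp

lemma exists_pairSum_bound {α : ℝ} (hα0 : 1 / 2 < α) (hα1 : α < 1) (D : ℕ) :
    ∃ B : ℝ, 1 ≤ B ∧ ∀ (N : ℕ) (R : Finset ℕ), 0 ∉ R → R.card ≤ D → ∀ S, 1 ≤ S →
      pairSum α N R S ≤ B := by
  have h1 : 0 < 1 - α := by linarith
  refine ⟨4 * (1 - α)⁻¹ + 2 + 2 * D, ?_, fun N R hR hD S hS => ?_⟩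
  · have : 0 < 4 * (1 - α)⁻¹ := by positivity
    have : (0 : ℝ) ≤ D := by positivity
    linarith
  · refine (pairSum_le (by linarith) hα1 N R hR S hS).trans (add_le_add ?_ ?_)
    · exact mul_le_of_le_one_right (by positivity) (rpow_le_one_of_nat (by linarith) hS)
    · have := sum_wt_le_card (by linarith : 0 < α) R R (fun ρ => S - ρ)
      have : (R.card : ℝ) ≤ D := by exact_mod_cast hD
      linarith

/-- The total weight of all completions of a fixed first entry `x₀` is bounded. -/
lemma exists_tail_sum_le {α : ℝ} (hα0 : 1 / 2 < α) (hα1 : α < 1) {g : ℕ} (hg : 1 ≤ g)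
    (hgα : (g : ℝ) * (2 * α - 1) = 1 - α) (D : ℕ) :
    ∃ C : ℝ, 0 < C ∧ ∀ R : Finset ℕ, 0 ∉ R → R.card ≤ D → ∀ x₀ N : ℕ, 1 ≤ x₀ →
      ∑ x ∈ Finset.range (x₀ + 1), wt α R x * pairSum α N R (x₀ + x) ^ g ≤ C := by
  obtain ⟨B, hB1, hB⟩ := exists_pairSum_bound hα0 hα1 D
  set κ := (2 * α - 1) / 2 with hκ
  have hκ0 : 0 < κ := by rw [hκ]; linarith
  have hκα : κ ≤ α := by rw [hκ]; linarith
  obtain ⟨Z, hZ0, hZ⟩ := exists_sum_shift_wt_le hκ0 hκα (by rw [hκ]; linarith)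
  have h1 : 0 < 1 - α := by linarith
  set A := 4 * (1 - α)⁻¹ + 2 with hA
  have hA0 : 0 < A := by positivity
  set c₁ : ℝ := 2 ^ (g - 1) * A ^ g with hc₁
  set c₂ : ℝ := 2 ^ (g - 1) * (2 ^ g * (D : ℝ) ^ (g - 1)) with hc₂
  refine ⟨c₁ * (1 - α)⁻¹ + c₂ * (D * (Z + D)) + D * B ^ g, by positivity,
    fun R hR hRD x₀ N hx₀ => ?_⟩
  have hRD' : (R.card : ℝ) ≤ D := by exact_mod_cast hRD
  have hx₀' : (0 : ℝ) < x₀ := by exact_mod_cast hx₀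
  have hpow : ∀ x : ℕ, pairSum α N R (x₀ + x) ^ g ≤
      c₁ * (x₀ : ℝ) ^ (-(1 - α)) + c₂ * ∑ ρ ∈ R, wt α R (x₀ + x - ρ) := by
    intro x
    have hP := pairSum_le (by linarith : 0 < α) hα1 N R hR (x₀ + x) (by omega)
    have hW0 : 0 ≤ ∑ ρ ∈ R, wt α R (x₀ + x - ρ) := Finset.sum_nonneg fun _ _ => wt_nonneg _ _ _
    have hWD := (sum_wt_le_card (by linarith : 0 < α) R R (fun ρ => x₀ + x - ρ)).trans hRD'
    set W := ∑ ρ ∈ R, wt α R (x₀ + x - ρ)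
    have hle : ((x₀ + x : ℕ) : ℝ) ^ (1 - 2 * α) ≤ (x₀ : ℝ) ^ (1 - 2 * α) :=
      Real.rpow_le_rpow_of_nonpos hx₀' (by exact_mod_cast Nat.le_add_right _ _) (by linarith)
    have he : ((x₀ : ℝ) ^ (1 - 2 * α)) ^ g = (x₀ : ℝ) ^ (-(1 - α)) := by
      rw [← Real.rpow_natCast, ← Real.rpow_mul hx₀'.le, ← hgα]; ring_nf
    calc _ ≤ (A * (x₀ : ℝ) ^ (1 - 2 * α) + 2 * W) ^ g :=
          pow_le_pow_left₀ (pairSum_nonneg _ _ _ _) (hP.trans (by gcongr)) g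
      _ ≤ 2 ^ (g - 1) * ((A * (x₀ : ℝ) ^ (1 - 2 * α)) ^ g + (2 * W) ^ g) :=
          add_pow_le (by positivity) (by positivity) g
      _ ≤ 2 ^ (g - 1) * (A ^ g * (x₀ : ℝ) ^ (-(1 - α)) + 2 ^ g * ((D : ℝ) ^ (g - 1) * W)) := by
          rw [mul_pow, mul_pow, he]
          gcongr
          obtain ⟨k, rfl⟩ : ∃ k, g = k + 1 := ⟨g - 1, by omega⟩
          rw [pow_succ, Nat.add_sub_cancel]
          gcongr
      _ = _ := by rw [hc₁, hc₂]; ring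
  have hterm : ∀ x : ℕ, wt α R x * pairSum α N R (x₀ + x) ^ g ≤
      (x₀ : ℝ) ^ (-(1 - α)) * c₁ * (x : ℝ) ^ (-α) +
        c₂ * ∑ ρ ∈ R, (x : ℝ) ^ (-α) * wt α R (x₀ + x - ρ) +
        (if x ∈ R then B ^ g else 0) := by
    intro x
    have hP0 := pow_nonneg (pairSum_nonneg α N R (x₀ + x)) g
    have hPB : pairSum α N R (x₀ + x) ^ g ≤ B ^ g :=
      pow_le_pow_left₀ (pairSum_nonneg _ _ _ _) (hB N R hR hRD _ (by omega)) g
    have n1 : 0 ≤ (x : ℝ) ^ (-α) := by positivity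
    calc _ ≤ ((x : ℝ) ^ (-α) + if x ∈ R then 1 else 0) * pairSum α N R (x₀ + x) ^ g :=
          mul_le_mul_of_nonneg_right (wt_le_add R x) hP0
      _ = (x : ℝ) ^ (-α) * pairSum α N R (x₀ + x) ^ g +
          (if x ∈ R then pairSum α N R (x₀ + x) ^ g else 0) := by
          rw [add_mul, ite_mul, one_mul, zero_mul]
      _ ≤ (x : ℝ) ^ (-α) * (c₁ * (x₀ : ℝ) ^ (-(1 - α)) + c₂ * ∑ ρ ∈ R, wt α R (x₀ + x - ρ)) +
          (if x ∈ R then B ^ g else 0) := by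
          refine add_le_add (mul_le_mul_of_nonneg_left (hpow x) n1) ?_
          split_ifs; exacts [hPB, le_rfl]
      _ = _ := by rw [← Finset.mul_sum]; ring
  have s1 : (x₀ : ℝ) ^ (-(1 - α)) * c₁ * ∑ x ∈ Finset.range (x₀ + 1), (x : ℝ) ^ (-α) ≤
      c₁ * (1 - α)⁻¹ := by
    calc _ ≤ (x₀ : ℝ) ^ (-(1 - α)) * c₁ * ((1 - α)⁻¹ * (x₀ : ℝ) ^ (1 - α)) := by
          gcongr; exact sum_rpow_neg_le (by linarith) hα1 x₀
      _ = c₁ * (1 - α)⁻¹ * ((x₀ : ℝ) ^ (-(1 - α)) * (x₀ : ℝ) ^ (1 - α)) := by ring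
      _ = _ := by rw [← Real.rpow_add hx₀']; simp
  have s2 : ∑ ρ ∈ R, ∑ x ∈ Finset.range (x₀ + 1), (x : ℝ) ^ (-α) * wt α R (x₀ + x - ρ) ≤
      D * (Z + D) := by
    calc _ ≤ ∑ ρ ∈ R, (Z + D) := by
          refine Finset.sum_le_sum fun ρ _ => (hZ R hR x₀ ρ _).trans (add_le_add ?_ ?_)
          · exact mul_le_of_le_one_right hZ0.le (decay_le_one hκ0 _)
          · refine le_trans ?_ hRD'
            simpa using Finset.sum_le_sum (s := R)
              fun σ _ => decay_le_one hκ0 ((σ : ℤ) + ρ - x₀)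
      _ = R.card * (Z + D) := by rw [Finset.sum_const, nsmul_eq_mul]
      _ ≤ _ := by gcongr
  have s3 : ∑ x ∈ Finset.range (x₀ + 1), (if x ∈ R then B ^ g else 0) ≤ D * B ^ g := by
    rw [← Finset.sum_filter, Finset.sum_const, nsmul_eq_mul]
    have : ((Finset.range (x₀ + 1)).filter (· ∈ R)).card ≤ D :=
      (Finset.card_le_card fun x hx => (Finset.mem_filter.1 hx).2).trans hRD
    gcongr
  calc _ ≤ _ := Finset.sum_le_sum fun x _ => hterm x
    _ ≤ _ := by
      rw [Finset.sum_add_distrib, Finset.sum_add_distrib, ← Finset.mul_sum, ← Finset.mul_sum,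
        Finset.sum_comm (s := Finset.range (x₀ + 1))]
      gcongr

lemma weighted_sum_le {E A Z G d₁ d₂ d₃ d₄ d₅ : ℝ} (hE : 0 ≤ E) (hA : 0 ≤ A) (hZ : 0 ≤ Z)
    (hG : 0 ≤ G) (h₁ : 0 ≤ d₁) (h₂ : 0 ≤ d₂) (h₃ : 0 ≤ d₃) (h₄ : 0 ≤ d₄) (h₅ : 0 ≤ d₅) :
    E * (A * d₁ + A * d₄) + 2 * G * E * (Z * d₂ + d₃ + d₅) ≤
      (E * A + 2 * G * E * (Z + 1)) * (d₁ + d₂ + (d₃ + d₄ + d₅)) := by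
  have t1 : 0 ≤ E * A * (d₂ + d₃ + d₅) := by positivity
  have t2 : 0 ≤ 2 * G * E * ((Z + 1) * (d₁ + d₄) + d₂ + Z * (d₃ + d₅)) := by positivity
  linarith

/-- The weight of the completions of `x₀` that meet `r` is controlled by how close a bounded
number of linear combinations of `x₀` and the elements of `R` are to zero. -/
lemma exists_hit_tail_sum_le {α κ : ℝ} (hα0 : 1 / 2 < α) (hα1 : α < 1)
    (hκ : κ = (2 * α - 1) / 2) {g : ℕ} (hg : 1 ≤ g) (D : ℕ) :
    ∃ C : ℝ, 0 < C ∧ ∀ r R : Finset ℕ, r ⊆ R → 0 ∉ R → R.card ≤ D → ∀ x₀ N : ℕ, 1 ≤ x₀ →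
      ∑ x ∈ Finset.range (x₀ + 1), wt α R x *
          ((if x ∈ r then pairSum α N R (x₀ + x) ^ g else 0) +
            g * (hitSum α N r R (x₀ + x) * pairSum α N R (x₀ + x) ^ (g - 1))) ≤
        C * ∑ ρ ∈ r, (decay κ x₀ + decay κ ((x₀ : ℤ) - ρ) +
          ∑ σ ∈ R, (decay κ ((σ : ℤ) + ρ - x₀) + near κ R ((x₀ : ℤ) + ρ - σ) +
            near κ R ((x₀ : ℤ) + σ - ρ))) := by
  obtain ⟨B, hB1, hB⟩ := exists_pairSum_bound hα0 hα1 D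
  have hκ0 : 0 < κ := by rw [hκ]; linarith
  have hκα : κ ≤ α := by rw [hκ]; linarith
  have hα : 0 < α := by linarith
  obtain ⟨Z, hZ0, hZ⟩ := exists_sum_shift_wt_le hκ0 hκα (by rw [hκ]; linarith)
  have h1 : 0 < 1 - α := by linarith
  set A := 4 * (1 - α)⁻¹ + 2 with hA
  have hA2 : 2 ≤ A := by
    have : 0 < 4 * (1 - α)⁻¹ := by positivity
    linarith
  set E := B ^ (g - 1) with hE
  have hE0 : 0 < E := by positivity
  refine ⟨E * A + 2 * g * E * (Z + 1), by positivity, fun r R hrR hR hRD x₀ N hx₀ => ?_⟩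
  have hx₀' : (0 : ℝ) < x₀ := by exact_mod_cast hx₀
  have hterm : ∀ x : ℕ, wt α R x * ((if x ∈ r then pairSum α N R (x₀ + x) ^ g else 0) +
      g * (hitSum α N r R (x₀ + x) * pairSum α N R (x₀ + x) ^ (g - 1))) ≤
      E * (if x ∈ r then pairSum α N R (x₀ + x) else 0) +
      2 * g * E * ∑ ρ ∈ r, ((x : ℝ) ^ (-α) * wt α R (x₀ + x - ρ) +
        if x ∈ R then wt α R (x₀ + x - ρ) else 0) := by
    intro x
    have hP0 := pairSum_nonneg α N R (x₀ + x)
    have hH0 := hitSum_nonneg α N r R (x₀ + x)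
    have hPE : pairSum α N R (x₀ + x) ^ (g - 1) ≤ E :=
      pow_le_pow_left₀ hP0 (hB N R hR hRD _ (by omega)) _
    have hw1 := wt_le_one hα R x
    have hw0 := wt_nonneg α R x
    rw [mul_add]
    refine add_le_add ?_ ?_
    · split_ifs
      · have : pairSum α N R (x₀ + x) ^ g ≤ E * pairSum α N R (x₀ + x) := by
          obtain ⟨k, rfl⟩ : ∃ k, g = k + 1 := ⟨g - 1, by omega⟩
          rw [pow_succ]
          exact mul_le_mul_of_nonneg_right hPE hP0
        exact (mul_le_of_le_one_left (by positivity) hw1).trans this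
      · simp
    · calc _ ≤ wt α R x * (g * ((2 * ∑ ρ ∈ r, wt α R (x₀ + x - ρ)) * E)) := by
            have := hitSum_le hα N r R hR (x₀ + x)
            have := hH0.trans this
            gcongr
        _ = 2 * g * E * ∑ ρ ∈ r, wt α R x * wt α R (x₀ + x - ρ) := by
            rw [← Finset.mul_sum]; ring
        _ ≤ _ := by
            refine mul_le_mul_of_nonneg_left (Finset.sum_le_sum fun ρ _ => ?_) (by positivity)
            have := mul_le_mul_of_nonneg_right (wt_le_add (α := α) R x)
              (wt_nonneg α R (x₀ + x - ρ))
            rwa [add_mul, ite_mul, one_mul, zero_mul] at this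
  have s1 : ∑ x ∈ Finset.range (x₀ + 1), (if x ∈ r then pairSum α N R (x₀ + x) else 0) ≤
      ∑ ρ ∈ r, (A * decay κ x₀ + A * ∑ σ ∈ R, near κ R ((x₀ : ℤ) + ρ - σ)) := by
    rw [← Finset.sum_filter]
    refine (Finset.sum_le_sum_of_subset_of_nonneg (fun y hy => (Finset.mem_filter.1 hy).2)
      fun _ _ _ => pairSum_nonneg _ _ _ _).trans (Finset.sum_le_sum fun ρ _ => ?_)
    refine (pairSum_le hα hα1 N R hR (x₀ + ρ) (by omega)).trans (add_le_add ?_ ?_)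
    · have h2 : ((x₀ + ρ : ℕ) : ℝ) ^ (1 - 2 * α) ≤ (x₀ : ℝ) ^ (-(2 * α - 1)) := by
        rw [neg_sub]
        exact Real.rpow_le_rpow_of_nonpos hx₀' (by exact_mod_cast Nat.le_add_right _ _)
          (by linarith)
      have h3 := h2.trans (rpow_neg_le_decay hκ0 (by rw [hκ]; linarith) x₀)
      exact mul_le_mul_of_nonneg_left h3 (by linarith)
    · refine mul_le_mul hA2 (Finset.sum_le_sum fun σ _ => ?_)
        (Finset.sum_nonneg fun _ _ => wt_nonneg _ _ _) (by linarith)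
      simpa using wt_sub_le_near hκ0 hκα hR (x₀ + ρ) σ
  have s2 : ∀ ρ : ℕ, ∑ x ∈ Finset.range (x₀ + 1), ((x : ℝ) ^ (-α) * wt α R (x₀ + x - ρ) +
        if x ∈ R then wt α R (x₀ + x - ρ) else 0) ≤
      Z * decay κ ((x₀ : ℤ) - ρ) + ∑ σ ∈ R, decay κ ((σ : ℤ) + ρ - x₀) +
        ∑ σ ∈ R, near κ R ((x₀ : ℤ) + σ - ρ) := by
    intro ρ
    rw [Finset.sum_add_distrib]
    refine add_le_add (hZ R hR x₀ ρ _) ?_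
    rw [← Finset.sum_filter]
    refine (Finset.sum_le_sum_of_subset_of_nonneg (fun y hy => (Finset.mem_filter.1 hy).2)
      fun _ _ _ => wt_nonneg _ _ _).trans (Finset.sum_le_sum fun σ _ => ?_)
    simpa using wt_sub_le_near hκ0 hκα hR (x₀ + σ) ρ
  calc _ ≤ _ := Finset.sum_le_sum fun x _ => hterm x
    _ ≤ E * ∑ ρ ∈ r, (A * decay κ x₀ + A * ∑ σ ∈ R, near κ R ((x₀ : ℤ) + ρ - σ)) +
        2 * g * E * ∑ ρ ∈ r, (Z * decay κ ((x₀ : ℤ) - ρ) +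
          ∑ σ ∈ R, decay κ ((σ : ℤ) + ρ - x₀) + ∑ σ ∈ R, near κ R ((x₀ : ℤ) + σ - ρ)) := by
      rw [Finset.sum_add_distrib, ← Finset.mul_sum, ← Finset.mul_sum,
        Finset.sum_comm (s := Finset.range (x₀ + 1))]
      gcongr
      exact s2 _
    _ ≤ _ := by
      rw [Finset.mul_sum, Finset.mul_sum, Finset.mul_sum, ← Finset.sum_add_distrib]
      refine Finset.sum_le_sum fun ρ _ => ?_
      rw [Finset.sum_add_distrib, Finset.sum_add_distrib]
      have q1 := decay_nonneg κ x₀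
      have q2 := decay_nonneg κ ((x₀ : ℤ) - ρ)
      have q3 : 0 ≤ ∑ σ ∈ R, decay κ ((σ : ℤ) + ρ - x₀) :=
        Finset.sum_nonneg fun _ _ => decay_nonneg _ _
      have q4 : 0 ≤ ∑ σ ∈ R, near κ R ((x₀ : ℤ) + ρ - σ) :=
        Finset.sum_nonneg fun _ _ => near_nonneg _ _ _
      have q5 : 0 ≤ ∑ σ ∈ R, near κ R ((x₀ : ℤ) + σ - ρ) :=
        Finset.sum_nonneg fun _ _ => near_nonneg _ _ _
      exact weighted_sum_le hE0.le (by linarith) hZ0.le (Nat.cast_nonneg g) q1 q2 q3 q4 q5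

def plane (n : ℕ) : Finset (Fin 3 → ℕ) :=
  (Fintype.piFinset fun _ => Finset.range (n + 1)).filter fun t => t 0 + t 1 + t 2 = n

lemma mem_plane {n : ℕ} {t : Fin 3 → ℕ} : t ∈ plane n ↔ t 0 + t 1 + t 2 = n := by
  simp only [plane, Finset.mem_filter, Fintype.mem_piFinset, Finset.mem_range,
    and_iff_right_iff_imp]
  intro h i
  fin_cases i <;> simp <;> omega

lemma le_of_mem_plane {n : ℕ} {t : Fin 3 → ℕ} (h : t ∈ plane n) (i : Fin 3) : t i ≤ n := by
  have := mem_plane.1 h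
  fin_cases i <;> simp <;> omega

lemma eq_of_mem_plane {n : ℕ} {s t : Fin 3 → ℕ} (hs : s ∈ plane n) (ht : t ∈ plane n)
    {i j : Fin 3} (hij : i ≠ j) (hi : s i = t i) (hj : s j = t j) : s = t := by
  have h1 := mem_plane.1 hs
  have h2 := mem_plane.1 ht
  ext k
  fin_cases i <;> fin_cases j <;> fin_cases k <;> simp at * <;> omega

lemma card_plane_filter_le (n : ℕ) {i j : Fin 3} (hij : i ≠ j) (A B : Finset ℕ) :
    ((plane n).filter fun t => t i ∈ A ∧ t j ∈ B).card ≤ A.card * B.card := by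
  rw [← Finset.card_product]
  refine Finset.card_le_card_of_injOn (fun t => (t i, t j)) ?_ ?_
  · intro t ht
    have := (Finset.mem_filter.1 (Finset.mem_coe.1 ht)).2
    simpa using this
  · intro s hs t ht hst
    simp only [Prod.mk.injEq] at hst
    exact eq_of_mem_plane (Finset.mem_filter.1 hs).1 (Finset.mem_filter.1 ht).1 hij hst.1 hst.2

def slab (n G : ℕ) : Finset (Fin 3 → ℕ) := (plane n).filter fun t => ∃ i, t i ≤ G

lemma card_slab_le (n G : ℕ) : (slab n G).card ≤ 3 * ((G + 1) * (n + 1)) := by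
  have hsub : slab n G ⊆ Finset.univ.biUnion fun i : Fin 3 =>
      (plane n).filter fun t =>
        t i ∈ Finset.range (G + 1) ∧ t (i + 1) ∈ Finset.range (n + 1) := by
    intro t ht
    obtain ⟨hp, i, hi⟩ := Finset.mem_filter.1 ht
    refine Finset.mem_biUnion.2 ⟨i, Finset.mem_univ _, Finset.mem_filter.2 ⟨hp, ?_⟩⟩
    have := le_of_mem_plane hp (i + 1)
    simp only [Finset.mem_range]
    omega
  refine (Finset.card_le_card hsub).trans (Finset.card_biUnion_le.trans ?_)
  refine (Finset.sum_le_sum fun i _ => card_plane_filter_le n (i := i) (j := i + 1)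
    (by fin_cases i <;> decide) _ _).trans ?_
  simp

lemma card_line_le (n : ℕ) {c₀ c₁ c₂ : ℤ} (c v : ℤ) (hc : ¬(c₀ = c₁ ∧ c₁ = c₂)) :
    ((plane n).filter fun t => c₀ * t 0 + c₁ * t 1 + c₂ * t 2 + c = v).card ≤ n + 1 := by
  have main : ∃ i : Fin 3, Set.InjOn (fun t : Fin 3 → ℕ => t i)
      ((plane n).filter fun t => c₀ * t 0 + c₁ * t 1 + c₂ * t 2 + c = v : Finset _) := by
    by_cases h : c₁ = c₂
    · have h0 : c₀ - c₁ ≠ 0 := fun h' => hc ⟨by omega, h⟩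
      refine ⟨1, fun s hs t ht hst => ?_⟩
      obtain ⟨hs1, hs2⟩ := Finset.mem_filter.1 (Finset.mem_coe.1 hs)
      obtain ⟨ht1, ht2⟩ := Finset.mem_filter.1 (Finset.mem_coe.1 ht)
      refine eq_of_mem_plane hs1 ht1 (i := 1) (j := 0) (by decide) hst ?_
      have e1 : (s 0 : ℤ) + s 1 + s 2 = n := by exact_mod_cast mem_plane.1 hs1
      have e2 : (t 0 : ℤ) + t 1 + t 2 = n := by exact_mod_cast mem_plane.1 ht1
      have : (c₀ - c₁) * ((s 0 : ℤ) - t 0) = 0 := by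
        subst h; linear_combination hs2 - ht2 - c₁ * e1 + c₁ * e2
      have := (mul_eq_zero.1 this).resolve_left h0
      omega
    · have h0 : c₁ - c₂ ≠ 0 := fun h' => h (by omega)
      refine ⟨0, fun s hs t ht hst => ?_⟩
      obtain ⟨hs1, hs2⟩ := Finset.mem_filter.1 (Finset.mem_coe.1 hs)
      obtain ⟨ht1, ht2⟩ := Finset.mem_filter.1 (Finset.mem_coe.1 ht)
      refine eq_of_mem_plane hs1 ht1 (i := 0) (j := 1) (by decide) hst ?_
      have e1 : (s 0 : ℤ) + s 1 + s 2 = n := by exact_mod_cast mem_plane.1 hs1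
      have e2 : (t 0 : ℤ) + t 1 + t 2 = n := by exact_mod_cast mem_plane.1 ht1
      have e3 : (s 0 : ℤ) = t 0 := by exact_mod_cast hst
      have : (c₁ - c₂) * ((s 1 : ℤ) - t 1) = 0 := by
        linear_combination hs2 - ht2 - c₂ * e1 + c₂ * e2 - (c₀ - c₂) * e3
      have := (mul_eq_zero.1 this).resolve_left h0
      omega
  obtain ⟨i, hi⟩ := main
  refine (Finset.card_le_card_of_injOn (t := Finset.range (n + 1)) _ ?_ hi).trans (by simp)
  intro t ht
  have := le_of_mem_plane (Finset.mem_filter.1 (Finset.mem_coe.1 ht)).1 i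
  simp only [Finset.coe_range, Set.mem_Iio]
  omega

lemma sum_decay_slab_le {κ : ℝ} (hκ : 0 < κ) (n G V : ℕ) (hV : 1 ≤ V) {c₀ c₁ c₂ : ℤ} (c : ℤ)
    (hc : ¬(c₀ = c₁ ∧ c₁ = c₂)) :
    ∑ t ∈ slab n G, decay κ (c₀ * t 0 + c₁ * t 1 + c₂ * t 2 + c) ≤
      (V : ℝ) ^ (-κ) * (3 * ((G + 1) * (n + 1))) + (2 * V + 1) * (n + 1) := by
  have hV' : (0 : ℝ) < V := by exact_mod_cast hV
  have key : ∀ v : ℤ, decay κ v ≤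
      (V : ℝ) ^ (-κ) + ∑ j ∈ Finset.Icc (-(V : ℤ)) V, if v = j then (1 : ℝ) else 0 := by
    intro v
    rw [Finset.sum_ite_eq]
    by_cases hv : v ∈ Finset.Icc (-(V : ℤ)) V
    · rw [if_pos hv]
      have : (0 : ℝ) ≤ (V : ℝ) ^ (-κ) := by positivity
      linarith [decay_le_one hκ v]
    · rw [if_neg hv, add_zero]
      refine decay_le hκ hV' ?_
      have : (V : ℤ) ≤ |v| := by
        by_contra h
        have := abs_lt.1 (not_le.1 h)
        exact hv (Finset.mem_Icc.2 ⟨by omega, by omega⟩)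
      exact_mod_cast this
  refine (Finset.sum_le_sum fun t _ => key _).trans ?_
  rw [Finset.sum_add_distrib, Finset.sum_const, nsmul_eq_mul, mul_comm, Finset.sum_comm]
  refine add_le_add ?_ ?_
  · have : ((slab n G).card : ℝ) ≤ 3 * ((G + 1) * (n + 1)) := by exact_mod_cast card_slab_le n G
    gcongr
  · calc _ ≤ ∑ j ∈ Finset.Icc (-(V : ℤ)) V, ((n : ℝ) + 1) := by
          refine Finset.sum_le_sum fun j _ => ?_
          rw [← Finset.sum_filter, Finset.sum_const, nsmul_eq_mul, mul_one]
          have h := card_line_le n c j hc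
          have h2 : ((slab n G).filter fun t =>
              c₀ * t 0 + c₁ * t 1 + c₂ * t 2 + c = j).card ≤ n + 1 :=
            (Finset.card_le_card (Finset.filter_subset_filter _
              (Finset.filter_subset _ _))).trans h
          exact_mod_cast h2
      _ = _ := by
          rw [Finset.sum_const, nsmul_eq_mul, Int.card_Icc]
          congr 1
          have : ((V : ℤ) + 1 - -(V : ℤ)).toNat = 2 * V + 1 := by omega
          rw [this]; push_cast; ring

/-- Affine forms in the second and third entry of a triple whose values are the elements of
`r` and these two entries. -/
def entryForms (r : Finset ℕ) : Finset (ℤ × ℤ × ℤ) :=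
  insert (1, 0, 0) (insert (0, 1, 0) (r.image fun ρ : ℕ => (0, 0, (ρ : ℤ))))

def formVal (e : ℤ × ℤ × ℤ) (t : Fin 3 → ℕ) : ℤ := e.1 * t 1 + e.2.1 * t 2 + e.2.2

lemma card_entryForms_le (r : Finset ℕ) : (entryForms r).card ≤ r.card + 2 := by
  unfold entryForms
  have h1 := Finset.card_insert_le ((1, 0, 0) : ℤ × ℤ × ℤ)
    (insert (0, 1, 0) (r.image fun ρ : ℕ => (0, 0, (ρ : ℤ))))
  have h2 := Finset.card_insert_le ((0, 1, 0) : ℤ × ℤ × ℤ) (r.image fun ρ : ℕ => (0, 0, (ρ : ℤ)))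
  have h3 := Finset.card_image_le (s := r) (f := fun ρ : ℕ => ((0, 0, (ρ : ℤ)) : ℤ × ℤ × ℤ))
  omega

lemma coeff_of_mem_entryForms {r : Finset ℕ} {e : ℤ × ℤ × ℤ} (he : e ∈ entryForms r) :
    0 ≤ e.1 ∧ 0 ≤ e.2.1 ∧ e.1 + e.2.1 ≤ 1 := by
  simp only [entryForms, Finset.mem_insert, Finset.mem_image] at he
  rcases he with rfl | rfl | ⟨ρ, _, rfl⟩ <;> simp

lemma sum_entries_le (r : Finset ℕ) (t : Fin 3 → ℕ) {F : ℤ → ℝ} (hF : ∀ v, 0 ≤ F v) :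
    ∑ σ ∈ insert (t 1) (insert (t 2) r), F σ ≤ ∑ e ∈ entryForms r, F (formVal e t) := by
  rw [← Finset.sum_image (f := F) (g := fun σ : ℕ => (σ : ℤ))
    (fun a _ b _ h => Nat.cast_injective h)]
  refine (Finset.sum_le_sum_of_subset_of_nonneg ?_ fun v _ _ => hF v).trans
    (Finset.sum_image_le_of_nonneg (g := fun e => formVal e t) fun v _ => hF v)
  intro v hv
  simp only [Finset.mem_image, Finset.mem_insert] at hv
  simp only [Finset.mem_image, entryForms, Finset.mem_insert]
  rcases hv with ⟨σ, rfl | rfl | hσ, rfl⟩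
  · exact ⟨_, Or.inl rfl, by simp [formVal]⟩
  · exact ⟨_, Or.inr (Or.inl rfl), by simp [formVal]⟩
  · exact ⟨_, Or.inr (Or.inr ⟨σ, hσ, rfl⟩), by simp [formVal]⟩

lemma near_entries_le (κ : ℝ) (r : Finset ℕ) (t : Fin 3 → ℕ) (v : ℤ) :
    near κ (insert (t 1) (insert (t 2) r)) v ≤
      decay κ v + ∑ e ∈ entryForms r, decay κ (v - formVal e t) :=
  add_le_add_right (sum_entries_le r t (F := fun w => decay κ (v - w))
    fun _ => decay_nonneg _ _) _

lemma sum_hit_bound_le {κ Q : ℝ} {T : Finset (Fin 3 → ℕ)} (D : ℕ)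
    (hQ : ∀ c₀ c₁ c₂ c : ℤ, ¬(c₀ = c₁ ∧ c₁ = c₂) →
      ∑ t ∈ T, decay κ (c₀ * t 0 + c₁ * t 1 + c₂ * t 2 + c) ≤ Q)
    {r : Finset ℕ} (hr : r.card + 2 ≤ D) :
    ∑ t ∈ T, ∑ ρ ∈ r, (decay κ (t 0) + decay κ ((t 0 : ℤ) - ρ) +
        ∑ σ ∈ insert (t 1) (insert (t 2) r), (decay κ ((σ : ℤ) + ρ - t 0) +
          near κ (insert (t 1) (insert (t 2) r)) ((t 0 : ℤ) + ρ - σ) +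
          near κ (insert (t 1) (insert (t 2) r)) ((t 0 : ℤ) + σ - ρ))) ≤
      D * (2 + D * (3 + 2 * D)) * Q := by
  have hQ0 : 0 ≤ Q := (Finset.sum_nonneg fun _ _ => decay_nonneg _ _).trans
    (hQ 1 0 0 0 (by simp))
  have hD : ((entryForms r).card : ℝ) ≤ D := by
    exact_mod_cast (card_entryForms_le r).trans hr
  have hrD : (r.card : ℝ) ≤ D := by exact_mod_cast (by omega : r.card ≤ D)
  have form : ∀ c₀ c₁ c₂ c : ℤ, ¬(c₀ = c₁ ∧ c₁ = c₂) → ∀ f : (Fin 3 → ℕ) → ℤ,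
      (∀ t, f t = c₀ * t 0 + c₁ * t 1 + c₂ * t 2 + c) → ∑ t ∈ T, decay κ (f t) ≤ Q := by
    intro c₀ c₁ c₂ c hc f hf
    simpa only [hf] using hQ c₀ c₁ c₂ c hc
  have hpt : ∀ t : Fin 3 → ℕ, ∀ ρ : ℕ,
      ∑ σ ∈ insert (t 1) (insert (t 2) r), (decay κ ((σ : ℤ) + ρ - t 0) +
          near κ (insert (t 1) (insert (t 2) r)) ((t 0 : ℤ) + ρ - σ) +
          near κ (insert (t 1) (insert (t 2) r)) ((t 0 : ℤ) + σ - ρ)) ≤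
      ∑ e ∈ entryForms r, (decay κ (formVal e t + ρ - t 0) +
        (decay κ ((t 0 : ℤ) + ρ - formVal e t) +
          ∑ e' ∈ entryForms r, decay κ ((t 0 : ℤ) + ρ - formVal e t - formVal e' t)) +
        (decay κ ((t 0 : ℤ) + formVal e t - ρ) +
          ∑ e' ∈ entryForms r, decay κ ((t 0 : ℤ) + formVal e t - ρ - formVal e' t))) := by
    intro t ρ
    refine (sum_entries_le r t (F := fun w => decay κ (w + ρ - t 0) +
      near κ (insert (t 1) (insert (t 2) r)) ((t 0 : ℤ) + ρ - w) +
      near κ (insert (t 1) (insert (t 2) r)) ((t 0 : ℤ) + w - ρ))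
      fun w => add_nonneg (add_nonneg (decay_nonneg _ _) (near_nonneg _ _ _))
        (near_nonneg _ _ _)).trans (Finset.sum_le_sum fun e _ => ?_)
    gcongr <;> exact near_entries_le _ _ _ _
  have hconst : ∀ {ι : Type} (s : Finset ι) (f : ι → ℝ) (b : ℝ), 0 ≤ b → (s.card : ℝ) ≤ D →
      (∀ i ∈ s, f i ≤ b) → ∑ i ∈ s, f i ≤ D * b := by
    intro ι s f b hb hs hf
    refine (Finset.sum_le_sum hf).trans ?_
    rw [Finset.sum_const, nsmul_eq_mul]
    gcongr
  calc _ ≤ ∑ t ∈ T, ∑ ρ ∈ r, (decay κ (t 0) + decay κ ((t 0 : ℤ) - ρ) + _) :=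
        Finset.sum_le_sum fun t _ => Finset.sum_le_sum fun ρ _ => add_le_add_right (hpt t ρ) _
    _ ≤ D * (Q + Q + D * (Q + (Q + D * Q) + (Q + D * Q))) := by
      rw [Finset.sum_comm]
      refine hconst _ _ _ (by positivity) hrD fun ρ _ => ?_
      rw [Finset.sum_add_distrib, Finset.sum_add_distrib]
      refine add_le_add (add_le_add ?_ ?_) ?_
      · exact form 1 0 0 0 (by simp) _ fun t => by ring
      · exact form 1 0 0 (-ρ) (by simp) _ fun t => by ring
      rw [Finset.sum_comm]
      refine hconst _ _ _ (by positivity) hD fun e he => ?_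
      obtain ⟨a1, a2, a3⟩ := coeff_of_mem_entryForms he
      rw [Finset.sum_add_distrib, Finset.sum_add_distrib, Finset.sum_add_distrib,
        Finset.sum_add_distrib]
      refine add_le_add (add_le_add ?_ (add_le_add ?_ ?_)) (add_le_add ?_ ?_)
      · exact form (-1) e.1 e.2.1 (e.2.2 + ρ) (by omega) _ fun t => by unfold formVal; ring
      · exact form 1 (-e.1) (-e.2.1) (ρ - e.2.2) (by omega) _ fun t => by unfold formVal; ring
      · rw [Finset.sum_comm]
        refine hconst _ _ _ hQ0 hD fun e' he' => ?_
        obtain ⟨b1, b2, b3⟩ := coeff_of_mem_entryForms he'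
        exact form 1 (-e.1 - e'.1) (-e.2.1 - e'.2.1) (ρ - e.2.2 - e'.2.2) (by omega) _
          fun t => by unfold formVal; ring
      · exact form 1 e.1 e.2.1 (e.2.2 - ρ) (by omega) _ fun t => by unfold formVal; ring
      · rw [Finset.sum_comm]
        refine hconst _ _ _ hQ0 hD fun e' he' => ?_
        obtain ⟨b1, b2, b3⟩ := coeff_of_mem_entryForms he'
        exact form 1 (e.1 - e'.1) (e.2.1 - e'.2.1) (e.2.2 - ρ - e'.2.2) (by omega) _
          fun t => by unfold formVal; ring
    _ = _ := by ring

/-- The leading triple `(x₁, x₂, x₃)` of a tuple, as a vector. -/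
def lead (g : ℕ) (x : Fin (2 * g + 4) → ℕ) : Fin 3 → ℕ :=
  ![x ⟨0, by omega⟩, x ⟨1, by omega⟩, x ⟨2, by omega⟩]

def partner (g : ℕ) (x : Fin (2 * g + 4) → ℕ) : ℕ := x ⟨3, by omega⟩

def pairFst (g : ℕ) (x : Fin (2 * g + 4) → ℕ) (k : Fin g) : ℕ := x ⟨2 * k + 4, by omega⟩

def pairSnd (g : ℕ) (x : Fin (2 * g + 4) → ℕ) (k : Fin g) : ℕ := x ⟨2 * k + 5, by omega⟩

def tripWt (α : ℝ) (r : Finset ℕ) (t : Fin 3 → ℕ) : ℝ :=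
  wt α r (t 0) * wt α r (t 1) * wt α r (t 2)

/-- The weight of the last `2g + 1` entries of a tuple, with `x₂`, `x₃` and the elements of
`r` counted with weight one. -/
def tailWt (g : ℕ) (α : ℝ) (r : Finset ℕ) (t : Fin 3 → ℕ) (z : ℕ) (y : Fin g → ℕ) : ℝ :=
  wt α (insert (t 1) (insert (t 2) r)) z *
    ∏ k, pairWt α (insert (t 1) (insert (t 2) r)) (y k) (t 0 + z - y k)

lemma tripWt_nonneg (α : ℝ) (r : Finset ℕ) (t : Fin 3 → ℕ) : 0 ≤ tripWt α r t :=
  mul_nonneg (mul_nonneg (wt_nonneg _ _ _) (wt_nonneg _ _ _)) (wt_nonneg _ _ _)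

lemma tailWt_nonneg (g : ℕ) (α : ℝ) (r : Finset ℕ) (t : Fin 3 → ℕ) (z : ℕ) (y : Fin g → ℕ) :
    0 ≤ tailWt g α r t z y :=
  mul_nonneg (wt_nonneg _ _ _) (Finset.prod_nonneg fun _ _ => pairWt_nonneg _ _ _ _)

lemma Rtrip.pairwise_ne {g M n a b c : ℕ} {lam : ℝ} {s : ℕ → Fin 3 → ZMod M}
    {CM : Set (ZMod M)} (hs : GoodS M CM s) (h : Rtrip g M lam s n a b c) :
    a ≠ b ∧ a ≠ c ∧ b ≠ c := by
  obtain ⟨-, h01, h02, h12, -⟩ := hs n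
  obtain ⟨-, -, -, -, -, -, -, -, -, -, ha, hb, hc⟩ := h
  refine ⟨?_, ?_, ?_⟩ <;> rintro rfl
  · exact h01 (ha.symm.trans hb)
  · exact h02 (ha.symm.trans hc)
  · exact h12 (hb.symm.trans hc)

lemma pair_eq_of_add_eq {p q p' q' a : ℕ} (h : p + q = p' + q') (h1 : a ∈ ({p, q} : Finset ℕ))
    (h2 : a ∈ ({p', q'} : Finset ℕ)) : ({p, q} : Finset ℕ) = {p', q'} := by
  simp only [Finset.mem_insert, Finset.mem_singleton] at h1 h2
  obtain ⟨rfl, rfl⟩ | ⟨rfl, rfl⟩ : (p = p' ∧ q = q') ∨ (p = q' ∧ q = p') := by omega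
  · rfl
  · exact Finset.pair_comm _ _

lemma pairOf_zero (g : ℕ) (x : Fin (2 * g + 4) → ℕ) :
    pairOf g x 0 = {lead g x 0, partner g x} := by
  simp [pairOf, lead, partner]

lemma pairOf_succ {g : ℕ} (x : Fin (2 * g + 4) → ℕ) (k : Fin g) :
    pairOf g x (k + 1) = {pairFst g x k, pairSnd g x k} := by
  have : (k : ℕ) + 1 ≤ g := k.isLt
  rw [pairOf, if_neg (by omega), dif_pos this]
  rfl

lemma firstThree_eq (g : ℕ) (x : Fin (2 * g + 4) → ℕ) :
    firstThree g x = {lead g x 0, lead g x 1, lead g x 2} := rfl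

section Tuple

variable {g M n : ℕ} {lam : ℝ} {s : ℕ → Fin 3 → ZMod M} {x : Fin (2 * g + 4) → ℕ}

lemma pair_sum_of_mem_Tn (hx : x ∈ Tn g M lam s n) (k : Fin g) :
    lead g x 0 + partner g x = pairFst g x k + pairSnd g x k :=
  hx.2.2.1 (k + 2) (by omega) (by have := k.isLt; omega)

lemma pair_snd_eq_of_mem_Tn (hx : x ∈ Tn g M lam s n) (k : Fin g) :
    lead g x 0 + partner g x - pairFst g x k = pairSnd g x k := by
  have := pair_sum_of_mem_Tn hx k
  omega

lemma le_lead_of_mem_Tn (hx : x ∈ Tn g M lam s n) :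
    partner g x ≤ lead g x 0 ∧ ∀ k, pairFst g x k ≤ lead g x 0 ∧ pairSnd g x k ≤ lead g x 0 :=
  ⟨hx.2.2.2.1 ⟨3, by omega⟩ le_rfl, fun k =>
    ⟨hx.2.2.2.1 ⟨2 * k + 4, by omega⟩ (by simp), hx.2.2.2.1 ⟨2 * k + 5, by omega⟩ (by simp)⟩⟩

lemma disjoint_pairs_of_mem_Tn (hx : x ∈ Tn g M lam s n) {j k : Fin g} (hjk : j ≠ k) :
    Disjoint ({pairFst g x j, pairSnd g x j} : Finset ℕ) {pairFst g x k, pairSnd g x k} := by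
  rw [Finset.disjoint_left]
  intro a ha ha'
  refine hx.2.2.2.2.2 (j + 1) (k + 1) j.isLt k.isLt (by omega) ?_
  rw [pairOf_succ, pairOf_succ]
  exact pair_eq_of_add_eq ((pair_sum_of_mem_Tn hx j).symm.trans (pair_sum_of_mem_Tn hx k)) ha ha'

lemma disjoint_first_pair_of_mem_Tn (hx : x ∈ Tn g M lam s n) (k : Fin g) :
    Disjoint ({lead g x 0, partner g x} : Finset ℕ) {pairFst g x k, pairSnd g x k} := by
  rw [Finset.disjoint_left]
  intro a ha ha'
  refine hx.2.2.2.2.2 0 (k + 1) (Nat.zero_le _) k.isLt (by omega) ?_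
  rw [pairOf_succ, pairOf_zero]
  exact pair_eq_of_add_eq (pair_sum_of_mem_Tn hx k) ha ha'

lemma lead_ne_partner_of_mem_Tn (hg : 1 ≤ g) (hx : x ∈ Tn g M lam s n) :
    lead g x 0 ≠ partner g x := by
  intro h
  have h1 := pair_sum_of_mem_Tn hx ⟨0, hg⟩
  obtain ⟨h2, h3⟩ := (le_lead_of_mem_Tn hx).2 ⟨0, hg⟩
  have := Finset.disjoint_left.1 (disjoint_first_pair_of_mem_Tn hx ⟨0, hg⟩)
    (Finset.mem_insert_self _ _)
  exact this (Finset.mem_insert.2 (Or.inl (by omega)))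

lemma exists_Rtrip_of_mem_Tn {CM : Set (ZMod M)} (hs : GoodS M CM s) (hx : x ∈ Tn g M lam s n) :
    lead g x 0 ≠ lead g x 1 ∧ lead g x 0 ≠ lead g x 2 ∧ lead g x 1 ≠ lead g x 2 ∧
    ∃ a b c, Rtrip g M lam s n a b c ∧ firstThree g x = {a, b, c} := by
  obtain ⟨a, b, c, habc, h⟩ := hx.2.1
  obtain ⟨h1, h2, h3⟩ := h.pairwise_ne hs
  have hcard : (firstThree g x).card = 3 := by
    rw [habc]; exact Finset.card_eq_three.2 ⟨a, b, c, h1, h2, h3, rfl⟩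
  rw [firstThree_eq] at hcard
  refine ⟨?_, ?_, ?_, a, b, c, h, habc⟩ <;> intro h' <;> rw [h'] at hcard
  · have := Finset.card_le_two (a := lead g x 1) (b := lead g x 2)
    simp at hcard; omega
  · have := Finset.card_le_two (a := lead g x 1) (b := lead g x 2)
    rw [Finset.insert_eq_of_mem (by simp)] at hcard; omega
  · have := Finset.card_le_two (a := lead g x 0) (b := lead g x 2)
    simp at hcard; omega

lemma prod_firstThree {CM : Set (ZMod M)} (hs : GoodS M CM s) (hx : x ∈ Tn g M lam s n)
    (f : ℕ → ℝ) :
    ∏ a ∈ firstThree g x, f a = f (lead g x 0) * f (lead g x 1) * f (lead g x 2) := by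
  obtain ⟨h1, h2, h3, -⟩ := exists_Rtrip_of_mem_Tn hs hx
  rw [firstThree_eq, Finset.prod_insert (by simp [h1, h2]), Finset.prod_pair h3, mul_assoc]

lemma lead_mem_slab {CM : Set (ZMod M)} (hs : GoodS M CM s) (hx : x ∈ Tn g M lam s n) :
    lead g x ∈ slab n ⌊glam g lam n⌋₊ := by
  obtain ⟨h1, h2, h3, a, b, c, h, habc⟩ := exists_Rtrip_of_mem_Tn hs hx
  obtain ⟨h1', h2', h3'⟩ := h.pairwise_ne hs
  rw [firstThree_eq] at habc
  have hsum : ∑ i ∈ ({lead g x 0, lead g x 1, lead g x 2} : Finset ℕ), i = a + b + c := by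
    rw [habc, Finset.sum_insert (by simp [h1', h2']), Finset.sum_pair h3', add_assoc]
  rw [Finset.sum_insert (by simp [h1, h2]), Finset.sum_pair h3, ← add_assoc, h.2.2.2.1] at hsum
  refine Finset.mem_filter.2 ⟨mem_plane.2 hsum, ?_⟩
  have ha : a ≤ ⌊glam g lam n⌋₊ := Nat.le_floor h.2.2.2.2.2.1
  have : a ∈ ({lead g x 0, lead g x 1, lead g x 2} : Finset ℕ) := by rw [habc]; simp
  simp only [Finset.mem_insert, Finset.mem_singleton] at this
  rcases this with h | h | h
  · exact ⟨0, h ▸ ha⟩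
  · exact ⟨1, h ▸ ha⟩
  · exact ⟨2, h ▸ ha⟩

lemma mem_tail_iff {a : ℕ} :
    a ∈ insert (partner g x) (Finset.univ.biUnion fun k : Fin g =>
      ({pairFst g x k, pairSnd g x k} : Finset ℕ)) ↔
    a = partner g x ∨ ∃ k, a = pairFst g x k ∨ a = pairSnd g x k := by
  simp

lemma imgF_eq (g : ℕ) (x : Fin (2 * g + 4) → ℕ) :
    imgF x = firstThree g x ∪ insert (partner g x) (Finset.univ.biUnion fun k : Fin g =>
      ({pairFst g x k, pairSnd g x k} : Finset ℕ)) := by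
  ext a
  rw [Finset.mem_union, mem_tail_iff]
  simp only [imgF, Finset.mem_image, Finset.mem_univ, true_and, firstThree, Finset.mem_insert,
    Finset.mem_singleton]
  constructor
  · rintro ⟨⟨i, hi⟩, rfl⟩
    rcases Nat.lt_or_ge i 4 with h | h
    · interval_cases i
      · exact Or.inl (Or.inl rfl)
      · exact Or.inl (Or.inr (Or.inl rfl))
      · exact Or.inl (Or.inr (Or.inr rfl))
      · exact Or.inr (Or.inl rfl)
    · rcases Nat.even_or_odd' i with ⟨k, rfl | rfl⟩
      · refine Or.inr (Or.inr ⟨⟨k - 2, by omega⟩, Or.inl (congrArg x (Fin.ext ?_))⟩)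
        simp only; omega
      · refine Or.inr (Or.inr ⟨⟨k - 2, by omega⟩, Or.inr (congrArg x (Fin.ext ?_))⟩)
        simp only; omega
  · rintro ((rfl | rfl | rfl) | rfl | ⟨k, rfl | rfl⟩) <;> exact ⟨_, rfl⟩

lemma prod_le_tripWt_mul_tailWt {CM : Set (ZMod M)} {α : ℝ} (hα : 0 < α) (hg : 1 ≤ g)
    (hlam : 1 < lam) (hs : GoodS M CM s) (hx : x ∈ Tn g M lam s n) (r : Finset ℕ) :
    ∏ y ∈ imgF x \ r, lam⁻¹ * (y : ℝ) ^ (-α) ≤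
      tripWt α r (lead g x) * tailWt g α r (lead g x) (partner g x) (pairFst g x) := by
  set R := insert (lead g x 1) (insert (lead g x 2) r) with hR
  set T := insert (partner g x) (Finset.univ.biUnion fun k : Fin g =>
      ({pairFst g x k, pairSnd g x k} : Finset ℕ)) with hT
  have hrR : r ⊆ R := (Finset.subset_insert _ _).trans (Finset.subset_insert _ _)
  have hT0 : lead g x 0 ∉ T := by
    rw [hT, mem_tail_iff]
    rintro (h | ⟨k, h⟩)
    · exact lead_ne_partner_of_mem_Tn hg hx h
    · exact Finset.disjoint_left.1 (disjoint_first_pair_of_mem_Tn hx k)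
        (Finset.mem_insert_self _ _) (by simpa using h)
  have hTprod : ∏ a ∈ T, wt α R a = tailWt g α r (lead g x) (partner g x) (pairFst g x) := by
    rw [hT, Finset.prod_insert, Finset.prod_biUnion, tailWt]
    · simp only [pair_snd_eq_of_mem_Tn hx, pairWt, hR]
    · exact fun j _ k _ hjk => disjoint_pairs_of_mem_Tn hx hjk
    · simp only [Finset.mem_biUnion, Finset.mem_univ, true_and, not_exists]
      exact fun k => Finset.disjoint_left.1 (disjoint_first_pair_of_mem_Tn hx k) (by simp)
  calc ∏ y ∈ imgF x \ r, lam⁻¹ * (y : ℝ) ^ (-α)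
      ≤ ∏ y ∈ imgF x \ r, wt α r y := by
        refine Finset.prod_le_prod (fun y _ => by positivity) fun y hy => ?_
        rw [wt, if_neg (Finset.mem_sdiff.1 hy).2]
        exact mul_le_of_le_one_left (by positivity) (inv_le_one_of_one_le₀ hlam.le)
    _ = ∏ y ∈ imgF x, wt α r y := by
        refine Finset.prod_subset Finset.sdiff_subset fun y hy hy' => if_pos ?_
        by_contra h
        exact hy' (Finset.mem_sdiff.2 ⟨hy, h⟩)
    _ = (∏ y ∈ firstThree g x, wt α r y) * ∏ y ∈ T \ firstThree g x, wt α r y := by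
        rw [imgF_eq, ← hT, ← Finset.union_sdiff_self_eq_union,
          Finset.prod_union Finset.disjoint_sdiff]
    _ ≤ (∏ y ∈ firstThree g x, wt α r y) * ∏ y ∈ T \ firstThree g x, wt α R y := by
        refine mul_le_mul_of_nonneg_left (Finset.prod_le_prod (fun _ _ => wt_nonneg _ _ _)
          fun y _ => wt_mono hα hrR y) (Finset.prod_nonneg fun _ _ => wt_nonneg _ _ _)
    _ = _ := by
        rw [prod_firstThree hs hx, ← tripWt, ← hTprod]
        congr 1
        refine Finset.prod_subset Finset.sdiff_subset fun y hy hy' => if_pos ?_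
        have h : y ∈ firstThree g x := by
          by_contra h
          exact hy' (Finset.mem_sdiff.2 ⟨hy, h⟩)
        rw [firstThree_eq, Finset.mem_insert, Finset.mem_insert, Finset.mem_singleton] at h
        rcases h with rfl | rfl | rfl
        · exact absurd hy hT0
        · simp [hR]
        · simp [hR]

end Tuple

lemma eq_of_lead_partner_pairFst_eq {g M n : ℕ} {lam : ℝ} {s : ℕ → Fin 3 → ZMod M}
    {x x' : Fin (2 * g + 4) → ℕ} (hx : x ∈ Tn g M lam s n) (hx' : x' ∈ Tn g M lam s n)
    (h0 : lead g x = lead g x') (h3 : partner g x = partner g x')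
    (hp : pairFst g x = pairFst g x') : x = x' := by
  have hq : pairSnd g x = pairSnd g x' := by
    ext k
    rw [← pair_snd_eq_of_mem_Tn hx, ← pair_snd_eq_of_mem_Tn hx', h0, h3, hp]
  ext ⟨i, hi⟩
  rcases Nat.lt_or_ge i 4 with h | h
  · interval_cases i
    · exact congrFun h0 0
    · exact congrFun h0 1
    · exact congrFun h0 2
    · exact h3
  · rcases Nat.even_or_odd' i with ⟨k, rfl | rfl⟩
    · have h1 := congrFun hp ⟨k - 2, by omega⟩
      have h2 : 2 * (k - 2) + 4 = 2 * k := by omega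
      simpa only [pairFst, h2] using h1
    · have h1 := congrFun hq ⟨k - 2, by omega⟩
      have h2 : 2 * (k - 2) + 5 = 2 * k + 1 := by omega
      simpa only [pairSnd, h2] using h1

lemma tsum_Tn_le {g M n : ℕ} {lam : ℝ} {s : ℕ → Fin 3 → ZMod M}
    {P : (Fin (2 * g + 4) → ℕ) → Prop} {f : (Fin (2 * g + 4) → ℕ) → ℝ} (hf : ∀ x, 0 ≤ f x)
    {T : Finset (Fin 3 → ℕ)} {Φ : (Fin 3 → ℕ) → ℕ → (Fin g → ℕ) → ℝ}
    (hΦ : ∀ t z y, 0 ≤ Φ t z y)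
    (h : ∀ x ∈ Tn g M lam s n, P x → lead g x ∈ T ∧
      f x ≤ Φ (lead g x) (partner g x) (pairFst g x)) :
    ∑' x : ↥{x ∈ Tn g M lam s n | P x}, f x.1 ≤
      ∑ t ∈ T, ∑ z ∈ Finset.range (t 0 + 1),
        ∑ y ∈ Fintype.piFinset fun _ : Fin g => Finset.range (2 * t 0 + 1), Φ t z y := by
  classical
  refine Real.tsum_le_of_sum_le (fun x => hf x.1) fun u => ?_
  let e : ↥{x ∈ Tn g M lam s n | P x} → (Σ _ : Fin 3 → ℕ, Σ _ : ℕ, (Fin g → ℕ)) :=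
    fun x => ⟨lead g x.1, partner g x.1, pairFst g x.1⟩
  have he : Function.Injective e := by
    intro x x' hxx
    simp only [e, Sigma.mk.injEq, heq_eq_eq] at hxx
    exact Subtype.ext (eq_of_lead_partner_pairFst_eq x.2.1 x'.2.1 hxx.1 hxx.2.1 hxx.2.2)
  let Ψ : (Σ _ : Fin 3 → ℕ, Σ _ : ℕ, (Fin g → ℕ)) → ℝ := fun p => Φ p.1 p.2.1 p.2.2
  calc ∑ x ∈ u, f x.1 ≤ ∑ x ∈ u, Ψ (e x) :=
        Finset.sum_le_sum fun x _ => (h x.1 x.2.1 x.2.2).2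
    _ = ∑ p ∈ u.image e, Ψ p := (Finset.sum_image he.injOn).symm
    _ ≤ ∑ p ∈ T.sigma fun t => (Finset.range (t 0 + 1)).sigma fun _ =>
          Fintype.piFinset fun _ : Fin g => Finset.range (2 * t 0 + 1), Ψ p := by
        refine Finset.sum_le_sum_of_subset_of_nonneg ?_ fun p _ _ => hΦ _ _ _
        intro p hp
        obtain ⟨x, -, rfl⟩ := Finset.mem_image.1 hp
        obtain ⟨h1, h2⟩ := le_lead_of_mem_Tn x.2.1
        refine Finset.mem_sigma.2 ⟨(h x.1 x.2.1 x.2.2).1, Finset.mem_sigma.2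
          ⟨Finset.mem_range.2 (Nat.lt_succ_of_le h1), Fintype.mem_piFinset.2 fun k => ?_⟩⟩
        have := (h2 k).1
        simp only [e, Finset.mem_range]
        omega
    _ = _ := by
        rw [Finset.sum_sigma]
        exact Finset.sum_congr rfl fun t _ => Finset.sum_sigma _ _ _

lemma sum_tailWt (g : ℕ) (α : ℝ) (N : ℕ) (r : Finset ℕ) (t : Fin 3 → ℕ) (z : ℕ) :
    ∑ y ∈ Fintype.piFinset fun _ : Fin g => Finset.range N, tailWt g α r t z y =
      wt α (insert (t 1) (insert (t 2) r)) z *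
        pairSum α N (insert (t 1) (insert (t 2) r)) (t 0 + z) ^ g := by
  simp only [tailWt]
  rw [← Finset.mul_sum]
  congr 1
  rw [← Finset.prod_univ_sum (fun _ : Fin g => Finset.range N)
    (fun _ a => pairWt α (insert (t 1) (insert (t 2) r)) a (t 0 + z - a)), Finset.prod_const,
    Finset.card_univ, Fintype.card_fin]
  rfl

/-- The number of entries of the tail lying in `r`, where each pair counts at most once. -/
def hits (g : ℕ) (r : Finset ℕ) (t : Fin 3 → ℕ) (z : ℕ) (y : Fin g → ℕ) : ℝ :=
  (if z ∈ r then 1 else 0) + ∑ k, if y k ∈ r ∨ t 0 + z - y k ∈ r then 1 else 0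

lemma hits_nonneg (g : ℕ) (r : Finset ℕ) (t : Fin 3 → ℕ) (z : ℕ) (y : Fin g → ℕ) :
    0 ≤ hits g r t z y :=
  add_nonneg (by split_ifs <;> simp) (Finset.sum_nonneg fun _ _ => by split_ifs <;> simp)

lemma sum_hits_mul_tailWt (g : ℕ) (α : ℝ) (N : ℕ) (r : Finset ℕ) (t : Fin 3 → ℕ) (z : ℕ) :
    ∑ y ∈ Fintype.piFinset fun _ : Fin g => Finset.range N,
        hits g r t z y * tailWt g α r t z y =
      wt α (insert (t 1) (insert (t 2) r)) z *
        ((if z ∈ r then pairSum α N (insert (t 1) (insert (t 2) r)) (t 0 + z) ^ g else 0) +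
          g * (hitSum α N r (insert (t 1) (insert (t 2) r)) (t 0 + z) *
            pairSum α N (insert (t 1) (insert (t 2) r)) (t 0 + z) ^ (g - 1))) := by
  set R := insert (t 1) (insert (t 2) r)
  have key : ∀ k : Fin g, ∑ y ∈ Fintype.piFinset fun _ : Fin g => Finset.range N,
      (if y k ∈ r ∨ t 0 + z - y k ∈ r then 1 else 0) *
        ∏ j, pairWt α R (y j) (t 0 + z - y j) =
      hitSum α N r R (t 0 + z) * pairSum α N R (t 0 + z) ^ (g - 1) := by
    intro k
    let F : Fin g → ℕ → ℝ := fun j a =>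
      (if j = k then (if a ∈ r ∨ t 0 + z - a ∈ r then 1 else 0) else 1) *
        pairWt α R a (t 0 + z - a)
    have h1 : ∀ y : Fin g → ℕ, (if y k ∈ r ∨ t 0 + z - y k ∈ r then 1 else 0) *
        ∏ j, pairWt α R (y j) (t 0 + z - y j) = ∏ j, F j (y j) := by
      intro y
      simp only [F, Finset.prod_mul_distrib, Finset.prod_ite_eq', Finset.mem_univ, if_true]
    simp only [h1]
    rw [← Finset.prod_univ_sum (fun _ : Fin g => Finset.range N) F,
      ← Finset.mul_prod_erase _ _ (Finset.mem_univ k)]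
    congr 1
    · simp [F, hitSum]
    · rw [Finset.prod_congr rfl (g := fun _ => pairSum α N R (t 0 + z)), Finset.prod_const,
        Finset.card_erase_of_mem (Finset.mem_univ k), Finset.card_univ, Fintype.card_fin]
      intro j hj
      simp [F, pairSum, Finset.ne_of_mem_erase hj]
  have hsplit : ∀ y : Fin g → ℕ, hits g r t z y * tailWt g α r t z y =
      (if z ∈ r then 1 else 0) * tailWt g α r t z y +
        wt α R z * ∑ k, (if y k ∈ r ∨ t 0 + z - y k ∈ r then 1 else 0) *
          ∏ j, pairWt α R (y j) (t 0 + z - y j) := by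
    intro y
    rw [hits, ← Finset.sum_mul, tailWt]
    ring
  simp only [hsplit]
  rw [Finset.sum_add_distrib, ← Finset.mul_sum, sum_tailWt, ← Finset.mul_sum, Finset.sum_comm,
    Finset.sum_congr rfl fun k _ => key k, Finset.sum_const, Finset.card_univ, Fintype.card_fin,
    nsmul_eq_mul]
  split_ifs <;> ring

lemma one_le_hits {g M n : ℕ} {lam : ℝ} {s : ℕ → Fin 3 → ZMod M} {x : Fin (2 * g + 4) → ℕ}
    (hx : x ∈ Tn g M lam s n) {r : Finset ℕ} (hr : r.Nonempty) (hdisj : firstThree g x ∩ r = ∅)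
    (hsub : r ⊆ imgF x) : 1 ≤ hits g r (lead g x) (partner g x) (pairFst g x) := by
  obtain ⟨a, ha⟩ := hr
  have h := hsub ha
  rw [imgF_eq, Finset.mem_union, mem_tail_iff] at h
  have hnn : ∀ k : Fin g, (0 : ℝ) ≤
      if pairFst g x k ∈ r ∨ lead g x 0 + partner g x - pairFst g x k ∈ r then 1 else 0 :=
    fun k => by split_ifs <;> simp
  rcases h with h | rfl | ⟨k, hk⟩
  · exact absurd (hdisj ▸ Finset.mem_inter.2 ⟨h, ha⟩) (Finset.notMem_empty _)
  · rw [hits, if_pos ha]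
    linarith [Finset.sum_nonneg fun k (_ : k ∈ Finset.univ) => hnn k]
  · have h1 := Finset.single_le_sum (fun k _ => hnn k) (Finset.mem_univ k)
    rw [if_pos] at h1
    · refine h1.trans (le_add_of_nonneg_left ?_)
      split_ifs <;> simp
    · rw [pair_snd_eq_of_mem_Tn hx]
      rcases hk with rfl | rfl
      · exact Or.inl ha
      · exact Or.inr ha

open Classical in
/-- The orderings of the representations of `n` in `Rn`. -/
def trips (g M : ℕ) (lam : ℝ) (s : ℕ → Fin 3 → ZMod M) (n : ℕ) : Finset (Fin 3 → ℕ) :=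
  (slab n ⌊glam g lam n⌋₊).filter fun t => t 0 ≠ t 1 ∧ t 0 ≠ t 2 ∧ t 1 ≠ t 2 ∧
    ∃ a b c, Rtrip g M lam s n a b c ∧ ({t 0, t 1, t 2} : Finset ℕ) = {a, b, c}

lemma trips_subset_slab (g M : ℕ) (lam : ℝ) (s : ℕ → Fin 3 → ZMod M) (n : ℕ) :
    trips g M lam s n ⊆ slab n ⌊glam g lam n⌋₊ := by
  classical
  exact Finset.filter_subset _ _

lemma lead_mem_trips {g M n : ℕ} {lam : ℝ} {s : ℕ → Fin 3 → ZMod M} {CM : Set (ZMod M)}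
    {x : Fin (2 * g + 4) → ℕ} (hs : GoodS M CM s) (hx : x ∈ Tn g M lam s n) :
    lead g x ∈ trips g M lam s n := by
  classical
  rw [trips, Finset.mem_filter]
  exact ⟨lead_mem_slab hs hx, exists_Rtrip_of_mem_Tn hs hx⟩

section Triple

variable {g M n : ℕ} {lam α : ℝ} {s : ℕ → Fin 3 → ZMod M} {CM : Set (ZMod M)}
  {t : Fin 3 → ℕ} {r : Finset ℕ}

lemma exists_Rtrip_of_mem_trips (hs : GoodS M CM s) (α : ℝ) (r : Finset ℕ)
    (ht : t ∈ trips g M lam s n) :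
    ∃ a b c, Rtrip g M lam s n a b c ∧ ({t 0, t 1, t 2} : Finset ℕ) = {a, b, c} ∧
      tripWt α r t = wt α r a * wt α r b * wt α r c := by
  classical
  rw [trips, Finset.mem_filter] at ht
  obtain ⟨-, h1, h2, h3, a, b, c, h, habc⟩ := ht
  obtain ⟨h1', h2', h3'⟩ := h.pairwise_ne hs
  refine ⟨a, b, c, h, habc, ?_⟩
  have e1 : ∏ y ∈ ({t 0, t 1, t 2} : Finset ℕ), wt α r y = tripWt α r t := by
    rw [Finset.prod_insert (by simp [h1, h2]), Finset.prod_pair h3, ← mul_assoc]; rfl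
  rw [← e1, habc, Finset.prod_insert (by simp [h1', h2']), Finset.prod_pair h3', ← mul_assoc]

lemma Rtrip.rpow_le {a b c : ℕ} (hα : 0 < α) (hG : 0 < glam g lam n) (hn : 0 < n)
    (h : Rtrip g M lam s n a b c) :
    (a : ℝ) ^ (-α) ≤ (glam g lam n / 2) ^ (-α) ∧ (b : ℝ) ^ (-α) ≤ ((n : ℝ) / 4) ^ (-α) ∧
      (c : ℝ) ^ (-α) ≤ ((n : ℝ) / 4) ^ (-α) := by
  obtain ⟨-, -, -, -, ha, -, hb, -, hc, -⟩ := h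
  exact ⟨rpow_neg_anti hα (by positivity) ha, rpow_neg_anti hα (by positivity) hb,
    rpow_neg_anti hα (by positivity) hc⟩

lemma tripWt_le_of_disjoint (hs : GoodS M CM s) (hα : 0 < α) (hG : 0 < glam g lam n)
    (hn : 0 < n) (ht : t ∈ trips g M lam s n) (hr : ({t 0, t 1, t 2} : Finset ℕ) ∩ r = ∅) :
    tripWt α r t ≤
      (glam g lam n / 2) ^ (-α) * ((n : ℝ) / 4) ^ (-α) * ((n : ℝ) / 4) ^ (-α) := by
  obtain ⟨a, b, c, h, habc, hw⟩ := exists_Rtrip_of_mem_trips hs α r ht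
  obtain ⟨ha, hb, hc⟩ := h.rpow_le hα hG hn
  rw [habc] at hr
  have hnot : ∀ v ∈ ({a, b, c} : Finset ℕ), wt α r v = (v : ℝ) ^ (-α) := fun v hv =>
    if_neg fun hv' => Finset.notMem_empty v (hr ▸ Finset.mem_inter.2 ⟨hv, hv'⟩)
  rw [hw, hnot a (by simp), hnot b (by simp), hnot c (by simp)]
  gcongr

/-- A bound for the weight of a triple partly contained in `r`, as a combination of indicator
functions of conditions on two entries. -/
def partialBound (A B : ℝ) (n G : ℕ) (r : Finset ℕ) (t : Fin 3 → ℕ) (p : Fin 3 × Fin 3) : ℝ :=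
  (if t p.1 ∈ r ∧ t p.2 ∈ r then A + B else 0) +
    (if t p.1 ∈ r ∧ t p.2 ∈ Finset.range (n + 1) then B * B else 0) +
    (if t p.1 ∈ r ∧ t p.2 ∈ Finset.range (G + 1) then A * B else 0)

lemma sum_partialBound_le {A B : ℝ} (hA : 0 ≤ A) (hB : 0 ≤ B) (n G D : ℕ)
    (hr : r.card ≤ D) (T : Finset (Fin 3 → ℕ)) (hT : T ⊆ plane n) :
    ∑ t ∈ T, ∑ p ∈ (Finset.univ : Finset (Fin 3)).offDiag, partialBound A B n G r t p ≤
      6 * (D * D * (A + B) + D * (n + 1) * (B * B) + D * (G + 1) * (A * B)) := by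
  have hcount : ∀ (i j : Fin 3) (X : Finset ℕ) (v : ℝ), 0 ≤ v → i ≠ j →
      (∑ t ∈ T, if t i ∈ r ∧ t j ∈ X then v else 0) ≤ D * X.card * v := by
    intro i j X v hv hij
    rw [← Finset.sum_filter, Finset.sum_const, nsmul_eq_mul]
    have h1 : (T.filter fun t => t i ∈ r ∧ t j ∈ X).card ≤ D * X.card :=
      (Finset.card_le_card (Finset.filter_subset_filter _ hT)).trans
        ((card_plane_filter_le n hij r X).trans (Nat.mul_le_mul_right _ hr))
    have h2 : ((T.filter fun t => t i ∈ r ∧ t j ∈ X).card : ℝ) ≤ D * X.card := by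
      exact_mod_cast h1
    gcongr
  have hcard : (Finset.univ : Finset (Fin 3)).offDiag.card = 6 := rfl
  rw [Finset.sum_comm]
  refine (Finset.sum_le_card_nsmul _ _
    (D * D * (A + B) + D * (n + 1) * (B * B) + D * (G + 1) * (A * B)) fun p hp => ?_).trans
    (by rw [hcard, nsmul_eq_mul, Nat.cast_ofNat])
  have hp' : p.1 ≠ p.2 := (Finset.mem_offDiag.1 hp).2.2
  simp only [partialBound]
  rw [Finset.sum_add_distrib, Finset.sum_add_distrib]
  refine add_le_add (add_le_add ?_ ?_) ?_
  · refine (hcount _ _ _ _ (by positivity) hp').trans ?_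
    have : (r.card : ℝ) ≤ D := by exact_mod_cast hr
    gcongr
  · simpa using hcount p.1 p.2 (Finset.range (n + 1)) (B * B) (by positivity) hp'
  · simpa using hcount p.1 p.2 (Finset.range (G + 1)) (A * B) (by positivity) hp'

lemma tripWt_le_of_partial (hs : GoodS M CM s) (hα : 0 < α) (hG : 0 < glam g lam n)
    (hn : 0 < n) (ht : t ∈ trips g M lam s n)
    (hr1 : 1 ≤ (({t 0, t 1, t 2} : Finset ℕ) ∩ r).card)
    (hr2 : (({t 0, t 1, t 2} : Finset ℕ) ∩ r).card ≤ 2) :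
    tripWt α r t ≤ ∑ p ∈ (Finset.univ : Finset (Fin 3)).offDiag,
      partialBound ((glam g lam n / 2) ^ (-α)) (((n : ℝ) / 4) ^ (-α)) n ⌊glam g lam n⌋₊ r t p := by
  obtain ⟨a, b, c, h, habc, hw⟩ := exists_Rtrip_of_mem_trips hs α r ht
  obtain ⟨ha, hb, hc⟩ := h.rpow_le hα hG hn
  obtain ⟨h1, h2, h3⟩ := h.pairwise_ne hs
  have haG : a < ⌊glam g lam n⌋₊ + 1 := Nat.lt_succ_of_le (Nat.le_floor h.2.2.2.2.2.1)
  have hbn : b < n + 1 := Nat.lt_succ_of_le h.2.2.2.2.2.2.2.1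
  have hA : 0 ≤ (glam g lam n / 2) ^ (-α) := by positivity
  have hB : 0 ≤ ((n : ℝ) / 4) ^ (-α) := by positivity
  generalize (glam g lam n / 2) ^ (-α) = A at *
  generalize ((n : ℝ) / 4) ^ (-α) = B at *
  rw [habc] at hr1 hr2
  have hidx : ∀ v ∈ ({a, b, c} : Finset ℕ), ∃ i, t i = v := by
    intro v hv
    rw [← habc] at hv
    simp only [Finset.mem_insert, Finset.mem_singleton] at hv
    rcases hv with rfl | rfl | rfl <;> exact ⟨_, rfl⟩
  obtain ⟨i, rfl⟩ := hidx a (by simp)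
  obtain ⟨j, rfl⟩ := hidx b (by simp)
  obtain ⟨k, rfl⟩ := hidx c (by simp)
  have hij : i ≠ j := fun h => h1 (h ▸ rfl)
  have hik : i ≠ k := fun h => h2 (h ▸ rfl)
  have hjk : j ≠ k := fun h => h3 (h ▸ rfl)
  have nn : ∀ p, 0 ≤ partialBound A B n ⌊glam g lam n⌋₊ r t p := fun p =>
    add_nonneg (add_nonneg (by split_ifs <;> positivity) (by split_ifs <;> positivity))
      (by split_ifs <;> positivity)
  have single : ∀ u v : Fin 3, u ≠ v → ∀ w, w ≤ partialBound A B n ⌊glam g lam n⌋₊ r t (u, v) →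
      w ≤ ∑ p ∈ (Finset.univ : Finset (Fin 3)).offDiag,
        partialBound A B n ⌊glam g lam n⌋₊ r t p := fun u v huv w hw =>
    hw.trans (Finset.single_le_sum (f := fun p => partialBound A B n ⌊glam g lam n⌋₊ r t p)
      (fun p _ => nn p) (Finset.mem_offDiag.2 ⟨Finset.mem_univ _, Finset.mem_univ _, huv⟩))
  have two : ∀ u v : Fin 3, t u ∈ r → t v ∈ r →
      A + B ≤ partialBound A B n ⌊glam g lam n⌋₊ r t (u, v) := by
    intro u v hu hv
    rw [partialBound, if_pos ⟨hu, hv⟩, add_assoc]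
    exact le_add_of_nonneg_right
      (add_nonneg (by split_ifs <;> positivity) (by split_ifs <;> positivity))
  have bb : ∀ u v : Fin 3, t u ∈ r → t v < n + 1 →
      B * B ≤ partialBound A B n ⌊glam g lam n⌋₊ r t (u, v) := by
    intro u v hu hv
    rw [partialBound, if_pos (c := _ ∧ t v ∈ Finset.range (n + 1)) ⟨hu, Finset.mem_range.2 hv⟩]
    have e1 : (0 : ℝ) ≤ if t u ∈ r ∧ t v ∈ r then A + B else 0 := by split_ifs <;> positivity
    have e2 : (0 : ℝ) ≤ if t u ∈ r ∧ t v ∈ Finset.range (⌊glam g lam n⌋₊ + 1) then A * B else 0 := by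
      split_ifs <;> positivity
    dsimp only
    linarith
  have ab : ∀ u v : Fin 3, t u ∈ r → t v < ⌊glam g lam n⌋₊ + 1 →
      A * B ≤ partialBound A B n ⌊glam g lam n⌋₊ r t (u, v) := by
    intro u v hu hv
    rw [partialBound, if_pos (c := _ ∧ t v ∈ Finset.range (⌊glam g lam n⌋₊ + 1))
      ⟨hu, Finset.mem_range.2 hv⟩]
    exact le_add_of_nonneg_left
      (add_nonneg (by split_ifs <;> positivity) (by split_ifs <;> positivity))
  have inr : ∀ {v}, t v ∈ r → wt α r (t v) = 1 := fun h => if_pos h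
  have notr : ∀ {v}, t v ∉ r → wt α r (t v) = (t v : ℝ) ^ (-α) := fun h => if_neg h
  rw [hw]
  by_cases mi : t i ∈ r <;> by_cases mj : t j ∈ r <;> by_cases mk : t k ∈ r
  · exfalso
    have : ({t i, t j, t k} : Finset ℕ) ∩ r = {t i, t j, t k} :=
      Finset.inter_eq_left.2 (by simp [Finset.insert_subset_iff, mi, mj, mk])
    rw [this, Finset.card_eq_three.2 ⟨_, _, _, h1, h2, h3, rfl⟩] at hr2
    omega
  · refine single i j hij _ (le_trans ?_ (two i j mi mj))
    rw [inr mi, inr mj, notr mk]; linarith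
  · refine single i k hik _ (le_trans ?_ (two i k mi mk))
    rw [inr mi, inr mk, notr mj]; linarith
  · refine single i j hij _ (le_trans ?_ (bb i j mi hbn))
    rw [inr mi, notr mj, notr mk, one_mul]; gcongr
  · refine single j k hjk _ (le_trans ?_ (two j k mj mk))
    rw [inr mj, inr mk, notr mi]; linarith
  · refine single j i hij.symm _ (le_trans ?_ (ab j i mj haG))
    rw [inr mj, notr mi, notr mk, mul_one]; gcongr
  · refine single k i hik.symm _ (le_trans ?_ (ab k i mk haG))
    rw [inr mk, notr mi, notr mj, mul_one]; gcongr
  · exfalso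
    have : ({t i, t j, t k} : Finset ℕ) ∩ r = ∅ := by
      ext v
      simp only [Finset.mem_inter, Finset.mem_insert, Finset.mem_singleton, Finset.notMem_empty,
        iff_false, not_and]
      rintro (rfl | rfl | rfl) <;> assumption
    rw [this, Finset.card_empty] at hr1
    omega

end Triple

lemma alph_gt_half (g : ℕ) : 1 / 2 < alph g := by
  unfold alph
  rw [div_lt_div_iff₀ (by norm_num) (by positivity)]
  linarith

lemma alph_lt_one {g : ℕ} (hg : 1 ≤ g) : alph g < 1 := by
  unfold alph
  have : (1 : ℝ) ≤ g := by exact_mod_cast hg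
  rw [div_lt_one (by positivity)]
  linarith

lemma mul_two_alph_sub_one (g : ℕ) : (g : ℝ) * (2 * alph g - 1) = 1 - alph g := by
  unfold alph
  field_simp
  ring

section Numerics

variable {u G α γ δ Λ : ℝ}

lemma half_rpow_neg_le (hα1 : α < 1) (hG : 0 < G) :
    (G / 2) ^ (-α) ≤ 2 * G ^ (-α) := by
  rw [Real.div_rpow hG.le (by norm_num), div_eq_mul_inv, ← Real.rpow_neg (by norm_num), neg_neg,
    mul_comm]
  gcongr
  exact Real.rpow_le_self_of_one_le (by norm_num) hα1.le

lemma quarter_rpow_neg_le (hα1 : α < 1) (hu : 0 < u) :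
    (u / 4) ^ (-α) ≤ 4 * u ^ (-α) := by
  rw [Real.div_rpow hu.le (by norm_num), div_eq_mul_inv, ← Real.rpow_neg (by norm_num), neg_neg,
    mul_comm]
  gcongr
  exact Real.rpow_le_self_of_one_le (by norm_num) hα1.le

lemma rpow_neg_le_of_rpow_le (hα : 0 < α) (hu : 0 < u) {e : ℝ} (hG : u ^ e ≤ G) :
    G ^ (-α) ≤ u ^ (-(e * α)) := by
  refine (rpow_neg_anti hα (by positivity) hG).trans (le_of_eq ?_)
  rw [← Real.rpow_mul hu.le]
  ring_nf

lemma add_rpow_neg_le (hα0 : 1 / 2 < α) (hα1 : α < 1) (hγ : 2 ≤ γ) (hu : 1 ≤ u)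
    (hG : u ^ (1 / γ) ≤ G) (hδ : δ = (2 * α - 1) / (8 * γ)) :
    (G / 2) ^ (-α) + (u / 4) ^ (-α) ≤ 6 * u ^ (-δ) := by
  have hu0 : 0 < u := by linarith
  have hG0 : 0 < G := (Real.rpow_pos_of_pos hu0 _).trans_le hG
  have h1 : G ^ (-α) ≤ u ^ (-δ) := by
    refine (rpow_neg_le_of_rpow_le (by linarith) hu0 hG).trans
      (Real.rpow_le_rpow_of_exponent_le hu (neg_le_neg ?_))
    rw [hδ, one_div_mul_eq_div, div_le_div_iff₀ (by positivity) (by positivity)]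
    nlinarith
  have h2 : u ^ (-α) ≤ u ^ (-δ) := by
    refine Real.rpow_le_rpow_of_exponent_le hu (neg_le_neg ?_)
    rw [hδ, div_le_iff₀ (by positivity)]
    nlinarith
  linarith [half_rpow_neg_le hα1 hG0, quarter_rpow_neg_le hα1 hu0]

lemma delta_le (hα0 : 1 / 2 < α) (hγ : 2 ≤ γ) (hδ : δ = (2 * α - 1) / (8 * γ)) :
    δ ≤ 2 * α - 1 := by
  rw [hδ]
  exact div_le_self (by linarith) (by linarith)

lemma mul_rpow_neg_sq_le (hα0 : 1 / 2 < α) (hα1 : α < 1) (hγ : 2 ≤ γ) (hu : 1 ≤ u)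
    (hδ : δ = (2 * α - 1) / (8 * γ)) :
    (u + 1) * ((u / 4) ^ (-α) * (u / 4) ^ (-α)) ≤ 32 * u ^ (-δ) := by
  have hu0 : 0 < u := by linarith
  have hB := quarter_rpow_neg_le hα1 hu0
  calc (u + 1) * ((u / 4) ^ (-α) * (u / 4) ^ (-α))
      ≤ (2 * u) * ((4 * u ^ (-α)) * (4 * u ^ (-α))) := by gcongr; linarith
    _ = 32 * (u ^ (1 : ℝ) * u ^ (-α) * u ^ (-α)) := by rw [Real.rpow_one]; ring
    _ = 32 * u ^ (1 + -α + -α) := by rw [Real.rpow_add hu0, Real.rpow_add hu0]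
    _ ≤ 32 * u ^ (-δ) := by
        have := delta_le hα0 hγ hδ
        gcongr 32 * ?_
        exact Real.rpow_le_rpow_of_exponent_le hu (by linarith)

lemma delta_pos (hα0 : 1 / 2 < α) (hγ : 2 ≤ γ) (hδ : δ = (2 * α - 1) / (8 * γ)) : 0 < δ := by
  rw [hδ]
  exact div_pos (by linarith) (by linarith)

lemma mul_rpow_neg_mul_rpow_neg_le (hα0 : 1 / 2 < α) (hα1 : α < 1) (hγ : 2 ≤ γ)
    (hγα : γ * (2 * α - 1) = 1 - α) (hu : 1 ≤ u) (hΛ : 0 ≤ Λ) (hG : u ^ (1 / γ) ≤ G)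
    (hGα : G ^ (1 - α) = Λ * u ^ (2 * α - 1) * Real.log u) (hδ : δ = (2 * α - 1) / (8 * γ)) :
    (G + 1) * ((G / 2) ^ (-α) * (u / 4) ^ (-α)) ≤ 16 * (Λ / δ) * u ^ (-δ) := by
  have hu0 : 0 < u := by linarith
  have hδ0 := delta_pos hα0 hγ hδ
  have hG1 : 1 ≤ G := (Real.one_le_rpow hu (by positivity)).trans hG
  have hG0 : 0 < G := by linarith
  have hA := half_rpow_neg_le hα1 hG0
  have hB := quarter_rpow_neg_le hα1 hu0
  calc (G + 1) * ((G / 2) ^ (-α) * (u / 4) ^ (-α))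
      ≤ (2 * G) * ((2 * G ^ (-α)) * (4 * u ^ (-α))) := by gcongr; linarith
    _ = 16 * (G ^ (1 : ℝ) * G ^ (-α)) * u ^ (-α) := by rw [Real.rpow_one]; ring
    _ = 16 * (Λ * u ^ (2 * α - 1) * Real.log u) * u ^ (-α) := by
        rw [← Real.rpow_add hG0, ← hGα]; rfl
    _ ≤ 16 * (Λ * u ^ (2 * α - 1) * (u ^ δ / δ)) * u ^ (-α) := by
        gcongr
        exact Real.log_le_rpow_div hu0.le hδ0
    _ = 16 * (Λ / δ) * (u ^ (2 * α - 1) * u ^ δ * u ^ (-α)) := by ring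
    _ = 16 * (Λ / δ) * u ^ (2 * α - 1 + δ + -α) := by rw [Real.rpow_add hu0, Real.rpow_add hu0]
    _ ≤ 16 * (Λ / δ) * u ^ (-δ) := by
        gcongr 16 * (Λ / δ) * ?_
        refine Real.rpow_le_rpow_of_exponent_le hu ?_
        have : 2 * δ ≤ 2 * (2 * α - 1) := by linarith [delta_le hα0 hγ hδ]
        nlinarith

/-- The count of triples on a plane near a fixed line, weighted by the bound for the weight of
a triple. -/
lemma triple_weight_mul_count_le (hα0 : 1 / 2 < α) (hα1 : α < 1) (hγ : 2 ≤ γ)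
    (hu : 1 ≤ u) (hΛ : 0 ≤ Λ) (hG : u ^ (1 / γ) ≤ G)
    (hGα : G ^ (1 - α) = Λ * u ^ (2 * α - 1) * Real.log u) (hδ : δ = (2 * α - 1) / (8 * γ))
    {V : ℝ} (hV1 : u ^ (1 / (2 * γ)) ≤ V) (hV2 : V ≤ 2 * u ^ (1 / (2 * γ))) :
    (G / 2) ^ (-α) * (u / 4) ^ (-α) * (u / 4) ^ (-α) *
      (V ^ (-((2 * α - 1) / 2)) * (3 * ((G + 1) * (u + 1))) + (2 * V + 1) * (u + 1)) ≤
      (384 * (Λ / δ) + 320) * u ^ (-δ) := by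
  have hu0 : 0 < u := by linarith
  have hδ0 := delta_pos hα0 hγ hδ
  have hG1 : 1 ≤ G := (Real.one_le_rpow hu (by positivity)).trans hG
  have hG0 : 0 < G := by linarith
  have hV0 : 1 ≤ u ^ (1 / (2 * γ)) := Real.one_le_rpow hu (by positivity)
  have hVpos : 0 < V := by linarith
  have hA := half_rpow_neg_le hα1 hG0
  have hB := quarter_rpow_neg_le hα1 hu0
  have hVκ : V ^ (-((2 * α - 1) / 2)) ≤ u ^ (-(2 * δ)) := by
    refine (rpow_neg_le_of_rpow_le (by linarith) hu0 hV1).trans (le_of_eq ?_)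
    congr 2
    rw [hδ]
    field_simp
    ring
  have hGu : G ^ (-α) ≤ u ^ (-(1 / (2 * γ))) := by
    refine (rpow_neg_le_of_rpow_le (by linarith) hu0 hG).trans
      (Real.rpow_le_rpow_of_exponent_le hu (neg_le_neg ?_))
    rw [one_div_mul_eq_div, div_le_div_iff₀ (by positivity) (by positivity)]
    nlinarith
  have first : 384 * (G * G ^ (-α)) * (u * u ^ (-α) * u ^ (-α)) * u ^ (-(2 * δ)) ≤
      384 * (Λ / δ) * u ^ (-δ) := by
    have e1 : G * G ^ (-α) = Λ * u ^ (2 * α - 1) * Real.log u := by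
      rw [← hGα, sub_eq_add_neg, Real.rpow_add hG0, Real.rpow_one]
    calc 384 * (G * G ^ (-α)) * (u * u ^ (-α) * u ^ (-α)) * u ^ (-(2 * δ))
        ≤ 384 * (Λ * u ^ (2 * α - 1) * (u ^ δ / δ)) * (u * u ^ (-α) * u ^ (-α)) *
            u ^ (-(2 * δ)) := by
          rw [e1]
          gcongr
          exact Real.log_le_rpow_div hu0.le hδ0
      _ = 384 * (Λ / δ) * (u ^ (2 * α - 1) * u ^ δ * u ^ (1 : ℝ) * u ^ (-α) * u ^ (-α) *
            u ^ (-(2 * δ))) := by rw [Real.rpow_one]; ring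
      _ = 384 * (Λ / δ) * u ^ (-δ) := by
          simp only [← Real.rpow_add hu0]
          ring_nf
  have second : 320 * (u ^ (-(1 / (2 * γ))) * u ^ (1 / (2 * γ))) * (u * u ^ (-α) * u ^ (-α)) ≤
      320 * u ^ (-δ) := by
    calc 320 * (u ^ (-(1 / (2 * γ))) * u ^ (1 / (2 * γ))) * (u * u ^ (-α) * u ^ (-α))
        = 320 * (u ^ (-(1 / (2 * γ))) * u ^ (1 / (2 * γ)) * u ^ (1 : ℝ) * u ^ (-α) *
            u ^ (-α)) := by rw [Real.rpow_one]; ring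
      _ = 320 * u ^ (1 - 2 * α) := by
          simp only [← Real.rpow_add hu0]
          ring_nf
      _ ≤ 320 * u ^ (-δ) := by
          have := delta_le hα0 hγ hδ
          gcongr 320 * ?_
          exact Real.rpow_le_rpow_of_exponent_le hu (by linarith)
  calc _ ≤ (2 * G ^ (-α)) * (4 * u ^ (-α)) * (4 * u ^ (-α)) *
        (u ^ (-(2 * δ)) * (3 * ((2 * G) * (2 * u))) +
          (5 * u ^ (1 / (2 * γ))) * (2 * u)) := by
        gcongr <;> linarith
    _ = 384 * (G * G ^ (-α)) * (u * u ^ (-α) * u ^ (-α)) * u ^ (-(2 * δ)) +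
        320 * (G ^ (-α) * u ^ (1 / (2 * γ))) * (u * u ^ (-α) * u ^ (-α)) := by ring
    _ ≤ 384 * (G * G ^ (-α)) * (u * u ^ (-α) * u ^ (-α)) * u ^ (-(2 * δ)) +
        320 * (u ^ (-(1 / (2 * γ))) * u ^ (1 / (2 * γ))) * (u * u ^ (-α) * u ^ (-α)) := by gcongr
    _ ≤ _ := by linarith

end Numerics

lemma rpow_le_glam {g n : ℕ} {lam : ℝ} (hg : 1 ≤ g) (hlam : 1 < lam) (hn : 3 ≤ n) :
    (n : ℝ) ^ (1 / (g : ℝ)) ≤ glam g lam n := by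
  have hα := sub_pos.2 (alph_lt_one hg)
  have hn' : (3 : ℝ) ≤ n := by exact_mod_cast hn
  have hlog : 1 ≤ Real.log n := by
    rw [Real.le_log_iff_exp_le (by linarith)]
    linarith [Real.exp_one_lt_d9]
  have h1 : 1 ≤ lam ^ ((2 * (g : ℝ) + 5) / (1 - alph g)) :=
    Real.one_le_rpow hlam.le (by positivity)
  have h2 : 1 ≤ Real.log n ^ ((1 : ℝ) / (1 - alph g)) := Real.one_le_rpow hlog (by positivity)
  unfold glam
  have h3 : 0 ≤ (n : ℝ) ^ (1 / (g : ℝ)) := by positivity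
  nlinarith [mul_nonneg h3 (sub_nonneg.2 h1), mul_nonneg (mul_nonneg h3 (zero_le_one.trans h1))
    (sub_nonneg.2 h2)]

lemma glam_rpow {g n : ℕ} {lam : ℝ} (hg : 1 ≤ g) (hlam : 1 < lam) (hn : 1 ≤ n) :
    glam g lam n ^ (1 - alph g) =
      lam ^ (2 * (g : ℝ) + 5) * (n : ℝ) ^ (2 * alph g - 1) * Real.log n := by
  have hα := sub_pos.2 (alph_lt_one hg)
  have hlog : 0 ≤ Real.log n := Real.log_natCast_nonneg n
  have hg' : (g : ℝ) ≠ 0 := by positivity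
  have hlam0 : 0 ≤ lam := by linarith
  unfold glam
  rw [Real.mul_rpow (by positivity) (by positivity), Real.mul_rpow (by positivity) (by positivity),
    ← Real.rpow_mul hlam0, ← Real.rpow_mul (by positivity), ← Real.rpow_mul hlog,
    div_mul_cancel₀ _ hα.ne', div_mul_cancel₀ _ hα.ne', Real.rpow_one]
  congr 3
  rw [← mul_two_alph_sub_one]
  field_simp

lemma pos_of_mem_trips {g M n : ℕ} {lam : ℝ} {s : ℕ → Fin 3 → ZMod M} {CM : Set (ZMod M)}
    {t : Fin 3 → ℕ} (hs : GoodS M CM s) (ht : t ∈ trips g M lam s n) :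
    0 < t 0 ∧ 0 < t 1 ∧ 0 < t 2 := by
  obtain ⟨a, b, c, ⟨ha, hb, hc, -⟩, habc, -⟩ := exists_Rtrip_of_mem_trips hs 1 ∅ ht
  have : ∀ v ∈ ({t 0, t 1, t 2} : Finset ℕ), 0 < v := by
    rw [habc]
    simp [ha, hb, hc]
  exact ⟨this _ (by simp), this _ (by simp), this _ (by simp)⟩

lemma zero_notMem_insert_insert {g M n : ℕ} {lam : ℝ} {s : ℕ → Fin 3 → ZMod M}
    {CM : Set (ZMod M)} {t : Fin 3 → ℕ} (hs : GoodS M CM s) (ht : t ∈ trips g M lam s n)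
    {r : Finset ℕ} (hr : 0 ∉ r) : 0 ∉ insert (t 1) (insert (t 2) r) := by
  obtain ⟨-, h1, h2⟩ := pos_of_mem_trips hs ht
  simp [h1.ne, h2.ne, hr]

lemma card_insert_insert_le (r : Finset ℕ) (a b : ℕ) :
    (insert a (insert b r)).card ≤ r.card + 2 :=
  (Finset.card_insert_le _ _).trans (Nat.succ_le_succ (Finset.card_insert_le _ _))

lemma exists_partial_sum_le (g M : ℕ) (hg : 2 ≤ g) {CM : Set (ZMod M)}
    {s : ℕ → Fin 3 → ZMod M} (hs : GoodS M CM s) {lam : ℝ} (hlam : 1 < lam) {δ : ℝ}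
    (hδ : δ = (2 * alph g - 1) / (8 * g)) :
    ∃ C : ℝ, 0 < C ∧ ∀ n : ℕ, 3 ≤ n → ∀ r : Finset ℕ, 0 ∉ r → r.card ≤ 2 * g + 3 →
      ∑' x : ↥{x ∈ Tn g M lam s n | (1 ≤ (firstThree g x ∩ r).card ∧
          (firstThree g x ∩ r).card ≤ 2) ∧ r ⊆ imgF x},
        ∏ y ∈ imgF x.1 \ r, lam⁻¹ * (y : ℝ) ^ (-alph g) ≤ C * (n : ℝ) ^ (-δ) := by
  have hg1 : 1 ≤ g := by omega
  have hα0 := alph_gt_half g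
  have hα1 := alph_lt_one hg1
  have hgα := mul_two_alph_sub_one g
  have hγ : (2 : ℝ) ≤ g := by exact_mod_cast hg
  have hδ0 := delta_pos hα0 hγ hδ
  set α := alph g
  have hα : 0 < α := by linarith
  obtain ⟨C₁, hC₁, htail⟩ := exists_tail_sum_le hα0 hα1 hg1 hgα (2 * g + 5)
  set D : ℕ := 2 * g + 3
  have hD : (0 : ℝ) < D := by positivity
  set Λ := lam ^ (2 * (g : ℝ) + 5)
  have hΛ : 0 ≤ Λ := by positivity
  refine ⟨C₁ * (6 * (D * D * 6 + D * 32 + D * (16 * (Λ / δ)))), by positivity,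
    fun n hn r hr0 hrD => ?_⟩
  have hu : (1 : ℝ) ≤ n := by exact_mod_cast (by omega : 1 ≤ n)
  have hGlo : (n : ℝ) ^ (1 / (g : ℝ)) ≤ glam g lam n := rpow_le_glam hg1 hlam hn
  have hGα := glam_rpow hg1 hlam (by omega : 1 ≤ n)
  have hG : 0 < glam g lam n := (Real.rpow_pos_of_pos (by linarith) _).trans_le hGlo
  have hfloor : (⌊glam g lam n⌋₊ : ℝ) ≤ glam g lam n := Nat.floor_le hG.le
  set T := (trips g M lam s n).filter fun t => 1 ≤ (({t 0, t 1, t 2} : Finset ℕ) ∩ r).card ∧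
    (({t 0, t 1, t 2} : Finset ℕ) ∩ r).card ≤ 2
  refine (tsum_Tn_le (f := fun x => ∏ y ∈ imgF x \ r, lam⁻¹ * (y : ℝ) ^ (-α)) (T := T)
    (Φ := fun t z y => tripWt α r t * tailWt g α r t z y)
    (fun x => Finset.prod_nonneg fun _ _ => by positivity)
    (fun t z y => mul_nonneg (tripWt_nonneg _ _ _) (tailWt_nonneg _ _ _ _ _ _))
    fun x hx hP => ⟨Finset.mem_filter.2 ⟨lead_mem_trips hs hx, hP.1⟩,
      prod_le_tripWt_mul_tailWt hα hg1 hlam hs hx r⟩).trans ?_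
  simp only [← Finset.mul_sum, sum_tailWt]
  calc _ ≤ ∑ t ∈ T, (∑ p ∈ (Finset.univ : Finset (Fin 3)).offDiag,
          partialBound ((glam g lam n / 2) ^ (-α)) (((n : ℝ) / 4) ^ (-α)) n ⌊glam g lam n⌋₊
            r t p) * C₁ := by
        refine Finset.sum_le_sum fun t ht => ?_
        obtain ⟨ht1, ht2⟩ := Finset.mem_filter.1 ht
        have h1 := tripWt_le_of_partial hs hα hG (by omega) ht1 ht2.1 ht2.2
        refine mul_le_mul h1 (htail _ (zero_notMem_insert_insert hs ht1 hr0)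
          ((card_insert_insert_le _ _ _).trans (by omega)) _ _ (pos_of_mem_trips hs ht1).1)
          (Finset.sum_nonneg fun z _ => mul_nonneg (wt_nonneg _ _ _)
            (pow_nonneg (pairSum_nonneg _ _ _ _) _)) ((tripWt_nonneg _ _ _).trans h1)
    _ ≤ C₁ * (6 * (D * D * ((glam g lam n / 2) ^ (-α) + ((n : ℝ) / 4) ^ (-α)) +
          D * (n + 1) * (((n : ℝ) / 4) ^ (-α) * ((n : ℝ) / 4) ^ (-α)) +
          D * (⌊glam g lam n⌋₊ + 1) *
            ((glam g lam n / 2) ^ (-α) * ((n : ℝ) / 4) ^ (-α)))) := by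
        rw [← Finset.sum_mul, mul_comm]
        gcongr
        exact sum_partialBound_le (by positivity) (by positivity) _ _ _ hrD _
          ((Finset.filter_subset _ _).trans ((trips_subset_slab _ _ _ _ _).trans
            (Finset.filter_subset _ _)))
    _ ≤ C₁ * (6 * (D * D * (6 * (n : ℝ) ^ (-δ)) + D * (32 * (n : ℝ) ^ (-δ)) +
          D * (16 * (Λ / δ) * (n : ℝ) ^ (-δ)))) := by
        rw [mul_assoc (D : ℝ) (n + 1 : ℝ), mul_assoc (D : ℝ) (_ + 1 : ℝ)]
        have h3 : (⌊glam g lam n⌋₊ + 1) * ((glam g lam n / 2) ^ (-α) * ((n : ℝ) / 4) ^ (-α)) ≤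
            16 * (Λ / δ) * (n : ℝ) ^ (-δ) := le_trans (by gcongr)
          (mul_rpow_neg_mul_rpow_neg_le hα0 hα1 hγ hgα hu hΛ hGlo hGα hδ)
        gcongr C₁ * (6 * (D * D * ?_ + D * ?_ + D * ?_))
        · exact add_rpow_neg_le hα0 hα1 hγ hu hGlo hδ
        · exact mul_rpow_neg_sq_le hα0 hα1 hγ hu hδ
    _ = _ := by ring

lemma exists_disjoint_sum_le (g M : ℕ) (hg : 2 ≤ g) {CM : Set (ZMod M)}
    {s : ℕ → Fin 3 → ZMod M} (hs : GoodS M CM s) {lam : ℝ} (hlam : 1 < lam) {δ : ℝ}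
    (hδ : δ = (2 * alph g - 1) / (8 * g)) :
    ∃ C : ℝ, 0 < C ∧ ∀ n : ℕ, 3 ≤ n → ∀ r : Finset ℕ, 0 ∉ r → 1 ≤ r.card →
      r.card ≤ 2 * g + 3 →
      ∑' x : ↥{x ∈ Tn g M lam s n | firstThree g x ∩ r = ∅ ∧ r ⊆ imgF x},
        ∏ y ∈ imgF x.1 \ r, lam⁻¹ * (y : ℝ) ^ (-alph g) ≤ C * (n : ℝ) ^ (-δ) := by
  have hg1 : 1 ≤ g := by omega
  have hα0 := alph_gt_half g
  have hα1 := alph_lt_one hg1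
  have hγ : (2 : ℝ) ≤ g := by exact_mod_cast hg
  have hδ0 := delta_pos hα0 hγ hδ
  set α := alph g
  have hα : 0 < α := by linarith
  set D : ℕ := 2 * g + 5
  obtain ⟨C₁, hC₁, htail⟩ := exists_hit_tail_sum_le hα0 hα1 rfl hg1 D
  set κ := (2 * α - 1) / 2 with hκ
  have hκ0 : 0 < κ := by rw [hκ]; linarith
  set Λ := lam ^ (2 * (g : ℝ) + 5)
  have hΛ : 0 ≤ Λ := by positivity
  have hD : (0 : ℝ) < D := by positivity
  refine ⟨C₁ * (D * (2 + D * (3 + 2 * D))) * (384 * (Λ / δ) + 320), by positivity,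
    fun n hn r hr0 hr1 hrD => ?_⟩
  have hu : (1 : ℝ) ≤ n := by exact_mod_cast (by omega : 1 ≤ n)
  have hGlo : (n : ℝ) ^ (1 / (g : ℝ)) ≤ glam g lam n := rpow_le_glam hg1 hlam hn
  have hGα := glam_rpow hg1 hlam (by omega : 1 ≤ n)
  have hG : 0 < glam g lam n := (Real.rpow_pos_of_pos (by linarith) _).trans_le hGlo
  have hfloor : (⌊glam g lam n⌋₊ : ℝ) ≤ glam g lam n := Nat.floor_le hG.le
  have hV0 : 1 ≤ (n : ℝ) ^ (1 / (2 * (g : ℝ))) := Real.one_le_rpow hu (by positivity)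
  set V := ⌈(n : ℝ) ^ (1 / (2 * (g : ℝ)))⌉₊
  have hV1 : (n : ℝ) ^ (1 / (2 * (g : ℝ))) ≤ V := Nat.le_ceil _
  have hV2 : (V : ℝ) ≤ 2 * (n : ℝ) ^ (1 / (2 * (g : ℝ))) := by
    linarith [Nat.ceil_lt_add_one (zero_le_one.trans hV0)]
  set K := (glam g lam n / 2) ^ (-α) * ((n : ℝ) / 4) ^ (-α) * ((n : ℝ) / 4) ^ (-α)
  have hK : 0 ≤ K := by positivity
  set Q := (V : ℝ) ^ (-κ) * (3 * ((⌊glam g lam n⌋₊ + 1) * (n + 1))) + (2 * V + 1) * ((n : ℝ) + 1)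
  refine (tsum_Tn_le (f := fun x => ∏ y ∈ imgF x \ r, lam⁻¹ * (y : ℝ) ^ (-α))
    (T := trips g M lam s n)
    (Φ := fun t z y => K * (hits g r t z y * tailWt g α r t z y))
    (fun x => Finset.prod_nonneg fun _ _ => by positivity)
    (fun t z y => mul_nonneg hK (mul_nonneg (hits_nonneg _ _ _ _ _) (tailWt_nonneg _ _ _ _ _ _)))
    fun x hx hP => ⟨lead_mem_trips hs hx, ?_⟩).trans ?_
  · refine (prod_le_tripWt_mul_tailWt hα hg1 hlam hs hx r).trans
      (mul_le_mul (tripWt_le_of_disjoint hs hα hG (by omega) (lead_mem_trips hs hx) hP.1)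
        (le_mul_of_one_le_left (tailWt_nonneg _ _ _ _ _ _)
          (one_le_hits hx (Finset.card_pos.1 hr1) hP.1 hP.2)) (tailWt_nonneg _ _ _ _ _ _) hK)
  simp only [← Finset.mul_sum, sum_hits_mul_tailWt]
  calc _ ≤ K * ∑ t ∈ trips g M lam s n, C₁ * ∑ ρ ∈ r, (decay κ (t 0) + decay κ ((t 0 : ℤ) - ρ) +
          ∑ σ ∈ insert (t 1) (insert (t 2) r), (decay κ ((σ : ℤ) + ρ - t 0) +
            near κ (insert (t 1) (insert (t 2) r)) ((t 0 : ℤ) + ρ - σ) +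
            near κ (insert (t 1) (insert (t 2) r)) ((t 0 : ℤ) + σ - ρ))) := by
        gcongr with t ht
        exact htail _ _ ((Finset.subset_insert _ _).trans (Finset.subset_insert _ _))
          (zero_notMem_insert_insert hs ht hr0) ((card_insert_insert_le _ _ _).trans (by omega))
          _ _ (pos_of_mem_trips hs ht).1
    _ ≤ K * (C₁ * (D * (2 + D * (3 + 2 * D)) * Q)) := by
        rw [← Finset.mul_sum]
        gcongr
        refine sum_hit_bound_le D (fun c₀ c₁ c₂ c hc => ?_) (by omega)
        exact (Finset.sum_le_sum_of_subset_of_nonneg (trips_subset_slab _ _ _ _ _)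
          fun _ _ _ => decay_nonneg _ _).trans
          (sum_decay_slab_le hκ0 n _ V (Nat.one_le_ceil_iff.2 (by linarith)) c hc)
    _ = C₁ * (D * (2 + D * (3 + 2 * D))) * (K * Q) := by ring
    _ ≤ C₁ * (D * (2 + D * (3 + 2 * D))) * ((384 * (Λ / δ) + 320) * (n : ℝ) ^ (-δ)) := by
        gcongr C₁ * (D * (2 + D * (3 + 2 * D))) * ?_
        refine le_trans ?_ (triple_weight_mul_count_le hα0 hα1 hγ hu hΛ hGlo hGα hδ hV1 hV2)
        gcongr K * ?_
        gcongr
    _ = _ := by ring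

theorem stmt12 (g M : ℕ) (hg : 2 ≤ g) (hM : 1 ≤ M) (CM : Set (ZMod M))
    (hSidon : IsSidonZ CM) (hcov : Covers3 CM) :
    ∃ δ : ℝ, 0 < δ ∧
      ∀ s : ℕ → Fin 3 → ZMod M, GoodS M CM s →
      ∀ lam : ℝ, 1 < lam → ∃ C : ℝ, 0 < C ∧ ∃ n₀ : ℕ, ∀ n : ℕ, n₀ ≤ n →
        ∀ r : Finset ℕ, (∀ a ∈ r, 1 ≤ a ∧ a ≤ n) → 1 ≤ r.card → r.card ≤ 2 * g + 3 →
          ((∑' x : ↥{x ∈ Tn g M lam s n | firstThree g x ∩ r = ∅ ∧ r ⊆ imgF x},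
              ∏ y ∈ imgF x.1 \ r, lam⁻¹ * (y : ℝ) ^ (-alph g)) ≤ C * (n : ℝ) ^ (-δ)) ∧
          ((∑' x : ↥{x ∈ Tn g M lam s n |
                (1 ≤ (firstThree g x ∩ r).card ∧ (firstThree g x ∩ r).card ≤ 2) ∧
                  r ⊆ imgF x},
              ∏ y ∈ imgF x.1 \ r, lam⁻¹ * (y : ℝ) ^ (-alph g)) ≤ C * (n : ℝ) ^ (-δ)) := by
  have hγ : (2 : ℝ) ≤ g := by exact_mod_cast hg
  refine ⟨(2 * alph g - 1) / (8 * g), delta_pos (alph_gt_half g) hγ rfl,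
    fun s hs lam hlam => ?_⟩
  obtain ⟨C₀, hC₀, h0⟩ := exists_disjoint_sum_le g M hg hs hlam rfl
  obtain ⟨C₁, hC₁, h1⟩ := exists_partial_sum_le g M hg hs hlam rfl
  refine ⟨C₀ + C₁, by positivity, 3, fun n hn r hr hr1 hr2 => ?_⟩
  have hr0 : 0 ∉ r := fun h => absurd (hr 0 h).1 (by norm_num)
  refine ⟨(h0 n hn r hr0 hr1 hr2).trans ?_, (h1 n hn r hr0 hr2).trans ?_⟩
  · gcongr
    linarith
  · gcongr
    linarith
end
end

section
/- There exist δ_g > 0 depending only on g and, for each λ > 1, a constant C and a threshold n₀, such that for every integer n ≥ n₀, every finite set r of positive integers ≤ n with |r| ≤ 2g+4, and every fixed integer r₁ ≥ n^{ε}: (i) ∑_{x ∈ T_n^{ind}} (∏_{i=1}^{2g+4} x_i^{-α}) · |{ {y₁, y₂, y₃} ∈ C_{r,x}(n) : {y₁, y₂, y₃} ≠ {x₁, x₂, x₃} }| ≤ C · n^{-δ_g}; and (ii) ∑_{x ∈ V_{r₁}} (∏_{i=4}^{2g+4} x_i^{-α}) · |C_{r,x}(n)| ≤ C · n^{-δ_g},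 where in (ii) Set(x) = {x₄, …, x_{2g+4}}. The constants are independent of r and r₁. -/
noncomputable section

open Real MeasureTheory ProbabilityTheory

theorem sum_rpow_neg_le_s17 {a : ℝ} (h0 : 0 ≤ a) (h1 : a < 1) (N : ℕ) :
    ∑ q ∈ Finset.Ico 1 (N + 1), (q : ℝ) ^ (-a) ≤ (N : ℝ) ^ (1 - a) / (1 - a) := by
  induction N with
  | zero => simp [Real.zero_rpow (by linarith : (1 : ℝ) - a ≠ 0)]
  | succ N ih =>
    rw [Finset.sum_Ico_succ_top (by omega)]
    refine (add_le_add_left ih _).trans ?_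
    have hN : (0 : ℝ) < (N : ℝ) + 1 := by positivity
    have hb := rpow_one_add_le_one_add_mul_self (s := -(1 / ((N : ℝ) + 1))) (p := 1 - a)
      (by rw [neg_le_neg_iff, div_le_one hN]; linarith [N.cast_nonneg (α := ℝ)])
      (by linarith) (by linarith)
    have e1 : (N : ℝ) = ((N : ℝ) + 1) * (1 + -(1 / ((N : ℝ) + 1))) := by field_simp; ring
    have e2 : 1 + -(1 / ((N : ℝ) + 1)) = N / ((N : ℝ) + 1) := by field_simp; ring
    have e3 : ((N : ℝ) + 1) ^ (1 - a) = ((N : ℝ) + 1) * ((N : ℝ) + 1) ^ (-a) := by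
      rw [sub_eq_add_neg, Real.rpow_add hN, Real.rpow_one]
    have key : (N : ℝ) ^ (1 - a) ≤
        ((N : ℝ) + 1) ^ (1 - a) - (1 - a) * ((N : ℝ) + 1) ^ (-a) := by
      calc (N : ℝ) ^ (1 - a)
          = ((N : ℝ) + 1) ^ (1 - a) * (1 + -(1 / ((N : ℝ) + 1))) ^ (1 - a) := by
            rw [← Real.mul_rpow hN.le (by rw [e2]; positivity), ← e1]
        _ ≤ ((N : ℝ) + 1) ^ (1 - a) * (1 + (1 - a) * -(1 / ((N : ℝ) + 1))) := by gcongr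
        _ = _ := by rw [e3]; field_simp; ring
    push_cast
    have h2 : 0 < 1 - a := by linarith
    rw [le_div_iff₀ h2, add_mul, div_mul_cancel₀ _ h2.ne']
    linarith

theorem pair_weight_le {a : ℝ} (h0 : 0 ≤ a) (h1 : a ≤ 1) {p q R : ℕ} (hp : 1 ≤ p) (hq : 1 ≤ q)
    (hR : 1 ≤ R) (h : R ≤ p + q) :
    (p : ℝ) ^ (-a) * (q : ℝ) ^ (-a) ≤
      2 * (R : ℝ) ^ (-a) * ((p : ℝ) ^ (-a) + (q : ℝ) ^ (-a)) := by
  have hR0 : (0 : ℝ) < R := by exact_mod_cast hR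
  have big : ∀ m : ℕ, R ≤ 2 * m → (m : ℝ) ^ (-a) ≤ 2 * (R : ℝ) ^ (-a) := by
    intro m hm
    have hm' : (R : ℝ) / 2 ≤ m := by
      rw [div_le_iff₀ two_pos]; exact_mod_cast (by omega : R ≤ m * 2)
    calc (m : ℝ) ^ (-a) ≤ ((R : ℝ) / 2) ^ (-a) :=
          Real.rpow_le_rpow_of_nonpos (by positivity) hm' (by linarith)
      _ = (2 : ℝ) ^ a * (R : ℝ) ^ (-a) := by
          rw [Real.div_rpow hR0.le two_pos.le, Real.rpow_neg two_pos.le]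
          field_simp
      _ ≤ 2 * (R : ℝ) ^ (-a) := by
          gcongr
          exact (Real.rpow_le_rpow_of_exponent_le one_le_two h1).trans (Real.rpow_one 2).le
  have hp0 : (0 : ℝ) ≤ (p : ℝ) ^ (-a) := by positivity
  have hq0 : (0 : ℝ) ≤ (q : ℝ) ^ (-a) := by positivity
  have hR1 : (0 : ℝ) ≤ 2 * (R : ℝ) ^ (-a) := by positivity
  rcases le_total p q with hpq | hpq
  · nlinarith [mul_le_mul_of_nonneg_left (big q (by omega)) hp0, mul_nonneg hR1 hq0]
  · nlinarith [mul_le_mul_of_nonneg_left (big p (by omega)) hq0, mul_nonneg hR1 hp0]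

theorem rpow_neg_le_one_of_one_le {a : ℝ} (h0 : 0 ≤ a) {p : ℕ} (hp : 1 ≤ p) :
    (p : ℝ) ^ (-a) ≤ 1 :=
  Real.rpow_le_one_of_one_le_of_nonpos (by exact_mod_cast hp) (by linarith)

theorem sum_pair_weight_le {a : ℝ} (h0 : 0 ≤ a) (h1 : a < 1) {R S : ℕ} (hR : 1 ≤ R)
    (hRS : R ≤ S) (hS : S ≤ 2 * R) :
    ∑ p ∈ Finset.Ico 1 S, (p : ℝ) ^ (-a) * ((S - p : ℕ) : ℝ) ^ (-a) ≤
      8 / (1 - a) * (R : ℝ) ^ (1 - 2 * a) := by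
  have h2 : 0 < 1 - a := by linarith
  have hR0 : (0 : ℝ) < R := by exact_mod_cast hR
  obtain ⟨N, rfl⟩ : ∃ N, S = N + 1 := ⟨S - 1, by omega⟩
  have hrefl : ∑ p ∈ Finset.Ico 1 (N + 1), ((N + 1 - p : ℕ) : ℝ) ^ (-a) =
      ∑ p ∈ Finset.Ico 1 (N + 1), (p : ℝ) ^ (-a) := by
    have := Finset.sum_Ico_reflect (fun p : ℕ => (p : ℝ) ^ (-a)) 1 (m := N + 1) (n := N + 1)
      (by omega)
    simpa using this
  have hN : (N : ℝ) ^ (1 - a) ≤ 2 * (R : ℝ) ^ (1 - a) := by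
    calc (N : ℝ) ^ (1 - a) ≤ (2 * R : ℝ) ^ (1 - a) := by
          gcongr; exact_mod_cast (by omega : N ≤ 2 * R)
      _ = 2 ^ (1 - a) * (R : ℝ) ^ (1 - a) := Real.mul_rpow two_pos.le hR0.le
      _ ≤ 2 * (R : ℝ) ^ (1 - a) := by
          gcongr
          exact (Real.rpow_le_rpow_of_exponent_le one_le_two (by linarith)).trans
            (Real.rpow_one 2).le
  calc ∑ p ∈ Finset.Ico 1 (N + 1), (p : ℝ) ^ (-a) * ((N + 1 - p : ℕ) : ℝ) ^ (-a)
      ≤ ∑ p ∈ Finset.Ico 1 (N + 1),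
          2 * (R : ℝ) ^ (-a) * ((p : ℝ) ^ (-a) + ((N + 1 - p : ℕ) : ℝ) ^ (-a)) := by
        refine Finset.sum_le_sum fun p hp => ?_
        rw [Finset.mem_Ico] at hp
        exact pair_weight_le h0 h1.le hp.1 (by omega) hR (by omega)
    _ = 4 * (R : ℝ) ^ (-a) * ∑ p ∈ Finset.Ico 1 (N + 1), (p : ℝ) ^ (-a) := by
        rw [← Finset.mul_sum, Finset.sum_add_distrib, hrefl]; ring
    _ ≤ 4 * (R : ℝ) ^ (-a) * ((N : ℝ) ^ (1 - a) / (1 - a)) := by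
        gcongr; exact sum_rpow_neg_le_s17 h0 h1 N
    _ ≤ 4 * (R : ℝ) ^ (-a) * (2 * (R : ℝ) ^ (1 - a) / (1 - a)) := by gcongr
    _ = 8 / (1 - a) * (R : ℝ) ^ (1 - 2 * a) := by
        rw [show 1 - 2 * a = -a + (1 - a) by ring, Real.rpow_add hR0]; ring

theorem tsum_subtype_le_of_sum_le {X : Type*} {S : Set X} {f : X → ℝ} {B : ℝ} (hB : 0 ≤ B)
    (h : ∀ F : Finset X, (∀ x ∈ F, x ∈ S) → ∑ x ∈ F, f x ≤ B) : ∑' x : S, f x ≤ B := by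
  refine tsum_le_of_sum_le' hB fun F => ?_
  have := h (F.map (Function.Embedding.subtype _)) (by
    intro x hx
    obtain ⟨y, -, rfl⟩ := Finset.mem_map.1 hx
    exact y.2)
  simpa using this

@[to_additive]
theorem prod_fin_odd {β : Type*} [CommMonoid β] (g : ℕ) (F : Fin (2 * g + 1) → β) :
    ∏ i, F i = F ⟨0, by omega⟩ *
      ∏ t : Fin g, F ⟨2 * t + 1, by omega⟩ * F ⟨2 * t + 2, by omega⟩ := by
  induction g with
  | zero => simp
  | succ g ih =>
    refine (Fin.prod_univ_castSucc (n := 2 * g + 2) F).trans ?_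
    rw [Fin.prod_univ_castSucc (n := 2 * g + 1), Fin.prod_univ_castSucc (n := g),
      ih fun i => F i.castSucc.castSucc, mul_assoc, mul_assoc]
    rfl

theorem sum_le_sum_of_injOn_of_le {X Y : Type*} [DecidableEq Y] {F : Finset X} {G : Finset Y}
    {f : X → ℝ} {h : Y → ℝ} (φ : X → Y) (hφ : ∀ x ∈ F, φ x ∈ G)
    (hinj : Set.InjOn φ F) (hle : ∀ x ∈ F, f x ≤ h (φ x)) (h0 : ∀ y ∈ G, 0 ≤ h y) :
    ∑ x ∈ F, f x ≤ ∑ y ∈ G, h y :=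
  calc ∑ x ∈ F, f x ≤ ∑ x ∈ F, h (φ x) := Finset.sum_le_sum hle
    _ = ∑ y ∈ F.image φ, h y := (Finset.sum_image hinj).symm
    _ ≤ ∑ y ∈ G, h y := Finset.sum_le_sum_of_subset_of_nonneg
        (Finset.image_subset_iff.2 hφ) fun y hy _ => h0 y hy

theorem Vr.pair_sum {g R : ℕ} {v : Fin (2 * g + 1) → ℕ} (hv : v ∈ Vr g R) (t : Fin g) :
    v ⟨2 * t + 1, by omega⟩ + v ⟨2 * t + 2, by omega⟩ = R + v ⟨0, by omega⟩ :=
  (hv.2.1 t t.2).symm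

theorem fin_odd_cases {g : ℕ} (i : Fin (2 * g + 1)) :
    i = ⟨0, by omega⟩ ∨ ∃ t : Fin g, i = ⟨2 * t + 1, by omega⟩ ∨ i = ⟨2 * t + 2, by omega⟩ := by
  obtain ⟨i, hi⟩ := i
  rcases Nat.eq_zero_or_pos i with rfl | h0
  · exact .inl rfl
  · refine .inr ⟨⟨(i - 1) / 2, by omega⟩, ?_⟩
    simp only [Fin.mk.injEq]
    omega

theorem Vr.ext_of_odd {g R : ℕ} {v v' : Fin (2 * g + 1) → ℕ} (hv : v ∈ Vr g R)
    (hv' : v' ∈ Vr g R) (h0 : v ⟨0, by omega⟩ = v' ⟨0, by omega⟩)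
    (h : ∀ t : Fin g, v ⟨2 * t + 1, by omega⟩ = v' ⟨2 * t + 1, by omega⟩) : v = v' := by
  funext i
  obtain rfl | ⟨t, rfl | rfl⟩ := fin_odd_cases i
  · exact h0
  · exact h t
  · have := Vr.pair_sum hv t
    have := Vr.pair_sum hv' t
    have := h t
    omega

/-- If a linear constraint involves exactly one member of the pair `t₀`, then that pair is
determined by the remaining coordinates. -/
theorem Vr.ext_of_constraint {g R c : ℕ} {J : Finset (Fin (2 * g + 1))} {t₀ : Fin g}
    (ht₀ : ¬ ((⟨2 * t₀ + 1, by omega⟩ : Fin (2 * g + 1)) ∈ J ↔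
      (⟨2 * t₀ + 2, by omega⟩ : Fin (2 * g + 1)) ∈ J))
    {v v' : Fin (2 * g + 1) → ℕ} (hv : v ∈ Vr g R) (hv' : v' ∈ Vr g R)
    (hc : ∑ i ∈ J, v i = c) (hc' : ∑ i ∈ J, v' i = c)
    (h0 : v ⟨0, by omega⟩ = v' ⟨0, by omega⟩)
    (h : ∀ t ∈ Finset.univ.erase t₀, v ⟨2 * t + 1, by omega⟩ = v' ⟨2 * t + 1, by omega⟩) :
    v = v' := by
  have hoff : ∀ i : Fin (2 * g + 1), (i : ℕ) ≠ 2 * t₀ + 1 → (i : ℕ) ≠ 2 * t₀ + 2 →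
      v i = v' i := by
    intro i h1 h2
    obtain rfl | ⟨t, rfl | rfl⟩ := fin_odd_cases i
    · exact h0
    · exact h t (by simp only [Finset.mem_erase, Finset.mem_univ, and_true]; rintro rfl; simp at h1)
    · have := Vr.pair_sum hv t
      have := Vr.pair_sum hv' t
      have := h t (by
        simp only [Finset.mem_erase, Finset.mem_univ, and_true]; rintro rfl; simp at h2)
      omega
  have hkey : v ⟨2 * t₀ + 1, by omega⟩ = v' ⟨2 * t₀ + 1, by omega⟩ := by
    have hs := Vr.pair_sum hv t₀
    have hs' := Vr.pair_sum hv' t₀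
    by_cases h1 : (⟨2 * t₀ + 1, by omega⟩ : Fin (2 * g + 1)) ∈ J
    · have h2 : (⟨2 * t₀ + 2, by omega⟩ : Fin (2 * g + 1)) ∉ J := by tauto
      rw [← Finset.add_sum_erase _ _ h1] at hc hc'
      have : ∑ i ∈ J.erase ⟨2 * t₀ + 1, by omega⟩, v i =
          ∑ i ∈ J.erase ⟨2 * t₀ + 1, by omega⟩, v' i := by
        refine Finset.sum_congr rfl fun i hi => hoff i ?_ ?_
        · exact fun e => (Finset.mem_erase.1 hi).1 (Fin.ext e)
        · exact fun e => h2 ((Fin.ext e : i = ⟨2 * t₀ + 2, by omega⟩) ▸ (Finset.mem_erase.1 hi).2)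
      omega
    · have h2 : (⟨2 * t₀ + 2, by omega⟩ : Fin (2 * g + 1)) ∈ J := by tauto
      rw [← Finset.add_sum_erase _ _ h2] at hc hc'
      have : ∑ i ∈ J.erase ⟨2 * t₀ + 2, by omega⟩, v i =
          ∑ i ∈ J.erase ⟨2 * t₀ + 2, by omega⟩, v' i := by
        refine Finset.sum_congr rfl fun i hi => hoff i ?_ ?_
        · exact fun e => h1 ((Fin.ext e : i = ⟨2 * t₀ + 1, by omega⟩) ▸ (Finset.mem_erase.1 hi).2)
        · exact fun e => (Finset.mem_erase.1 hi).1 (Fin.ext e)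
      omega
  refine Vr.ext_of_odd hv hv' h0 fun t => ?_
  by_cases e : t = t₀
  · rw [e]; exact hkey
  · exact h t (by simp [e])

theorem Vr.fibre_sum_le {g : ℕ} (D : Finset (Fin g)) {a : ℝ} (h0 : 0 ≤ a) (h1 : a < 1)
    {R b : ℕ} (hR : 1 ≤ R) (hb : b ≤ R) (F : Finset (Fin (2 * g + 1) → ℕ))
    (hF : ∀ v ∈ F, v ∈ Vr g R) (hFb : ∀ v ∈ F, v ⟨0, by omega⟩ = b)
    (hinj : ∀ v ∈ F, ∀ v' ∈ F,
      (∀ t ∈ D, v ⟨2 * t + 1, by omega⟩ = v' ⟨2 * t + 1, by omega⟩) → v = v') :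
    ∑ v ∈ F, ∏ t : Fin g, (v ⟨2 * t + 1, by omega⟩ : ℝ) ^ (-a) *
        (v ⟨2 * t + 2, by omega⟩ : ℝ) ^ (-a) ≤
      ∏ t : Fin g, if t ∈ D then 8 / (1 - a) * (R : ℝ) ^ (1 - 2 * a)
        else 4 * (R : ℝ) ^ (-a) := by
  have h2 : 0 < 1 - a := by linarith
  let A : Fin g → Finset ℕ := fun t => if t ∈ D then Finset.Ico 1 (R + b) else {0}
  let H : Fin g → ℕ → ℝ := fun t q =>
    if t ∈ D then (q : ℝ) ^ (-a) * ((R + b - q : ℕ) : ℝ) ^ (-a) else 4 * (R : ℝ) ^ (-a)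
  have hH : ∀ t q, 0 ≤ H t q := by
    intro t q
    simp only [H]
    split_ifs <;> positivity
  calc _ ≤ ∑ p ∈ Fintype.piFinset A, ∏ t, H t (p t) := by
        refine sum_le_sum_of_injOn_of_le
          (fun v t => if t ∈ D then v ⟨2 * t + 1, by omega⟩ else 0) ?_ ?_ ?_ ?_
        · intro v hv
          refine Fintype.mem_piFinset.2 fun t => ?_
          by_cases ht : t ∈ D
          · have := Vr.pair_sum (hF v hv) t
            have := (hF v hv).1 ⟨2 * t + 1, by omega⟩
            have := (hF v hv).1 ⟨2 * t + 2, by omega⟩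
            have := hFb v hv
            simp only [A, ht, if_true, Finset.mem_Ico]
            omega
          · simp [A, ht]
        · intro v hv v' hv' he
          refine hinj v hv v' hv' fun t ht => ?_
          simpa [ht] using congrFun he t
        · intro v hv
          refine Finset.prod_le_prod (fun t _ => by positivity) fun t _ => ?_
          have hs := Vr.pair_sum (hF v hv) t
          rw [hFb v hv] at hs
          have hp := (hF v hv).1 ⟨2 * t + 1, by omega⟩
          have hq := (hF v hv).1 ⟨2 * t + 2, by omega⟩
          by_cases ht : t ∈ D
          · simp only [H, ht, if_true]
            rw [show R + b - v ⟨2 * t + 1, by omega⟩ = v ⟨2 * t + 2, by omega⟩ by omega]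
          · simp only [H, ht, if_false]
            refine (pair_weight_le h0 h1.le hp hq hR (by omega)).trans ?_
            have e1 := rpow_neg_le_one_of_one_le h0 hp
            have e2 := rpow_neg_le_one_of_one_le h0 hq
            have e3 : (0 : ℝ) ≤ (R : ℝ) ^ (-a) := by positivity
            nlinarith
        · exact fun p _ => Finset.prod_nonneg fun t _ => hH _ _
    _ = ∏ t, ∑ q ∈ A t, H t q := (Finset.prod_univ_sum A H).symm
    _ ≤ _ := by
        refine Finset.prod_le_prod (fun t _ => Finset.sum_nonneg fun q _ => hH _ _)
          fun t _ => ?_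
        by_cases ht : t ∈ D
        · simp only [A, H, ht, if_true]
          exact sum_pair_weight_le h0 h1 hR (by omega) (by omega)
        · simp [A, H, ht]

theorem alph_bounds {g : ℕ} (hg : 1 ≤ g) :
    0 < alph g ∧ alph g < 1 ∧ (1 - 2 * alph g) * g = -(1 - alph g) := by
  have : (1 : ℝ) ≤ g := by exact_mod_cast hg
  refine ⟨by unfold alph; positivity, ?_, ?_⟩
  · unfold alph; rw [div_lt_one (by positivity)]; linarith
  · unfold alph; field_simp; ring

theorem Vr.sum_le_of_fibre {g : ℕ} {a : ℝ} (h0 : 0 ≤ a) (h1 : a < 1) {R : ℕ}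
    {Q : ℝ} (hQ : 0 ≤ Q) (F : Finset (Fin (2 * g + 1) → ℕ))
    (hF : ∀ v ∈ F, v ∈ Vr g R)
    (h : ∀ b ≤ R, ∑ v ∈ F with v ⟨0, by omega⟩ = b,
      ∏ t : Fin g, (v ⟨2 * t + 1, by omega⟩ : ℝ) ^ (-a) *
        (v ⟨2 * t + 2, by omega⟩ : ℝ) ^ (-a) ≤ Q) :
    ∑ v ∈ F, ∏ i, (v i : ℝ) ^ (-a) ≤ (R : ℝ) ^ (1 - a) / (1 - a) * Q := by
  have hmaps : ∀ v ∈ F, v ⟨0, by omega⟩ ∈ Finset.Ico 1 (R + 1) := fun v hv =>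
    Finset.mem_Ico.2 ⟨(hF v hv).1 _, Nat.lt_succ_of_le ((hF v hv).2.2.1 _)⟩
  rw [← Finset.sum_fiberwise_of_maps_to hmaps]
  calc _ ≤ ∑ b ∈ Finset.Ico 1 (R + 1), (b : ℝ) ^ (-a) * Q := by
        refine Finset.sum_le_sum fun b hb => ?_
        calc _ = ∑ v ∈ F with v ⟨0, by omega⟩ = b, (b : ℝ) ^ (-a) *
              ∏ t : Fin g, (v ⟨2 * t + 1, by omega⟩ : ℝ) ^ (-a) *
                (v ⟨2 * t + 2, by omega⟩ : ℝ) ^ (-a) := by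
              refine Finset.sum_congr rfl fun v hv => ?_
              rw [prod_fin_odd, (Finset.mem_filter.1 hv).2]
          _ ≤ _ := by
              rw [← Finset.mul_sum]
              gcongr
              exact h b (Nat.lt_succ_iff.1 (Finset.mem_Ico.1 hb).2)
    _ ≤ _ := by
        rw [← Finset.sum_mul]
        gcongr
        exact sum_rpow_neg_le_s17 h0 h1 R

/-- The implied constant in the bounds for weighted sums over `Vr g R`. -/
def tailConst (g : ℕ) : ℝ := (8 / (1 - alph g)) ^ g / (1 - alph g)

theorem tailConst_pos {g : ℕ} (hg : 1 ≤ g) : 0 < tailConst g := by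
  have := (alph_bounds hg).2.1
  have h : 0 < 1 - alph g := by linarith
  unfold tailConst
  positivity

theorem Vr.fibre_sum_le_univ {g : ℕ} (hg : 1 ≤ g) {R b : ℕ} (hR : 1 ≤ R) (hb : b ≤ R)
    (F : Finset (Fin (2 * g + 1) → ℕ)) (hF : ∀ v ∈ F, v ∈ Vr g R)
    (hFb : ∀ v ∈ F, v ⟨0, by omega⟩ = b) :
    ∑ v ∈ F, ∏ t : Fin g, (v ⟨2 * t + 1, by omega⟩ : ℝ) ^ (-alph g) *
        (v ⟨2 * t + 2, by omega⟩ : ℝ) ^ (-alph g) ≤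
      (8 / (1 - alph g)) ^ g * (R : ℝ) ^ (-(1 - alph g)) := by
  obtain ⟨h0, h1, h2⟩ := alph_bounds hg
  refine (Vr.fibre_sum_le Finset.univ h0.le h1 hR hb F hF hFb fun v hv v' hv' h =>
    Vr.ext_of_odd (hF v hv) (hF v' hv') ((hFb v hv).trans (hFb v' hv').symm)
      fun t => h t (Finset.mem_univ t)).trans_eq ?_
  simp only [Finset.mem_univ, if_true, Finset.prod_const, Finset.card_univ, Fintype.card_fin]
  rw [mul_pow, ← Real.rpow_mul_natCast (by positivity), h2]

theorem Vr.sum_le {g : ℕ} (hg : 1 ≤ g) {R : ℕ} (hR : 1 ≤ R)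
    (F : Finset (Fin (2 * g + 1) → ℕ)) (hF : ∀ v ∈ F, v ∈ Vr g R) :
    ∑ v ∈ F, ∏ i, (v i : ℝ) ^ (-alph g) ≤ tailConst g := by
  obtain ⟨h0, h1, h2⟩ := alph_bounds hg
  have h3 : 0 < 1 - alph g := by linarith
  have hR0 : (0 : ℝ) < R := by exact_mod_cast hR
  refine (Vr.sum_le_of_fibre h0.le h1
    (Q := (8 / (1 - alph g)) ^ g * (R : ℝ) ^ (-(1 - alph g))) (by positivity) F hF
    fun b hb => Vr.fibre_sum_le_univ hg hR hb _ (fun v hv => hF v (Finset.mem_filter.1 hv).1)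
      fun v hv => (Finset.mem_filter.1 hv).2).trans_eq ?_
  rw [Real.rpow_neg hR0.le, tailConst]
  field_simp

theorem Vr.sum_le_of_constraint {g : ℕ} (hg : 1 ≤ g) {R c : ℕ} (hR : 1 ≤ R)
    {J : Finset (Fin (2 * g + 1))} (hJ : J.Nonempty)
    (F : Finset (Fin (2 * g + 1) → ℕ)) (hF : ∀ v ∈ F, v ∈ Vr g R)
    (hc : ∀ v ∈ F, ∑ i ∈ J, v i = c) :
    ∑ v ∈ F, ∏ i, (v i : ℝ) ^ (-alph g) ≤ tailConst g * (R : ℝ) ^ (-(1 - alph g)) := by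
  obtain ⟨h0, h1, h2⟩ := alph_bounds hg
  have h3 : 0 < 1 - alph g := by linarith
  have hR0 : (0 : ℝ) < R := by exact_mod_cast hR
  by_cases hcase : ∃ t₀ : Fin g, ¬ ((⟨2 * t₀ + 1, by omega⟩ : Fin (2 * g + 1)) ∈ J ↔
      (⟨2 * t₀ + 2, by omega⟩ : Fin (2 * g + 1)) ∈ J)
  · obtain ⟨t₀, ht₀⟩ := hcase
    have hQ : ∏ t : Fin g, (if t ∈ Finset.univ.erase t₀ then
          8 / (1 - alph g) * (R : ℝ) ^ (1 - 2 * alph g) else 4 * (R : ℝ) ^ (-alph g)) ≤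
        (8 / (1 - alph g)) ^ g * (R : ℝ) ^ (-2 * (1 - alph g)) := by
      rw [← Finset.prod_erase_mul _ _ (Finset.mem_univ t₀),
        Finset.prod_congr rfl fun t ht => if_pos ht]
      simp only [Finset.prod_const, Finset.card_erase_of_mem (Finset.mem_univ t₀),
        Finset.card_univ, Fintype.card_fin, Finset.mem_erase, ne_eq, not_true_eq_false,
        false_and, if_false]
      obtain ⟨k, rfl⟩ : ∃ k, g = k + 1 := ⟨g - 1, by omega⟩
      have hk : (4 : ℝ) ≤ 8 / (1 - alph (k + 1)) := by
        rw [le_div_iff₀ h3]; linarith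
      have he : (1 - 2 * alph (k + 1)) * k + -alph (k + 1) = -2 * (1 - alph (k + 1)) := by
        push_cast at h2
        linarith
      rw [Nat.add_sub_cancel, mul_pow, ← Real.rpow_mul_natCast (by positivity), ← he,
        Real.rpow_add hR0, pow_succ]
      calc _ = (8 / (1 - alph (k + 1))) ^ k * 4 * ((R : ℝ) ^ ((1 - 2 * alph (k + 1)) * k) *
            (R : ℝ) ^ (-alph (k + 1))) := by ring
        _ ≤ _ := by gcongr
    refine (Vr.sum_le_of_fibre h0.le h1
      (Q := (8 / (1 - alph g)) ^ g * (R : ℝ) ^ (-2 * (1 - alph g))) (by positivity) F hF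
      fun b hb => ?_).trans_eq ?_
    · refine (Vr.fibre_sum_le (Finset.univ.erase t₀) h0.le h1 hR hb _
        (fun v hv => hF v (Finset.mem_filter.1 hv).1)
        (fun v hv => (Finset.mem_filter.1 hv).2) fun v hv v' hv' h => ?_).trans hQ
      rw [Finset.mem_filter] at hv hv'
      exact Vr.ext_of_constraint ht₀ (hF v hv.1) (hF v' hv'.1) (hc v hv.1) (hc v' hv'.1)
        (hv.2.trans hv'.2.symm) h
    · have : (R : ℝ) ^ (-(1 - alph g)) =
          (R : ℝ) ^ (1 - alph g) * (R : ℝ) ^ (-2 * (1 - alph g)) := by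
        rw [← Real.rpow_add hR0]; ring_nf
      rw [this, tailConst]
      ring
  · push Not at hcase
    have hconst : ∀ v ∈ F, ∀ v' ∈ F, v ⟨0, by omega⟩ = v' ⟨0, by omega⟩ := by
      have hform : ∀ v ∈ F, ∑ i ∈ J, v i =
          (if (⟨0, by omega⟩ : Fin (2 * g + 1)) ∈ J then v ⟨0, by omega⟩ else 0) +
          ∑ t : Fin g, if (⟨2 * t + 1, by omega⟩ : Fin (2 * g + 1)) ∈ J then
            R + v ⟨0, by omega⟩ else 0 := by
        intro v hv
        rw [← Finset.univ_inter J, ← Finset.sum_ite_mem, sum_fin_odd, Finset.univ_inter]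
        congr 1
        refine Finset.sum_congr rfl fun t _ => ?_
        have := Vr.pair_sum (hF v hv) t
        by_cases ht : (⟨2 * t + 1, by omega⟩ : Fin (2 * g + 1)) ∈ J
        · rw [if_pos ht, if_pos ((hcase t).1 ht), if_pos ht, this]
        · rw [if_neg ht, if_neg (mt (hcase t).2 ht), if_neg ht, add_zero]
      have hlt : ∀ v ∈ F, ∀ v' ∈ F, ¬ v ⟨0, by omega⟩ < v' ⟨0, by omega⟩ := by
        intro v hv v' hv' h
        have he := (hc v hv).trans (hc v' hv').symm
        rw [hform v hv, hform v' hv'] at he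
        refine he.not_lt ?_
        have hpair : ∀ t : Fin g,
            (if (⟨2 * t + 1, by omega⟩ : Fin (2 * g + 1)) ∈ J then
              R + v ⟨0, by omega⟩ else 0) ≤
            (if (⟨2 * t + 1, by omega⟩ : Fin (2 * g + 1)) ∈ J then
              R + v' ⟨0, by omega⟩ else 0) := by
          intro t; split_ifs <;> omega
        have hpairs := Finset.sum_le_sum fun t (_ : t ∈ Finset.univ) => hpair t
        obtain ⟨i, hi⟩ := hJ
        obtain rfl | ⟨t, ht⟩ := fin_odd_cases i
        · rw [if_pos hi, if_pos hi]
          omega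
        · have hi' : (⟨2 * t + 1, by omega⟩ : Fin (2 * g + 1)) ∈ J := by
            rcases ht with rfl | rfl
            · exact hi
            · exact (hcase t).2 hi
          refine add_lt_add_of_le_of_lt (by split_ifs <;> omega)
            (Finset.sum_lt_sum (fun t _ => hpair t) ⟨t, Finset.mem_univ t, ?_⟩)
          rw [if_pos hi', if_pos hi']
          omega
      exact fun v hv v' hv' => le_antisymm (not_lt.1 (hlt v' hv' v hv)) (not_lt.1 (hlt v hv v' hv'))
    rcases F.eq_empty_or_nonempty with rfl | ⟨w, hw⟩
    · simp only [Finset.sum_empty]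
      have := tailConst_pos hg
      positivity
    · have hb : w ⟨0, by omega⟩ ≤ R := (hF w hw).2.2.1 _
      calc _ ≤ ∑ v ∈ F, ∏ t : Fin g, (v ⟨2 * t + 1, by omega⟩ : ℝ) ^ (-alph g) *
              (v ⟨2 * t + 2, by omega⟩ : ℝ) ^ (-alph g) := by
            refine Finset.sum_le_sum fun v hv => ?_
            rw [prod_fin_odd]
            exact mul_le_of_le_one_left (by positivity)
              (rpow_neg_le_one_of_one_le h0.le ((hF v hv).1 _))
        _ ≤ _ := Vr.fibre_sum_le_univ hg hR hb F hF fun v hv => hconst v hv w hw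
        _ ≤ _ := by
            gcongr
            rw [tailConst, le_div_iff₀ h3]
            exact mul_le_of_le_one_right (by positivity) (by linarith)

theorem Rn.card_le_three {g M : ℕ} {lam : ℝ} {s : ℕ → Fin 3 → ZMod M} {n : ℕ} {w : Finset ℕ}
    (hw : w ∈ Rn g M lam s n) : w.card ≤ 3 := by
  obtain ⟨y₁, y₂, y₃, rfl, -⟩ := hw
  exact Finset.card_le_three

theorem Rn.sum_eq {g M : ℕ} {CM : Set (ZMod M)} {lam : ℝ} {s : ℕ → Fin 3 → ZMod M}
    (hs : GoodS M CM s) {n : ℕ} {w : Finset ℕ} (hw : w ∈ Rn g M lam s n) :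
    ∑ b ∈ w, b = n := by
  obtain ⟨y₁, y₂, y₃, rfl, -, -, -, hsum, -, -, -, -, -, -, h₁, h₂, h₃⟩ := hw
  obtain ⟨-, h01, h02, h12, -⟩ := hs n
  have e12 : y₁ ≠ y₂ := by rintro rfl; exact h01 (h₁.symm.trans h₂)
  have e13 : y₁ ≠ y₃ := by rintro rfl; exact h02 (h₁.symm.trans h₃)
  have e23 : y₂ ≠ y₃ := by rintro rfl; exact h12 (h₂.symm.trans h₃)
  rw [Finset.sum_insert (by simp [e12, e13]), Finset.sum_pair e23]
  omega

theorem CcalR.exists_pattern {g M : ℕ} {CM : Set (ZMod M)} {lam : ℝ}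
    {s : ℕ → Fin 3 → ZMod M} (hs : GoodS M CM s) {n m : ℕ} {x : Fin m → ℕ}
    (hx : Function.Injective x) {r w : Finset ℕ} (hw : w ∈ CcalR g M lam s n (imgF x) r) :
    ∃ J : Finset (Fin m), ∃ B ⊆ r, J.Nonempty ∧ w = J.image x ∪ B ∧
      ∑ i ∈ J, x i + ∑ b ∈ B, b = n := by
  obtain ⟨hR, hsub, a, haw, haX, har⟩ := hw
  have himg : (Finset.univ.filter fun i => x i ∈ w ∧ x i ∉ r).image x =
      w.filter (· ∉ r) := by
    ext b
    simp only [Finset.mem_image, Finset.mem_filter, Finset.mem_univ, true_and]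
    constructor
    · rintro ⟨i, hi, rfl⟩; exact hi
    · rintro ⟨hb, hbr⟩
      obtain ⟨i, -, rfl⟩ := Finset.mem_image.1 ((Finset.mem_union.1 (hsub hb)).resolve_right hbr)
      exact ⟨i, ⟨hb, hbr⟩, rfl⟩
  refine ⟨Finset.univ.filter fun i => x i ∈ w ∧ x i ∉ r, w.filter (· ∈ r),
    fun b hb => (Finset.mem_filter.1 hb).2, ?_, ?_, ?_⟩
  · obtain ⟨i, -, rfl⟩ := Finset.mem_image.1 haX
    exact ⟨i, by simp [haw, har]⟩
  · rw [himg, Finset.union_comm, Finset.filter_union_filter_not_eq]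
  · rw [← Finset.sum_image (f := fun b : ℕ => b) hx.injOn, himg, add_comm,
      Finset.sum_filter_add_sum_filter_not, Rn.sum_eq hs hR]

/-- Reduces a weighted count of triples to weighted sums over solutions of a single additional
linear equation, one for each way the triple can meet the tuple and `r`. -/
theorem sum_mul_ncard_le {g M : ℕ} {CM : Set (ZMod M)} {lam : ℝ}
    {s : ℕ → Fin 3 → ZMod M} (hs : GoodS M CM s) {n m : ℕ} {r : Finset ℕ}
    (F : Finset (Fin m → ℕ)) (hF : ∀ x ∈ F, Function.Injective x)
    (W : (Fin m → ℕ) → Set (Finset ℕ)) (hW : ∀ x ∈ F, W x ⊆ CcalR g M lam s n (imgF x) r)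
    (P : Finset (Fin m) → Prop)
    (hP : ∀ x ∈ F, ∀ w ∈ W x, ∀ J : Finset (Fin m), J.image x ⊆ w → P J)
    (f : (Fin m → ℕ) → ℝ) (hf : ∀ x ∈ F, 0 ≤ f x) {K : ℝ}
    (hK : ∀ J : Finset (Fin m), J.Nonempty → P J → ∀ c : ℕ, ∀ F' ⊆ F,
      (∀ x ∈ F', ∑ i ∈ J, x i + c = n) → ∑ x ∈ F', f x ≤ K) (hK0 : 0 ≤ K) :
    ∑ x ∈ F, f x * (Set.ncard (W x) : ℝ) ≤ 2 ^ m * 2 ^ r.card * K := by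
  classical
  let Q : Finset (Finset (Fin m) × Finset ℕ) := Finset.univ ×ˢ r.powerset
  let A : (Fin m → ℕ) → Finset (Fin m) × Finset ℕ → Prop := fun x p =>
    (p.1.Nonempty ∧ P p.1) ∧ ∑ i ∈ p.1, x i + ∑ b ∈ p.2, b = n
  have hcount : ∀ x ∈ F, (Set.ncard (W x) : ℝ) ≤ ∑ p ∈ Q, if A x p then 1 else 0 := by
    intro x hx
    rw [Finset.sum_boole]
    have hsub : W x ⊆ ((Q.filter (A x)).image fun p => p.1.image x ∪ p.2 : Finset (Finset ℕ)) := by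
      intro w hw
      obtain ⟨J, B, hB, hJ, rfl, hsum⟩ := CcalR.exists_pattern hs (hF x hx) (hW x hx hw)
      refine Finset.mem_coe.2 (Finset.mem_image.2 ⟨(J, B), Finset.mem_filter.2 ⟨?_, ?_⟩, rfl⟩)
      · exact Finset.mem_product.2 ⟨Finset.mem_univ _, Finset.mem_powerset.2 hB⟩
      · exact ⟨⟨hJ, hP x hx _ hw J Finset.subset_union_left⟩, hsum⟩
    have h1 := Set.ncard_le_ncard hsub (Finset.finite_toSet _)
    rw [Set.ncard_coe_finset] at h1
    exact_mod_cast h1.trans Finset.card_image_le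
  calc ∑ x ∈ F, f x * (Set.ncard (W x) : ℝ)
      ≤ ∑ x ∈ F, f x * ∑ p ∈ Q, if A x p then 1 else 0 :=
        Finset.sum_le_sum fun x hx => mul_le_mul_of_nonneg_left (hcount x hx) (hf x hx)
    _ = ∑ p ∈ Q, ∑ x ∈ F with A x p, f x := by
        simp only [Finset.mul_sum, mul_ite, mul_one, mul_zero]
        rw [Finset.sum_comm]
        simp only [Finset.sum_filter]
    _ ≤ ∑ _p ∈ Q, K := by
        refine Finset.sum_le_sum fun p _ => ?_
        by_cases hp : p.1.Nonempty ∧ P p.1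
        · exact hK p.1 hp.1 hp.2 (∑ b ∈ p.2, b) _ (Finset.filter_subset _ _)
            fun x hx => (Finset.mem_filter.1 hx).2.2
        · rw [Finset.filter_false_of_mem fun x _ hx => hp hx.1, Finset.sum_empty]
          exact hK0
    _ = 2 ^ m * 2 ^ r.card * K := by
        rw [Finset.sum_const, Finset.card_product, Finset.card_powerset, Finset.card_univ,
          Fintype.card_finset, Fintype.card_fin, nsmul_eq_mul]
        push_cast
        ring

/-- The position in a tuple of the `i`-th of the first three entries. -/
def headIdx (g : ℕ) (i : Fin 3) : Fin (2 * g + 4) := ⟨i, by omega⟩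

/-- The position in a tuple of the `i`-th entry after the first three. -/
def tailIdx (g : ℕ) (i : Fin (2 * g + 1)) : Fin (2 * g + 4) := ⟨i + 3, by omega⟩

@[to_additive]
theorem prod_head_mul_tail {β : Type*} [CommMonoid β] (g : ℕ) (F : Fin (2 * g + 4) → β) :
    ∏ i, F i = (∏ i, F (headIdx g i)) * ∏ i, F (tailIdx g i) := by
  rw [Fin.prod_univ_three]
  refine (Fin.prod_univ_succ (n := 2 * g + 3) F).trans ?_
  rw [Fin.prod_univ_succ (n := 2 * g + 2), Fin.prod_univ_succ (n := 2 * g + 1), mul_assoc,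
    mul_assoc]
  rfl

theorem idx_cases {g : ℕ} (i : Fin (2 * g + 4)) :
    (∃ k, i = headIdx g k) ∨ ∃ k, i = tailIdx g k := by
  by_cases h : (i : ℕ) < 3
  · exact .inl ⟨⟨i, h⟩, rfl⟩
  · exact .inr ⟨⟨i - 3, by omega⟩, Fin.ext (by simp [tailIdx]; omega)⟩

theorem sum_eq_head_add_tail {g : ℕ} (J : Finset (Fin (2 * g + 4))) (x : Fin (2 * g + 4) → ℕ) :
    ∑ i ∈ J, x i = ∑ i with headIdx g i ∈ J, x (headIdx g i) +
      ∑ i with tailIdx g i ∈ J, x (tailIdx g i) := by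
  rw [← Finset.univ_inter J, ← Finset.sum_ite_mem, sum_head_add_tail, Finset.sum_filter,
    Finset.sum_filter, Finset.univ_inter]

theorem TnInd.tail_mem_Vr {g M : ℕ} {lam : ℝ} {s : ℕ → Fin 3 → ZMod M} {n : ℕ}
    {x : Fin (2 * g + 4) → ℕ} (hx : x ∈ TnInd g M lam s n) :
    x ∘ tailIdx g ∈ Vr g (x (headIdx g 0)) := by
  obtain ⟨⟨hpos, -, hsum, hle, -, -⟩, hinj⟩ := hx
  refine ⟨fun i => hpos _, fun t ht => hsum (t + 2) (by omega) (by omega),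
    fun i => hle _ (by simp [tailIdx]), hinj.comp fun i j h => ?_, fun i h => ?_⟩
  · simpa [tailIdx, Fin.ext_iff] using h
  · have := hinj h
    simp [tailIdx, headIdx] at this

theorem TnInd.head_spec {g M : ℕ} {CM : Set (ZMod M)} {lam : ℝ} {s : ℕ → Fin 3 → ZMod M}
    (hs : GoodS M CM s) {n : ℕ} {x : Fin (2 * g + 4) → ℕ} (hx : x ∈ TnInd g M lam s n) :
    x (headIdx g 0) + x (headIdx g 1) + x (headIdx g 2) = n ∧
    ∃ k : Fin 3, glam g lam n / 2 ≤ x (headIdx g k) ∧ (x (headIdx g k) : ℝ) ≤ glam g lam n ∧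
      ∀ j ≠ k, (n : ℝ) / 4 ≤ x (headIdx g j) := by
  obtain ⟨⟨-, hR, -⟩, hinj⟩ := hx
  have hne : ∀ i j : Fin 3, i ≠ j → x (headIdx g i) ≠ x (headIdx g j) := by
    intro i j hij h
    have := hinj h
    simp [headIdx, Fin.ext_iff] at this
    omega
  have hset : firstThree g x = {x (headIdx g 0), x (headIdx g 1), x (headIdx g 2)} := rfl
  have hmem : ∀ i, x (headIdx g i) ∈ firstThree g x := by
    intro i; rw [hset]; fin_cases i <;> simp
  constructor
  · have := Rn.sum_eq hs hR
    rw [hset, Finset.sum_insert (by simp [hne 0 1, hne 0 2]),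
      Finset.sum_pair (hne 1 2 (by decide))] at this
    omega
  · obtain ⟨y₁, y₂, y₃, he, -, -, -, -, hl, hu, h2, -, h3, -⟩ := hR
    have hy : y₁ ∈ firstThree g x := by rw [he]; simp
    obtain ⟨k, hk⟩ : ∃ k, y₁ = x (headIdx g k) := by
      rw [hset] at hy
      simp only [Finset.mem_insert, Finset.mem_singleton] at hy
      rcases hy with h | h | h
      exacts [⟨0, h⟩, ⟨1, h⟩, ⟨2, h⟩]
    refine ⟨k, hk ▸ hl, hk ▸ hu, fun j hj => ?_⟩
    have hm := hmem j
    rw [he] at hm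
    simp only [Finset.mem_insert, Finset.mem_singleton] at hm
    rcases hm with h | h | h
    · exact absurd (h.trans hk) (hne j k hj)
    · rw [h]; exact h2
    · rw [h]; exact h3

theorem eq_of_eq_of_sum_eq {h h' : Fin 3 → ℕ} {n : ℕ} (hn : h 0 + h 1 + h 2 = n)
    (hn' : h' 0 + h' 1 + h' 2 = n) (k : Fin 3) (h1 : h k = h' k)
    (h2 : h (k + 1) = h' (k + 1)) : h = h' := by
  funext i
  fin_cases k <;> fin_cases i <;> simp at h1 h2 ⊢ <;> omega

theorem card_le_of_fixed {n c : ℕ} (k : Fin 3) (G : Finset (Fin 3 → ℕ))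
    (hpos : ∀ h ∈ G, ∀ i, 1 ≤ h i) (hn : ∀ h ∈ G, h 0 + h 1 + h 2 = n)
    (hc : ∀ h ∈ G, h k = c) : G.card ≤ n := by
  have := Finset.card_le_card_of_injOn (s := G) (t := Finset.Icc 1 n) (fun h => h (k + 1))
    (fun h hh => ?_) fun h hh h' hh' he =>
      eq_of_eq_of_sum_eq (hn h hh) (hn h' hh') k ((hc h hh).trans (hc h' hh').symm) he
  · simpa using this
  · have h1 := hn h hh
    refine Finset.mem_coe.2 (Finset.mem_Icc.2 ⟨hpos h hh _, ?_⟩)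
    fin_cases k <;> simp <;> omega

theorem card_le_of_small {n : ℕ} {L : ℝ} (hL : 0 ≤ L) (G : Finset (Fin 3 → ℕ))
    (hpos : ∀ h ∈ G, ∀ i, 1 ≤ h i) (hn : ∀ h ∈ G, h 0 + h 1 + h 2 = n)
    (hs : ∀ h ∈ G, ∃ k, (h k : ℝ) ≤ L) : (G.card : ℝ) ≤ 3 * (L * n) := by
  have hk : ∀ k : Fin 3, (G.filter fun h => (h k : ℝ) ≤ L).card ≤ ⌊L⌋₊ * n := by
    intro k
    have := Finset.card_le_card_of_injOn (s := G.filter fun h => (h k : ℝ) ≤ L)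
      (t := Finset.Icc 1 ⌊L⌋₊ ×ˢ Finset.Icc 1 n) (fun h => (h k, h (k + 1)))
      (fun h hh => ?_) fun h hh h' hh' he => ?_
    · simpa using this
    · rw [Finset.mem_coe, Finset.mem_filter] at hh
      have h1 := hn h hh.1
      refine Finset.mem_coe.2 (Finset.mem_product.2 ⟨Finset.mem_Icc.2 ⟨hpos h hh.1 _,
        Nat.le_floor hh.2⟩, Finset.mem_Icc.2 ⟨hpos h hh.1 _, ?_⟩⟩)
      fin_cases k <;> simp <;> omega
    · rw [Finset.mem_coe, Finset.mem_filter] at hh hh'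
      rw [Prod.mk.injEq] at he
      exact eq_of_eq_of_sum_eq (hn h hh.1) (hn h' hh'.1) k he.1 he.2
  have hsub : G ⊆ Finset.univ.biUnion fun k => G.filter fun h => (h k : ℝ) ≤ L := by
    intro h hh
    obtain ⟨k, hk⟩ := hs h hh
    exact Finset.mem_biUnion.2 ⟨k, Finset.mem_univ k, Finset.mem_filter.2 ⟨hh, hk⟩⟩
  have hcard : G.card ≤ 3 * (⌊L⌋₊ * n) := by
    refine (Finset.card_le_card hsub).trans (Finset.card_biUnion_le.trans ?_)
    refine (Finset.sum_le_sum fun k _ => hk k).trans ?_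
    simp
  calc (G.card : ℝ) ≤ ((3 * (⌊L⌋₊ * n) : ℕ) : ℝ) := by exact_mod_cast hcard
    _ ≤ _ := by push_cast; gcongr; exact Nat.floor_le hL

theorem rpow_neg_le_mul_of_div_le {a c X y : ℝ} (h0 : 0 ≤ a) (h1 : a ≤ 1) (hc : 1 ≤ c)
    (hX : 0 < X) (h : X / c ≤ y) : y ^ (-a) ≤ c * X ^ (-a) := by
  have hc0 : 0 < c := by linarith
  calc y ^ (-a) ≤ (X / c) ^ (-a) :=
        Real.rpow_le_rpow_of_nonpos (by positivity) h (by linarith)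
    _ = c ^ a * X ^ (-a) := by
        rw [Real.div_rpow hX.le hc0.le, Real.rpow_neg hc0.le]
        field_simp
    _ ≤ c * X ^ (-a) := by
        gcongr
        exact (Real.rpow_le_rpow_of_exponent_le hc h1).trans (Real.rpow_one c).le

theorem TnInd.head_weight_le {g M : ℕ} {CM : Set (ZMod M)} {lam : ℝ} {s : ℕ → Fin 3 → ZMod M}
    (hs : GoodS M CM s) {n : ℕ} (hn : 1 ≤ n) (hL : 0 < glam g lam n) {a : ℝ} (h0 : 0 ≤ a)
    (h1 : a ≤ 1) {x : Fin (2 * g + 4) → ℕ} (hx : x ∈ TnInd g M lam s n) :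
    ∏ i, (x (headIdx g i) : ℝ) ^ (-a) ≤ 32 * glam g lam n ^ (-a) * (n : ℝ) ^ (-2 * a) := by
  obtain ⟨-, k, hk, -, hj⟩ := TnInd.head_spec hs hx
  have hn0 : (0 : ℝ) < n := by exact_mod_cast hn
  have hsmall := rpow_neg_le_mul_of_div_le h0 h1 one_le_two hL hk
  have hbig : ∀ j ≠ k, (x (headIdx g j) : ℝ) ^ (-a) ≤ 4 * (n : ℝ) ^ (-a) := fun j hjk =>
    rpow_neg_le_mul_of_div_le h0 h1 (by norm_num) hn0 (hj j hjk)
  rw [← Finset.mul_prod_erase _ _ (Finset.mem_univ k)]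
  calc _ ≤ (2 * glam g lam n ^ (-a)) * ∏ j ∈ Finset.univ.erase k, 4 * (n : ℝ) ^ (-a) := by
        gcongr with j hj'
        exact hbig j (Finset.ne_of_mem_erase hj')
    _ = _ := by
        rw [Finset.prod_const, Finset.card_erase_of_mem (Finset.mem_univ k), Finset.card_univ,
          Fintype.card_fin, show -2 * a = -a + -a by ring, Real.rpow_add hn0]
        ring

theorem TnInd.sum_le_of_fibre {g M : ℕ} {CM : Set (ZMod M)} {lam : ℝ}
    {s : ℕ → Fin 3 → ZMod M} (hs : GoodS M CM s) {n : ℕ} (hn : 1 ≤ n)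
    (hL : 0 < glam g lam n) {a : ℝ} (h0 : 0 ≤ a) (h1 : a ≤ 1)
    (F : Finset (Fin (2 * g + 4) → ℕ)) (hF : ∀ x ∈ F, x ∈ TnInd g M lam s n) {T : ℝ}
    (hT : ∀ x₀ ∈ F, ∀ V : Finset (Fin (2 * g + 1) → ℕ),
      (∀ v ∈ V, ∃ x ∈ F, x ∘ headIdx g = x₀ ∘ headIdx g ∧ x ∘ tailIdx g = v) →
      ∑ v ∈ V, ∏ i, (v i : ℝ) ^ (-a) ≤ T) :
    ∑ x ∈ F, ∏ i, (x i : ℝ) ^ (-a) ≤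
      (F.image (· ∘ headIdx g)).card *
        (32 * glam g lam n ^ (-a) * (n : ℝ) ^ (-2 * a) * T) := by
  classical
  rw [← Finset.sum_fiberwise_of_maps_to fun x hx =>
    Finset.mem_image_of_mem (· ∘ headIdx g) hx, ← nsmul_eq_mul]
  refine Finset.sum_le_card_nsmul _ _ _ fun h hh => ?_
  obtain ⟨x₀, hx₀, rfl⟩ := Finset.mem_image.1 hh
  have hinj : Set.InjOn (fun x : Fin (2 * g + 4) → ℕ => x ∘ tailIdx g)
      (F.filter fun x => x ∘ headIdx g = x₀ ∘ headIdx g) := by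
    intro x hx x' hx' he
    rw [Finset.mem_coe, Finset.mem_filter] at hx hx'
    funext i
    rcases idx_cases i with ⟨k, rfl⟩ | ⟨k, rfl⟩
    · exact congrFun (hx.2.trans hx'.2.symm) k
    · exact congrFun he k
  have hV := hT x₀ hx₀
    ((F.filter fun x => x ∘ headIdx g = x₀ ∘ headIdx g).image (· ∘ tailIdx g)) (by
      intro v hv
      obtain ⟨x, hx, rfl⟩ := Finset.mem_image.1 hv
      rw [Finset.mem_filter] at hx
      exact ⟨x, hx.1, hx.2, rfl⟩)
  rw [Finset.sum_image hinj] at hV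
  calc _ ≤ ∑ x ∈ F with x ∘ headIdx g = x₀ ∘ headIdx g,
        32 * glam g lam n ^ (-a) * (n : ℝ) ^ (-2 * a) *
          ∏ i, (x (tailIdx g i) : ℝ) ^ (-a) := by
        refine Finset.sum_le_sum fun x hx => ?_
        rw [prod_head_mul_tail]
        gcongr
        exact TnInd.head_weight_le hs hn hL h0 h1 (hF x (Finset.mem_filter.1 hx).1)
    _ ≤ _ := by
        rw [← Finset.mul_sum]
        gcongr
        exact hV

theorem exists_eq_singleton_or_erase : ∀ H : Finset (Fin 3), H.Nonempty → H ≠ Finset.univ →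
    ∃ k, H = {k} ∨ H = Finset.univ.erase k := by
  decide

theorem one_le_log_of_three_le {n : ℕ} (hn : 3 ≤ n) : 1 ≤ Real.log n := by
  rw [Real.le_log_iff_exp_le (by positivity)]
  exact Real.exp_one_lt_three.le.trans (by exact_mod_cast hn)

theorem rpow_inv_le_glam {g : ℕ} (hg : 1 ≤ g) {lam : ℝ} (hlam : 1 < lam) {n : ℕ} (hn : 3 ≤ n) :
    (n : ℝ) ^ ((1 : ℝ) / g) ≤ glam g lam n := by
  obtain ⟨h0, h1, -⟩ := alph_bounds hg
  have h3 : 0 < 1 - alph g := by linarith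
  have e1 : 1 ≤ lam ^ ((2 * (g : ℝ) + 5) / (1 - alph g)) :=
    Real.one_le_rpow hlam.le (by positivity)
  have e2 : 1 ≤ Real.log n ^ ((1 : ℝ) / (1 - alph g)) :=
    Real.one_le_rpow (one_le_log_of_three_le hn) (by positivity)
  have e3 : (0 : ℝ) ≤ (n : ℝ) ^ ((1 : ℝ) / g) := by positivity
  unfold glam
  calc (n : ℝ) ^ ((1 : ℝ) / g) = 1 * (n : ℝ) ^ ((1 : ℝ) / g) * 1 := by ring
    _ ≤ _ := by gcongr

theorem glam_rpow_one_sub {g : ℕ} (hg : 1 ≤ g) {lam : ℝ} (hlam : 1 < lam) {n : ℕ}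
    (hn : 3 ≤ n) :
    glam g lam n ^ (1 - alph g) =
      lam ^ (2 * (g : ℝ) + 5) * (n : ℝ) ^ ((1 - alph g) / g) * Real.log n := by
  obtain ⟨h0, h1, -⟩ := alph_bounds hg
  have h3 : 0 < 1 - alph g := by linarith
  have hl : 0 ≤ Real.log n := zero_le_one.trans (one_le_log_of_three_le hn)
  have hlam0 : 0 ≤ lam := by linarith
  unfold glam
  rw [Real.mul_rpow (by positivity) (by positivity), Real.mul_rpow (by positivity) (by positivity),
    ← Real.rpow_mul hlam0, ← Real.rpow_mul (by positivity), ← Real.rpow_mul hl,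
    div_mul_cancel₀ _ h3.ne', div_mul_cancel₀ _ h3.ne', Real.rpow_one, one_div_mul_eq_div]

/-- Half of the exponent `1 / (2 * g + 1)` saved by an additional linear equation. -/
def savedExp (g : ℕ) : ℝ := 1 / (2 * (2 * (g : ℝ) + 1))

theorem savedExp_pos (g : ℕ) : 0 < savedExp g := by unfold savedExp; positivity

theorem one_sub_two_mul_alph (g : ℕ) : 1 - 2 * alph g = -(2 * savedExp g) := by
  unfold alph savedExp; field_simp; ring

theorem one_sub_alph_div {g : ℕ} (hg : 1 ≤ g) : (1 - alph g) / g = 2 * savedExp g := by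
  have : (0 : ℝ) < g := by exact_mod_cast hg
  unfold alph savedExp; field_simp; ring

theorem rpow_neg_one_sub_alph_le {g : ℕ} (hg : 1 ≤ g) {n R : ℕ} {c : ℝ} (hc : 1 ≤ c)
    (hn : 1 ≤ n) (hR : (n : ℝ) ^ ((1 : ℝ) / g) / c ≤ R) :
    (R : ℝ) ^ (-(1 - alph g)) ≤ c * (n : ℝ) ^ (-(2 * savedExp g)) := by
  obtain ⟨h0, h1, -⟩ := alph_bounds hg
  have hn0 : (0 : ℝ) < n := by exact_mod_cast hn
  refine (rpow_neg_le_mul_of_div_le (by linarith) (by linarith) hc (by positivity) hR).trans_eq ?_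
  rw [← Real.rpow_mul hn0.le, ← one_sub_alph_div hg]
  ring_nf

theorem TnInd.sum_le_of_constraint {g M : ℕ} (hg : 1 ≤ g) {CM : Set (ZMod M)} {lam : ℝ}
    (hlam : 1 < lam) {s : ℕ → Fin 3 → ZMod M} (hs : GoodS M CM s) {n : ℕ} (hn : 3 ≤ n)
    {J : Finset (Fin (2 * g + 4))} (hJ : J.Nonempty) (hJ3 : ¬ ∀ i, headIdx g i ∈ J) {c : ℕ}
    (F : Finset (Fin (2 * g + 4) → ℕ)) (hF : ∀ x ∈ F, x ∈ TnInd g M lam s n)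
    (hc : ∀ x ∈ F, ∑ i ∈ J, x i + c = n) :
    ∑ x ∈ F, ∏ i, (x i : ℝ) ^ (-alph g) ≤
      (384 * tailConst g * lam ^ (2 * (g : ℝ) + 5) / savedExp g + 32 * tailConst g) *
        (n : ℝ) ^ (-savedExp g) := by
  classical
  obtain ⟨h0, h1, -⟩ := alph_bounds hg
  have hT := tailConst_pos hg
  have hd := savedExp_pos g
  have hn0 : (0 : ℝ) < n := by positivity
  have hn1 : (1 : ℝ) ≤ n := by exact_mod_cast (by omega : 1 ≤ n)
  have hg1 : (1 : ℝ) ≤ g := by exact_mod_cast hg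
  have hlam0 : 0 < lam := by linarith
  have hL := rpow_inv_le_glam hg hlam hn
  have hL1 : 1 ≤ glam g lam n := (Real.one_le_rpow hn1 (by positivity)).trans hL
  have hL0 : 0 < glam g lam n := by linarith
  have hGpos : ∀ h ∈ F.image (· ∘ headIdx g), ∀ i, 1 ≤ h i := by
    intro h hh i
    obtain ⟨x, hx, rfl⟩ := Finset.mem_image.1 hh
    exact (hF x hx).1.1 _
  have hGsum : ∀ h ∈ F.image (· ∘ headIdx g), h 0 + h 1 + h 2 = n := by
    intro h hh
    obtain ⟨x, hx, rfl⟩ := Finset.mem_image.1 hh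
    exact (TnInd.head_spec hs (hF x hx)).1
  by_cases htail : (Finset.univ.filter fun i => tailIdx g i ∈ J).Nonempty
  · have hsum := TnInd.sum_le_of_fibre hs (by omega) hL0 h0.le h1.le F hF
      (T := tailConst g * (4 * (n : ℝ) ^ (-(2 * savedExp g)))) (by
        intro x₀ hx₀ V hV
        have hx₀R : 1 ≤ x₀ (headIdx g 0) := (hF x₀ hx₀).1.1 _
        refine (Vr.sum_le_of_constraint hg hx₀R htail
          (c := n - c - ∑ i with headIdx g i ∈ J, x₀ (headIdx g i)) V ?_ ?_).trans ?_
        · intro v hv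
          obtain ⟨x, hx, hh, rfl⟩ := hV v hv
          have := TnInd.tail_mem_Vr (hF x hx)
          rwa [show x (headIdx g 0) = x₀ (headIdx g 0) from congrFun hh 0] at this
        · intro v hv
          obtain ⟨x, hx, hh, rfl⟩ := hV v hv
          have h2 := hc x hx
          rw [sum_eq_head_add_tail] at h2
          have h3 : ∑ i with headIdx g i ∈ J, x (headIdx g i) =
              ∑ i with headIdx g i ∈ J, x₀ (headIdx g i) :=
            Finset.sum_congr rfl fun i _ => congrFun hh i
          simp only [Function.comp]
          omega
        · gcongr
          refine rpow_neg_one_sub_alph_le hg (by norm_num) (by omega) ?_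
          obtain ⟨-, k, hk, -, hj⟩ := TnInd.head_spec hs (hF x₀ hx₀)
          by_cases e : 0 = k
          · subst e; linarith
          · have := hj 0 e
            have h4 : (n : ℝ) ^ ((1 : ℝ) / g) ≤ n :=
              (Real.rpow_le_rpow_of_exponent_le hn1
                (by rw [div_le_one (by positivity)]; exact hg1)).trans_eq (Real.rpow_one _)
            linarith)
    have hcard := card_le_of_small hL0.le _ hGpos hGsum (by
      intro h hh
      obtain ⟨x, hx, rfl⟩ := Finset.mem_image.1 hh
      obtain ⟨-, k, -, hk, -⟩ := TnInd.head_spec hs (hF x hx)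
      exact ⟨k, hk⟩)
    have hlog := Real.log_le_rpow_div hn0.le hd
    have hpow : glam g lam n * n * (glam g lam n ^ (-alph g) * (n : ℝ) ^ (-2 * alph g)) =
        lam ^ (2 * (g : ℝ) + 5) * Real.log n := by
      have e1 : glam g lam n * glam g lam n ^ (-alph g) = glam g lam n ^ (1 - alph g) := by
        rw [sub_eq_add_neg, Real.rpow_add hL0, Real.rpow_one]
      have e2 : (n : ℝ) * (n : ℝ) ^ (-2 * alph g) = (n : ℝ) ^ (-(2 * savedExp g)) := by
        rw [← one_sub_two_mul_alph, sub_eq_add_neg, Real.rpow_add hn0, Real.rpow_one]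
        ring_nf
      calc _ = (glam g lam n * glam g lam n ^ (-alph g)) * (n * (n : ℝ) ^ (-2 * alph g)) := by
            ring
        _ = lam ^ (2 * (g : ℝ) + 5) * Real.log n *
            ((n : ℝ) ^ (2 * savedExp g) * (n : ℝ) ^ (-(2 * savedExp g))) := by
            rw [e1, e2, glam_rpow_one_sub hg hlam hn, one_sub_alph_div hg]; ring
        _ = _ := by rw [← Real.rpow_add hn0]; simp
    calc _ ≤ _ := hsum
      _ ≤ 3 * (glam g lam n * n) * (32 * glam g lam n ^ (-alph g) * (n : ℝ) ^ (-2 * alph g) *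
            (tailConst g * (4 * (n : ℝ) ^ (-(2 * savedExp g))))) := by gcongr
      _ = 384 * tailConst g * (glam g lam n * n *
            (glam g lam n ^ (-alph g) * (n : ℝ) ^ (-2 * alph g))) *
            (n : ℝ) ^ (-(2 * savedExp g)) := by ring
      _ = 384 * tailConst g * lam ^ (2 * (g : ℝ) + 5) * Real.log n *
            (n : ℝ) ^ (-(2 * savedExp g)) := by rw [hpow]; ring
      _ ≤ 384 * tailConst g * lam ^ (2 * (g : ℝ) + 5) * ((n : ℝ) ^ savedExp g / savedExp g) *
            (n : ℝ) ^ (-(2 * savedExp g)) := by gcongr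
      _ = 384 * tailConst g * lam ^ (2 * (g : ℝ) + 5) / savedExp g *
            (n : ℝ) ^ (-savedExp g) := by
          rw [show -savedExp g = savedExp g + -(2 * savedExp g) by ring, Real.rpow_add hn0]
          ring
      _ ≤ _ := by
          gcongr
          linarith
  · have hsum := TnInd.sum_le_of_fibre hs (by omega) hL0 h0.le h1.le F hF
      (T := tailConst g) (by
        intro x₀ hx₀ V hV
        refine Vr.sum_le hg (R := x₀ (headIdx g 0)) ((hF x₀ hx₀).1.1 _) V fun v hv => ?_
        obtain ⟨x, hx, hh, rfl⟩ := hV v hv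
        have := TnInd.tail_mem_Vr (hF x hx)
        rwa [show x (headIdx g 0) = x₀ (headIdx g 0) from congrFun hh 0] at this)
    rw [Finset.not_nonempty_iff_eq_empty] at htail
    have hhead : ∀ x ∈ F, ∑ i with headIdx g i ∈ J, x (headIdx g i) + c = n := by
      intro x hx
      have := hc x hx
      rwa [sum_eq_head_add_tail, htail, Finset.sum_empty, add_zero] at this
    have hcard : (F.image (· ∘ headIdx g)).card ≤ n := by
      obtain ⟨k, hk⟩ := exists_eq_singleton_or_erase
        (Finset.univ.filter fun i => headIdx g i ∈ J) (by
          obtain ⟨i, hi⟩ := hJ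
          rcases idx_cases i with ⟨k, rfl⟩ | ⟨k, rfl⟩
          · exact ⟨k, by simpa using hi⟩
          · exact absurd (by simpa using hi : k ∈ Finset.univ.filter fun i => tailIdx g i ∈ J)
              (by rw [htail]; exact Finset.notMem_empty k))
        (by
          intro he
          refine hJ3 fun i => ?_
          have hi := Finset.mem_univ i
          rw [← he] at hi
          exact (Finset.mem_filter.1 hi).2)
      rcases hk with hk | hk
      · refine card_le_of_fixed (c := n - c) k _ hGpos hGsum fun h hh => ?_
        obtain ⟨x, hx, rfl⟩ := Finset.mem_image.1 hh
        have := hhead x hx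
        rw [hk, Finset.sum_singleton] at this
        simp only [Function.comp]
        omega
      · refine card_le_of_fixed (c := c) k _ hGpos hGsum fun h hh => ?_
        have h2 := hGsum h hh
        obtain ⟨x, hx, rfl⟩ := Finset.mem_image.1 hh
        have h3 := hhead x hx
        have h4 := Finset.add_sum_erase Finset.univ (fun i => x (headIdx g i))
          (Finset.mem_univ k)
        rw [hk] at h3
        rw [Fin.sum_univ_three] at h4
        simp only [Function.comp] at h2 ⊢
        omega
    have hcard' : ((F.image (· ∘ headIdx g)).card : ℝ) ≤ n := by exact_mod_cast hcard
    have hLpow : glam g lam n ^ (-alph g) ≤ 1 :=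
      Real.rpow_le_one_of_one_le_of_nonpos hL1 (by linarith)
    calc _ ≤ _ := hsum
      _ ≤ n * (32 * 1 * (n : ℝ) ^ (-2 * alph g) * tailConst g) := by gcongr
      _ = 32 * tailConst g * (n : ℝ) ^ (-(2 * savedExp g)) := by
          rw [← one_sub_two_mul_alph, sub_eq_add_neg, Real.rpow_add hn0, Real.rpow_one]
          ring_nf
      _ ≤ 32 * tailConst g * (n : ℝ) ^ (-savedExp g) := by
          gcongr
          linarith
      _ ≤ _ := by
          gcongr
          have : 0 ≤ 384 * tailConst g * lam ^ (2 * (g : ℝ) + 5) / savedExp g := by positivity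
          linarith

theorem TnInd.not_forall_headIdx_mem {g M : ℕ} {lam : ℝ} {s : ℕ → Fin 3 → ZMod M} {n : ℕ}
    {x : Fin (2 * g + 4) → ℕ} (hx : x ∈ TnInd g M lam s n) {w : Finset ℕ}
    (hw : w ∈ Rn g M lam s n) (hne : w ≠ firstThree g x) {J : Finset (Fin (2 * g + 4))}
    (hJ : J.image x ⊆ w) : ¬ ∀ i, headIdx g i ∈ J := by
  intro h
  have hfirst : firstThree g x = Finset.univ.image (x ∘ headIdx g) := by
    ext b
    simp [firstThree, headIdx, Fin.exists_fin_succ, eq_comm]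
  have hinj : Function.Injective (x ∘ headIdx g) :=
    hx.2.comp fun i j hij => by simpa [headIdx, Fin.ext_iff] using hij
  refine hne (Finset.eq_of_subset_of_card_le (s := firstThree g x) ?_ ?_).symm
  · rw [hfirst]
    intro b hb
    obtain ⟨i, -, rfl⟩ := Finset.mem_image.1 hb
    exact hJ (Finset.mem_image_of_mem x (h i))
  · rw [hfirst, Finset.card_image_of_injective _ hinj]
    simpa using Rn.card_le_three hw

theorem stmt17 (g M : ℕ) (hg : 2 ≤ g) (hM : 1 ≤ M) (CM : Set (ZMod M))
    (hSidon : IsSidonZ CM) (hcov : Covers3 CM) :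
    ∃ δ : ℝ, 0 < δ ∧
      ∀ s : ℕ → Fin 3 → ZMod M, GoodS M CM s →
      ∀ lam : ℝ, 1 < lam → ∃ C : ℝ, 0 < C ∧ ∃ n₀ : ℕ, ∀ n : ℕ, n₀ ≤ n →
      ∀ r : Finset ℕ, (∀ a ∈ r, 1 ≤ a ∧ a ≤ n) → r.card ≤ 2 * g + 4 →
        ((∑' x : ↥(TnInd g M lam s n),
            (∏ i : Fin (2 * g + 4), (x.1 i : ℝ) ^ (-alph g)) *
              (Set.ncard {w ∈ CcalR g M lam s n (imgF x.1) r |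
                w ≠ firstThree g x.1} : ℝ))
          ≤ C * (n : ℝ) ^ (-δ)) ∧
        (∀ r₁ : ℕ, (n : ℝ) ^ ((1 : ℝ) / (g : ℝ)) ≤ (r₁ : ℝ) →
          (∑' v : ↥(Vr g r₁),
            (∏ i : Fin (2 * g + 1), (v.1 i : ℝ) ^ (-alph g)) *
              (Set.ncard (CcalR g M lam s n (imgF v.1) r) : ℝ))
          ≤ C * (n : ℝ) ^ (-δ)) := by
  have hg1 : 1 ≤ g := by omega
  have hd := savedExp_pos g
  have hT := tailConst_pos hg1
  refine ⟨savedExp g, hd, fun s hs lam hlam => ?_⟩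
  have hlam0 : 0 < lam := by linarith
  set K := 384 * tailConst g * lam ^ (2 * (g : ℝ) + 5) / savedExp g + 32 * tailConst g with hK
  have hK0 : 0 < K := by positivity
  have hTK : tailConst g ≤ K := by
    have : 0 ≤ 384 * tailConst g * lam ^ (2 * (g : ℝ) + 5) / savedExp g := by positivity
    linarith
  refine ⟨2 ^ (2 * g + 4) * 2 ^ (2 * g + 4) * K, by positivity, 3, fun n hn r _ hr => ⟨?_, ?_⟩⟩
  · refine tsum_subtype_le_of_sum_le (f := fun x : Fin (2 * g + 4) → ℕ =>
      (∏ i, (x i : ℝ) ^ (-alph g)) *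
        (Set.ncard {w ∈ CcalR g M lam s n (imgF x) r | w ≠ firstThree g x} : ℝ))
      (by positivity) fun F hF => ?_
    refine (sum_mul_ncard_le hs F (fun x hx => (hF x hx).2) _
      (fun x _ => Set.sep_subset _ _) (fun J => ¬ ∀ i, headIdx g i ∈ J)
      (fun x hx w hw J hJ => TnInd.not_forall_headIdx_mem (hF x hx) hw.1.1 hw.2 hJ) _
      (fun x _ => by positivity) (K := K * (n : ℝ) ^ (-savedExp g))
      (fun J hJ hJ3 c F' hF' hc => TnInd.sum_le_of_constraint hg1 hlam hs hn hJ hJ3 F'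
        (fun x hx => hF x (hF' hx)) hc) (by positivity)).trans ?_
    rw [mul_assoc _ K]
    gcongr
    exact one_le_two
  · intro r₁ hr₁
    have hn1 : (1 : ℝ) ≤ n := by exact_mod_cast (by omega : 1 ≤ n)
    have hR : 1 ≤ r₁ := by
      exact_mod_cast (Real.one_le_rpow hn1 (by positivity)).trans hr₁
    refine tsum_subtype_le_of_sum_le (f := fun v : Fin (2 * g + 1) → ℕ =>
      (∏ i, (v i : ℝ) ^ (-alph g)) * (Set.ncard (CcalR g M lam s n (imgF v) r) : ℝ))
      (by positivity) fun F hF => ?_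
    refine (sum_mul_ncard_le hs F (fun v hv => (hF v hv).2.2.2.1) _ (fun v _ => subset_rfl)
      (fun _ => True) (fun _ _ _ _ _ _ => trivial) _ (fun v _ => by positivity)
      (K := K * (n : ℝ) ^ (-savedExp g)) (fun J hJ _ c F' hF' hc => ?_)
      (by positivity)).trans ?_
    · refine (Vr.sum_le_of_constraint hg1 hR hJ (c := n - c) F' (fun v hv => hF v (hF' hv))
        fun v hv => ?_).trans ?_
      · have := hc v hv
        omega
      · have h1 := rpow_neg_one_sub_alph_le hg1 le_rfl (by omega : 1 ≤ n)
          (by rwa [div_one] : (n : ℝ) ^ ((1 : ℝ) / g) / 1 ≤ r₁)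
        rw [one_mul] at h1
        have h2 : (n : ℝ) ^ (-(2 * savedExp g)) ≤ (n : ℝ) ^ (-savedExp g) :=
          Real.rpow_le_rpow_of_exponent_le hn1 (by linarith)
        exact mul_le_mul hTK (h1.trans h2) (by positivity) hK0.le
    · rw [mul_assoc _ K]
      gcongr
      · exact one_le_two
      · omega
      · exact one_le_two
end
end
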